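/- Let s ≥ 5 be an integer, let μ₁, …, μ_s be real numbers with μ₁ irrational, and let η > 0. Then meas(Z(N)) = o(N) as N → ∞; that is, for every ε > 0 there exists N₀ such that for all real N ≥ N₀ the Lebesgue measure of Z(N) is at most εN. -/

import Mathlib

open MeasureTheory

namespace ShiftedCubes

open Finset Filter Topology
open scoped ENNReal SchwartzMap FourierTransform

/-- The distance from a real number to the nearest integer. -/
noncomputable def nint (x : ℝ) : ℝ := |x - round x|

lemma nint_nonneg (x : ℝ) : 0 ≤ nint x := abs_nonneg _

lemma nint_le (x : ℝ) (z : ℤ) : nint x ≤ |x - z| := round_le x z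

lemma nint_le_add (x y : ℝ) : nint x ≤ nint y + |x - y| := by
  calc nint x ≤ |x - round y| := nint_le _ _
    _ = |(y - round y) + (x - y)| := by ring_nf
    _ ≤ _ := abs_add_le _ _

lemma nint_add_int (x : ℝ) (z : ℤ) : nint (x + z) = nint x := by
  unfold nint; rw [round_add_intCast]; push_cast; ring_nf

lemma nint_neg (x : ℝ) : nint (-x) = nint x := by
  have key : ∀ y, nint (-y) ≤ nint y := fun y => by
    calc nint (-y) ≤ |-y - ((-round y : ℤ) : ℝ)| := nint_le _ _
      _ = nint y := by
        unfold nint; push_cast; rw [← abs_neg]; ring_nf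
  exact le_antisymm (key x) (by simpa using key (-x))

lemma nint_eq_abs {x : ℝ} (hx : |x| ≤ 1 / 2) : nint x = |x| := by
  apply le_antisymm (by simpa using nint_le x 0)
  unfold nint
  by_cases h : round x = 0
  · simp [h]
  · have h1 : (1 : ℝ) ≤ |(round x : ℝ)| := by
      have := Int.one_le_abs h
      exact_mod_cast this
    have h2 : |(round x : ℝ)| ≤ |x - round x| + |x| := by
      calc |(round x : ℝ)| = |x - (x - round x)| := by ring_nf
        _ ≤ |x| + |x - round x| := abs_sub _ _
        _ = _ := by ring
    linarith

/-- The majorant `≍ min (L, 1 / ‖x‖)` for a geometric sum of length `L`. -/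
noncomputable def wt (L : ℕ) (x : ℝ) : ℝ := L / (1 + L * nint x)

lemma wt_den_pos (L : ℕ) (x : ℝ) : 0 < 1 + L * nint x := by
  have := nint_nonneg x; positivity

lemma wt_nonneg (L : ℕ) (x : ℝ) : 0 ≤ wt L x :=
  div_nonneg (Nat.cast_nonneg _) (wt_den_pos L x).le

lemma wt_le (L : ℕ) (x : ℝ) : wt L x ≤ L := by
  unfold wt
  apply div_le_self (Nat.cast_nonneg _)
  have := nint_nonneg x
  have : 0 ≤ L * nint x := by positivity
  linarith

lemma wt_neg (L : ℕ) (x : ℝ) : wt L (-x) = wt L x := by unfold wt; rw [nint_neg]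

lemma wt_le_inv (L : ℕ) {x t : ℝ} (ht : 0 < t) (h : t ≤ nint x) : wt L x ≤ 1 / t := by
  unfold wt
  rw [div_le_div_iff₀ (wt_den_pos L x) ht]
  have : (L : ℝ) * t ≤ L * nint x := by gcongr
  linarith

/-- The additive character `x ↦ exp (2πix)`. -/
noncomputable def e (x : ℝ) : ℂ := Complex.exp (2 * Real.pi * x * Complex.I)

lemma e_add (x y : ℝ) : e (x + y) = e x * e y := by
  unfold e; rw [← Complex.exp_add]; push_cast; ring_nf

lemma norm_e (x : ℝ) : ‖e x‖ = 1 := by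
  unfold e
  have := Complex.norm_exp_ofReal_mul_I (2 * Real.pi * x)
  push_cast at this
  exact this

lemma e_zero : e 0 = 1 := by simp [e]

lemma conj_e (x : ℝ) : (starRingEnd ℂ) (e x) = e (-x) := by
  unfold e
  rw [← Complex.exp_conj]
  simp [Complex.conj_ofNat]

lemma e_mul_conj (x y : ℝ) : e x * (starRingEnd ℂ) (e y) = e (x - y) := by
  rw [conj_e, ← e_add, sub_eq_add_neg]

lemma e_int (z : ℤ) : e z = 1 := by
  unfold e
  rw [Complex.exp_eq_one_iff]
  exact ⟨z, by push_cast; ring⟩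

lemma continuous_e : Continuous e := by unfold e; fun_prop

lemma norm_e_sub_one (x : ℝ) : ‖e x - 1‖ = 2 * |Real.sin (Real.pi * x)| := by
  have := Complex.norm_exp_I_mul_ofReal_sub_one (2 * Real.pi * x)
  rw [show 2 * Real.pi * x / 2 = Real.pi * x by ring] at this
  rw [norm_mul, Real.norm_eq_abs, Real.norm_eq_abs, abs_two] at this
  rw [← this]
  unfold e; push_cast; ring_nf

lemma norm_e_sub_one_le (x : ℝ) : ‖e x - 1‖ ≤ 2 * Real.pi * |x| := by
  rw [norm_e_sub_one]
  have := Real.abs_sin_le_abs (x := Real.pi * x)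
  rw [abs_mul, abs_of_pos Real.pi_pos] at this
  linarith

lemma four_nint_le (x : ℝ) : 4 * nint x ≤ ‖e x - 1‖ := by
  have h1 : e x = e (x - round x) := by
    conv_lhs => rw [show x = (x - round x) + (round x : ℤ) by ring]
    rw [e_add, e_int, mul_one]
  rw [h1, norm_e_sub_one]
  have hpi := Real.pi_pos
  have h2 : |Real.pi * (x - round x)| ≤ Real.pi / 2 := by
    rw [abs_mul, abs_of_pos hpi]
    have := abs_sub_round x
    nlinarith
  have h3 := Real.mul_abs_le_abs_sin h2
  rw [abs_mul, abs_of_pos hpi] at h3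
  have h4 : 2 / Real.pi * (Real.pi * |x - round x|) = 2 * nint x := by
    unfold nint; field_simp
  linarith

lemma telescope_geom (z : ℂ) (hz : z ≠ 0) {a b : ℤ} (hab : a ≤ b) :
    (z - 1) * ∑ n ∈ Ico a b, z ^ n = z ^ b - z ^ a := by
  induction b, hab using Int.leInduction with
  | base => simp
  | succ k hk ih =>
    rw [← Finset.insert_Ico_right_eq_Ico_add_one hk, Finset.sum_insert (by simp), mul_add, ih,
      zpow_add_one₀ hz]
    ring

lemma norm_geom_le (θ γ : ℝ) (L : ℕ) (a b : ℤ) (hab : b - a ≤ L) :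
    ‖∑ n ∈ Ico a b, e (θ * n + γ)‖ ≤ 2 * wt L θ := by
  rcases le_or_gt a b with h | h
  swap
  · rw [Finset.Ico_eq_empty (by omega)]
    simpa using wt_nonneg L θ
  have hz : e θ ≠ 0 := by
    intro h0; have := norm_e θ; rw [h0] at this; simp at this
  have hpow : ∀ n : ℤ, e (θ * n + γ) = e γ * (e θ) ^ n := by
    intro n
    rw [e_add, mul_comm]
    congr 1
    unfold e
    rw [← Complex.exp_int_mul]
    push_cast; ring_nf
  have h1 : ‖∑ n ∈ Ico a b, e (θ * n + γ)‖ = ‖∑ n ∈ Ico a b, (e θ) ^ n‖ := by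
    simp_rw [hpow, ← Finset.mul_sum, norm_mul, norm_e, one_mul]
  rw [h1]
  set S := ‖∑ n ∈ Ico a b, (e θ) ^ n‖
  have hS0 : 0 ≤ S := norm_nonneg _
  have h2 : ‖e θ - 1‖ * S ≤ 2 := by
    rw [← norm_mul, telescope_geom _ hz h]
    refine (norm_sub_le _ _).trans ?_
    rw [norm_zpow, norm_zpow, norm_e]; norm_num
  have h3 : S ≤ L := by
    refine (norm_sum_le _ _).trans ?_
    simp only [norm_zpow, norm_e, one_zpow, Finset.sum_const, Int.card_Ico, nsmul_eq_mul, mul_one]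
    have : ((b - a).toNat : ℤ) ≤ L := by rw [Int.toNat_of_nonneg (by omega)]; exact hab
    exact_mod_cast this
  have h4 := four_nint_le θ
  have h5 : 4 * nint θ * S ≤ 2 := (mul_le_mul_of_nonneg_right h4 hS0).trans h2
  unfold wt
  rw [← mul_div_assoc, le_div_iff₀ (wt_den_pos L θ)]
  have h6 : (L : ℝ) * (4 * nint θ * S) ≤ L * 2 := by gcongr
  nlinarith

lemma sq_norm_sum_le (g : ℤ → ℂ) (L : ℕ) (a b : ℤ) (hab : b - a ≤ L) :
    ‖∑ n ∈ Ico a b, g n‖ ^ 2 ≤ ∑ h ∈ Ioo (-(L : ℤ)) L,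
      ‖∑ n ∈ Ico (max a (a - h)) (min b (b - h)), g (n + h) * (starRingEnd ℂ) (g n)‖ := by
  have h1 : (∑ n ∈ Ico a b, g n) * (starRingEnd ℂ) (∑ n ∈ Ico a b, g n) =
      ∑ h ∈ Ioo (-(L : ℤ)) L, ∑ n ∈ Ico (max a (a - h)) (min b (b - h)),
        g (n + h) * (starRingEnd ℂ) (g n) := by
    rw [map_sum, Finset.sum_mul_sum, ← Finset.sum_product', Finset.sum_sigma']
    refine Finset.sum_bij' (fun p _ => ⟨p.1 - p.2, p.2⟩) (fun p _ => (p.2 + p.1, p.2))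
      ?_ ?_ ?_ ?_ ?_
    · rintro ⟨m, n⟩ h
      simp only [Finset.mem_product, Finset.mem_Ico, Finset.mem_sigma, Finset.mem_Ioo] at h ⊢
      omega
    · rintro ⟨m, n⟩ h
      simp only [Finset.mem_product, Finset.mem_Ico, Finset.mem_sigma, Finset.mem_Ioo] at h ⊢
      omega
    · rintro ⟨m, n⟩ h
      simp
    · rintro ⟨m, n⟩ h
      simp
    · rintro ⟨m, n⟩ h
      simp
  have h2 : ‖∑ n ∈ Ico a b, g n‖ ^ 2 =
      ‖(∑ n ∈ Ico a b, g n) * (starRingEnd ℂ) (∑ n ∈ Ico a b, g n)‖ := by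
    rw [norm_mul, RCLike.norm_conj, sq]
  rw [h2, h1]
  exact norm_sum_le _ _

/-- The exponential sum over shifted cubes `(n + c) ^ 3`, `0 ≤ n < L`. -/
noncomputable def cubeSum (c : ℝ) (L : ℕ) (α : ℝ) : ℂ :=
  ∑ n ∈ Ico (0 : ℤ) L, e (α * ((n : ℝ) + c) ^ 3)

/-- The double sum that majorises fourth powers of cubic exponential sums. -/
noncomputable def weylSum (L : ℕ) (θ : ℝ) : ℝ :=
  ∑ h ∈ Icc 1 L, ∑ k ∈ Icc 1 L, wt L ((h : ℝ) * k * θ)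

lemma sum_Ioo_even_le (G : ℤ → ℝ) (h0 : ∀ n, 0 ≤ G n) (heven : ∀ n, G (-n) = G n) (L : ℕ) :
    ∑ h ∈ Ioo (-(L : ℤ)) L, G h ≤ G 0 + 2 * ∑ h ∈ Icc 1 L, G (h : ℕ) := by
  have hsub : Ioo (-(L : ℤ)) L ⊆ {0} ∪ ((Icc 1 L).image (fun n : ℕ => (n : ℤ)) ∪
      (Icc 1 L).image (fun n : ℕ => -(n : ℤ))) := by
    intro h hh
    simp only [Finset.mem_Ioo] at hh
    simp only [Finset.mem_union, Finset.mem_singleton, Finset.mem_image, Finset.mem_Icc]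
    rcases lt_trichotomy h 0 with h1 | h1 | h1
    · exact Or.inr (Or.inr ⟨h.natAbs, by omega, by omega⟩)
    · exact Or.inl h1
    · exact Or.inr (Or.inl ⟨h.natAbs, by omega, by omega⟩)
  have hU : ∀ s t : Finset ℤ, ∑ h ∈ s ∪ t, G h ≤ ∑ h ∈ s, G h + ∑ h ∈ t, G h := fun s t => by
    rw [← Finset.sum_union_inter]
    exact le_add_of_nonneg_right (Finset.sum_nonneg fun _ _ => h0 _)
  refine (Finset.sum_le_sum_of_subset_of_nonneg hsub fun _ _ _ => h0 _).trans ?_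
  refine (hU _ _).trans ?_
  rw [Finset.sum_singleton, two_mul]
  gcongr
  refine (hU _ _).trans ?_
  rw [Finset.sum_image (fun x _ y _ h => by simpa using h),
    Finset.sum_image (fun x _ y _ h => by simpa using h)]
  simp_rw [heven]
  exact le_rfl

lemma card_Ioo_le (L : ℕ) : ((Ioo (-(L : ℤ)) L).card : ℝ) ≤ 2 * L := by
  rw [Int.card_Ioo]
  have : ((L : ℤ) - -(L : ℤ) - 1).toNat ≤ 2 * L := by omega
  exact_mod_cast this

theorem norm_cubeSum_pow_four_le (c : ℝ) (L : ℕ) (α : ℝ) :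
    ‖cubeSum c L α‖ ^ 4 ≤ 16 * L * ((L : ℝ) ^ 2 + weylSum L (6 * α)) := by
  have h1 : ‖cubeSum c L α‖ ^ 2 ≤ ∑ h ∈ Ioo (-(L : ℤ)) L,
      ‖∑ n ∈ Ico (max 0 (0 - h)) (min (L : ℤ) (L - h)),
        e (α * ((((n + h : ℤ) : ℝ) + c) ^ 3 - ((n : ℝ) + c) ^ 3))‖ := by
    refine (sq_norm_sum_le _ L 0 L (by simp)).trans (le_of_eq ?_)
    refine Finset.sum_congr rfl fun h _ => ?_
    congr 1
    refine Finset.sum_congr rfl fun n _ => ?_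
    rw [e_mul_conj, mul_sub]
  have h2 : ∀ h ∈ Ioo (-(L : ℤ)) L, ‖∑ n ∈ Ico (max 0 (0 - h)) (min (L : ℤ) (L - h)),
        e (α * ((((n + h : ℤ) : ℝ) + c) ^ 3 - ((n : ℝ) + c) ^ 3))‖ ^ 2 ≤
      ∑ k ∈ Ioo (-(L : ℤ)) L, 2 * wt L ((h : ℝ) * k * (6 * α)) := by
    intro h _
    refine (sq_norm_sum_le _ L _ _ (by omega)).trans ?_
    refine Finset.sum_le_sum fun k _ => ?_
    have hcg : ∀ n : ℤ, e (α * (((((n + k : ℤ) + h : ℤ) : ℝ) + c) ^ 3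
          - (((n + k : ℤ) : ℝ) + c) ^ 3)) *
        (starRingEnd ℂ) (e (α * ((((n + h : ℤ) : ℝ) + c) ^ 3 - ((n : ℝ) + c) ^ 3))) =
        e (((h : ℝ) * k * (6 * α)) * n + α * (6 * c * h * k + 3 * h ^ 2 * k + 3 * h * k ^ 2)) := by
      intro n
      rw [e_mul_conj]
      congr 1
      push_cast; ring
    simp_rw [hcg]
    exact norm_geom_le _ _ L _ _ (by omega)
  have h3 : ‖cubeSum c L α‖ ^ 4 ≤ (2 * L) * ∑ h ∈ Ioo (-(L : ℤ)) L,
      ∑ k ∈ Ioo (-(L : ℤ)) L, 2 * wt L ((h : ℝ) * k * (6 * α)) := by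
    calc ‖cubeSum c L α‖ ^ 4 = (‖cubeSum c L α‖ ^ 2) ^ 2 := by ring
      _ ≤ _ := pow_le_pow_left₀ (by positivity) h1 2
      _ ≤ _ := sq_sum_le_card_mul_sum_sq
      _ ≤ _ := mul_le_mul (card_Ioo_le L) (Finset.sum_le_sum h2)
          (Finset.sum_nonneg fun _ _ => by positivity) (by positivity)
  have h4 : ∀ h : ℤ, ∑ k ∈ Ioo (-(L : ℤ)) L, wt L ((h : ℝ) * k * (6 * α)) ≤
      L + 2 * ∑ k ∈ Icc 1 L, wt L ((h : ℝ) * k * (6 * α)) := by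
    intro h
    refine (sum_Ioo_even_le (fun k => wt L ((h : ℝ) * k * (6 * α))) (fun _ => wt_nonneg _ _)
      (fun n => ?_) L).trans ?_
    · rw [← wt_neg]; push_cast; ring_nf
    · simp only [Int.cast_natCast]
      gcongr
      exact wt_le _ _
  have h5 : ∑ h ∈ Ioo (-(L : ℤ)) L, ∑ k ∈ Icc 1 L, wt L ((h : ℝ) * k * (6 * α)) ≤
      (L : ℝ) ^ 2 + 2 * weylSum L (6 * α) := by
    refine (sum_Ioo_even_le (fun h => ∑ k ∈ Icc 1 L, wt L ((h : ℝ) * k * (6 * α)))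
      (fun _ => Finset.sum_nonneg fun _ _ => wt_nonneg _ _) (fun n => ?_) L).trans ?_
    · refine Finset.sum_congr rfl fun k _ => ?_
      rw [← wt_neg]; push_cast; ring_nf
    · simp only [Int.cast_natCast]
      unfold weylSum
      gcongr
      refine (Finset.sum_le_sum fun k _ => wt_le L _).trans ?_
      simp [sq]
  have h6 : ∑ h ∈ Ioo (-(L : ℤ)) L, ∑ k ∈ Ioo (-(L : ℤ)) L, wt L ((h : ℝ) * k * (6 * α)) ≤
      4 * ((L : ℝ) ^ 2 + weylSum L (6 * α)) := by
    refine (Finset.sum_le_sum fun h _ => h4 h).trans ?_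
    rw [Finset.sum_add_distrib, ← Finset.mul_sum, Finset.sum_const, nsmul_eq_mul]
    have := card_Ioo_le L
    have : ((Ioo (-(L : ℤ)) L).card : ℝ) * L ≤ 2 * L * L := by gcongr
    nlinarith
  refine h3.trans ?_
  simp_rw [← Finset.mul_sum]
  have : (0 : ℝ) ≤ L := Nat.cast_nonneg _
  nlinarith [mul_le_mul_of_nonneg_left h6 this]

lemma nint_intCast_div {q : ℕ} (hq : 0 < q) (m : ℤ) :
    nint ((m : ℝ) / q) = nint (((m % q).toNat : ℝ) / q) := by
  have hq' : (q : ℝ) ≠ 0 := by positivity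
  have h0 : 0 ≤ m % (q : ℤ) := Int.emod_nonneg _ (by omega)
  have h1 : ((m % q).toNat : ℝ) = ((m % q : ℤ) : ℝ) := by
    have h3 : (((m % q).toNat : ℤ) : ℝ) = ((m % q : ℤ) : ℝ) := by
      rw [Int.toNat_of_nonneg h0]
    rw [← h3, Int.cast_natCast]
  have h2 : (m : ℝ) / q = ((m % q).toNat : ℝ) / q + ((m / q : ℤ) : ℝ) := by
    rw [h1]
    have := Int.emod_add_mul_ediv m q
    have : (m : ℝ) = ((m % q : ℤ) : ℝ) + q * ((m / q : ℤ) : ℝ) := by exact_mod_cast this.symm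
    field_simp
    linarith
  rw [h2, nint_add_int]

lemma nint_natCast_div {q r : ℕ} (hr : r < q) :
    nint ((r : ℝ) / q) = (min r (q - r) : ℕ) / (q : ℝ) := by
  unfold nint
  rw [abs_sub_round_div_natCast_eq, Nat.mod_eq_of_lt hr]

lemma inv_nint_le {q r : ℕ} (hr : r < q) :
    (nint ((r : ℝ) / q))⁻¹ ≤ q * ((r : ℝ)⁻¹ + ((q - r : ℕ) : ℝ)⁻¹) := by
  rw [nint_natCast_div hr, inv_div, div_eq_mul_inv]
  gcongr
  rcases le_total r (q - r) with h | h
  · rw [min_eq_left h]; linarith [inv_nonneg.mpr (Nat.cast_nonneg (α := ℝ) (q - r))]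
  · rw [min_eq_right h]; linarith [inv_nonneg.mpr (Nat.cast_nonneg (α := ℝ) r)]

lemma sum_range_inv_le {q : ℕ} :
    ∑ r ∈ range q, ((r : ℝ))⁻¹ ≤ 1 + Real.log q := by
  have h1 := harmonic_le_one_add_log q
  refine le_trans ?_ h1
  unfold harmonic
  push_cast
  rw [← Finset.sum_range_succ_sub_top]
  rw [Finset.sum_range_succ']
  simp

lemma sum_inv_nint_le {q : ℕ} (hq : 0 < q) :
    ∑ r ∈ range q, (nint ((r : ℝ) / q))⁻¹ ≤ 4 * q * (1 + Real.log q) := by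
  have h1 := sum_range_inv_le (q := q)
  have h2 : ∑ r ∈ range q, (((q - r : ℕ) : ℝ))⁻¹ ≤ 2 * (1 + Real.log q) := by
    rw [← Finset.sum_range_reflect]
    have : ∀ j ∈ range q, (((q - (q - 1 - j) : ℕ) : ℝ))⁻¹ = (((j + 1 : ℕ)) : ℝ)⁻¹ := by
      intro j hj
      rw [Finset.mem_range] at hj
      congr 3; omega
    rw [Finset.sum_congr rfl this]
    have h3 := harmonic_le_one_add_log q
    unfold harmonic at h3
    push_cast at h3 ⊢
    have hlog : 0 ≤ Real.log q := Real.log_natCast_nonneg q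
    linarith
  calc ∑ r ∈ range q, (nint ((r : ℝ) / q))⁻¹
      ≤ ∑ r ∈ range q, q * ((r : ℝ)⁻¹ + ((q - r : ℕ) : ℝ)⁻¹) :=
        Finset.sum_le_sum fun r hr => inv_nint_le (Finset.mem_range.mp hr)
    _ = q * (∑ r ∈ range q, (r : ℝ)⁻¹ + ∑ r ∈ range q, ((q - r : ℕ) : ℝ)⁻¹) := by
        rw [← Finset.mul_sum, Finset.sum_add_distrib]
    _ ≤ q * (4 * (1 + Real.log q)) := by
        gcongr
        have hlog : 0 ≤ Real.log q := Real.log_natCast_nonneg q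
        linarith
    _ = _ := by ring

lemma sum_range_mul_le (f : ℕ → ℝ) (q J : ℕ) (B : ℝ)
    (h : ∀ n₀, ∑ j ∈ range q, f (n₀ + j) ≤ B) : ∑ n ∈ range (q * J), f n ≤ J * B := by
  induction J with
  | zero => simp
  | succ J ih =>
    rw [Nat.mul_succ, Finset.sum_range_add]
    push_cast
    linarith [h (q * J)]

lemma sum_Icc_le_blocks (f : ℕ → ℝ) (hf : ∀ n, 0 ≤ f n) {q : ℕ} (hq : 0 < q) (X : ℕ) (B : ℝ)
    (hB : 0 ≤ B) (h : ∀ n₀, ∑ j ∈ range q, f (n₀ + j) ≤ B) :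
    ∑ n ∈ Icc 1 X, f n ≤ ((X : ℝ) / q + 1) * B := by
  have hsub : Icc 1 X ⊆ range (q * (X / q + 1)) := by
    intro n hn
    rw [Finset.mem_Icc] at hn
    rw [Finset.mem_range]
    have := Nat.lt_mul_div_succ X hq
    omega
  refine (Finset.sum_le_sum_of_subset_of_nonneg hsub fun _ _ _ => hf _).trans ?_
  refine (sum_range_mul_le f q _ B h).trans ?_
  gcongr
  push_cast
  gcongr
  exact Nat.cast_div_le

/-- Residues of an arithmetic progression with difference coprime to the modulus. -/
lemma injOn_residue {q : ℕ} {b : ℤ} (hb : IsCoprime b (q : ℤ)) (A : ℤ) :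
    Set.InjOn (fun j : ℕ => ((A + j * b) % (q : ℤ)).toNat) (range q : Finset ℕ) := by
  intro i hi j hj hij
  rw [Finset.mem_coe, Finset.mem_range] at hi hj
  have hq : (q : ℤ) ≠ 0 := by omega
  have h1 : (A + i * b) % (q : ℤ) = (A + j * b) % (q : ℤ) := by
    have hi0 := Int.emod_nonneg (A + i * b) hq
    have hj0 := Int.emod_nonneg (A + j * b) hq
    simp only at hij
    omega
  have h2 : (q : ℤ) ∣ (i - j) * b := by
    have := Int.emod_emod_of_dvd
    have h3 := (Int.emod_eq_emod_iff_emod_sub_eq_zero).mp h1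
    have h4 := Int.dvd_of_emod_eq_zero h3
    convert h4 using 1; ring
  have h3 : (q : ℤ) ∣ (i - j : ℤ) := hb.symm.dvd_of_dvd_mul_right h2
  have h4 : ((i : ℤ) - j) = 0 := by
    apply Int.eq_zero_of_abs_lt_dvd h3
    rw [abs_lt]; omega
  omega

lemma sum_residue_le {q : ℕ} (hq : 0 < q) {b : ℤ} (hb : IsCoprime b (q : ℤ)) (A : ℤ)
    (W : ℕ → ℝ) (hW : ∀ r, 0 ≤ W r) :
    ∑ j ∈ range q, W ((A + j * b) % (q : ℤ)).toNat ≤ ∑ r ∈ range q, W r := by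
  rw [← Finset.sum_image (f := W) (injOn_residue hb A)]
  refine Finset.sum_le_sum_of_subset_of_nonneg ?_ fun _ _ _ => hW _
  intro r hr
  rw [Finset.mem_image] at hr
  obtain ⟨j, _, rfl⟩ := hr
  rw [Finset.mem_range]
  have h1 := Int.emod_lt_of_pos (A + j * b) (by omega : (0 : ℤ) < q)
  have h2 := Int.emod_nonneg (A + j * b) (by omega : (q : ℤ) ≠ 0)
  omega

lemma one_add_log_nonneg (q : ℕ) : 0 ≤ 1 + Real.log q := by
  have := Real.log_natCast_nonneg q; linarith

lemma sum_inv_nint_mul_le_of_coprime {q : ℕ} (hq : 0 < q) {b : ℤ} (hb : IsCoprime b (q : ℤ))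
    (X : ℕ) : ∑ k ∈ Icc 1 X, (nint ((k : ℝ) * b / q))⁻¹ ≤ 4 * (X + q) * (1 + Real.log q) := by
  have hq' : (0 : ℝ) < q := by exact_mod_cast hq
  have hlog := one_add_log_nonneg q
  refine (sum_Icc_le_blocks (fun k : ℕ => (nint ((k : ℝ) * b / q))⁻¹)
    (fun _ => inv_nonneg.mpr (nint_nonneg _)) hq X
    (4 * q * (1 + Real.log q)) (by positivity) fun n₀ => ?_).trans (le_of_eq (by field_simp))
  have h1 : ∀ j ∈ range q, (nint (((n₀ + j : ℕ) : ℝ) * b / q))⁻¹ =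
      (nint (((((n₀ : ℤ) * b + j * b) % (q : ℤ)).toNat : ℝ) / q))⁻¹ := by
    intro j _
    rw [← nint_intCast_div hq]
    push_cast; ring_nf
  rw [Finset.sum_congr rfl h1]
  exact (sum_residue_le hq hb _ (fun r => (nint ((r : ℝ) / q))⁻¹)
    (fun _ => inv_nonneg.mpr (nint_nonneg _))).trans (sum_inv_nint_le hq)

lemma sum_inv_nint_mul_le {q : ℕ} (hq : 0 < q) (b : ℤ) (X : ℕ) :
    ∑ k ∈ Icc 1 X, (nint ((k : ℝ) * b / q))⁻¹ ≤ 4 * (X + q) * (1 + Real.log q) := by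
  set r : ℚ := (b : ℚ) / q with hr
  have hden : r.den ∣ q := by
    have h := Rat.den_dvd b q
    rw [Rat.divInt_eq_div, Int.cast_natCast, ← hr] at h
    exact_mod_cast h
  have hle : r.den ≤ q := Nat.le_of_dvd hq hden
  have h1 := sum_inv_nint_mul_le_of_coprime r.den_pos
    (Int.isCoprime_iff_gcd_eq_one.mpr (by simpa [Int.gcd] using r.reduced) :
      IsCoprime r.num (r.den : ℤ)) X
  have h2 : ∀ k : ℕ, (k : ℝ) * b / q = (k : ℝ) * r.num / r.den := by
    intro k
    have h3 : (r : ℝ) = b / q := by rw [hr]; push_cast; rfl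
    rw [mul_div_assoc, mul_div_assoc, ← h3]
    congr 1
    exact Rat.cast_def r
  simp_rw [h2]
  refine h1.trans ?_
  have hle' : (r.den : ℝ) ≤ q := by exact_mod_cast hle
  have hpos : (0 : ℝ) < r.den := by exact_mod_cast r.den_pos
  have := one_add_log_nonneg r.den
  gcongr

lemma sum_block_wt_le {q : ℕ} (hq : 0 < q) {a : ℤ} (ha : IsCoprime a (q : ℤ)) {θ : ℝ}
    (hθ : |θ - a / q| ≤ 1 / (q : ℝ) ^ 2) (L n₀ : ℕ) :
    ∑ j ∈ range q, wt L (((n₀ + j : ℕ) : ℝ) * θ) ≤ 8 * (L + q * (1 + Real.log q)) := by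
  have hq' : (0 : ℝ) < q := by exact_mod_cast hq
  set A : ℤ := ⌊q * (n₀ * θ)⌋ with hA
  set W : ℕ → ℝ := fun r => 2 * (nint ((r : ℝ) / q))⁻¹ +
    if nint ((r : ℝ) / q) < 4 / q then (L : ℝ) else 0 with hWdef
  have hW : ∀ r, 0 ≤ W r := by
    intro r
    have := inv_nonneg.mpr (nint_nonneg ((r : ℝ) / q))
    have h2 : (0 : ℝ) ≤ if nint ((r : ℝ) / q) < 4 / q then (L : ℝ) else 0 := by
      split_ifs <;> positivity
    simp only [hWdef]; linarith
  have h1 : ∀ j ∈ range q, wt L (((n₀ + j : ℕ) : ℝ) * θ) ≤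
      W ((A + j * a) % (q : ℤ)).toNat := by
    intro j hj
    rw [Finset.mem_range] at hj
    have hj' : (j : ℝ) ≤ q := by exact_mod_cast hj.le
    set r := ((A + j * a) % (q : ℤ)).toNat with hr
    have hnr : nint (((A + j * a : ℤ) : ℝ) / q) = nint ((r : ℝ) / q) := nint_intCast_div hq _
    have hclose : |((A + j * a : ℤ) : ℝ) / q - ((n₀ + j : ℕ) : ℝ) * θ| ≤ 2 / q := by
      have e1 : ((A + j * a : ℤ) : ℝ) / q - ((n₀ + j : ℕ) : ℝ) * θ =
          (A - q * (n₀ * θ)) / q - j * (θ - a / q) := by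
        push_cast; field_simp; ring
      rw [e1]
      refine (abs_sub _ _).trans ?_
      have e2 : |((A : ℝ) - q * (n₀ * θ)) / q| ≤ 1 / q := by
        rw [abs_div, abs_of_pos hq']
        gcongr
        rw [abs_le]
        have := Int.floor_le (q * (n₀ * θ))
        have := Int.lt_floor_add_one (q * (n₀ * θ))
        constructor <;> linarith
      have e3 : |(j : ℝ) * (θ - a / q)| ≤ 1 / q := by
        rw [abs_mul, abs_of_nonneg (Nat.cast_nonneg j)]
        calc (j : ℝ) * |θ - a / q| ≤ q * (1 / (q : ℝ) ^ 2) := by gcongr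
          _ = 1 / q := by field_simp
      calc _ ≤ 1 / (q : ℝ) + 1 / q := add_le_add e2 e3
        _ = 2 / q := by ring
    have hn := nint_le_add (((A + j * a : ℤ) : ℝ) / q) (((n₀ + j : ℕ) : ℝ) * θ)
    rw [hnr] at hn
    simp only [hWdef]
    split_ifs with hc
    · have := inv_nonneg.mpr (nint_nonneg ((r : ℝ) / q))
      have := wt_le L (((n₀ + j : ℕ) : ℝ) * θ)
      linarith
    · push Not at hc
      have hpos : 0 < nint ((r : ℝ) / q) := lt_of_lt_of_le (by positivity) hc
      have h5 : nint ((r : ℝ) / q) / 2 ≤ nint (((n₀ + j : ℕ) : ℝ) * θ) := by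
        have : 2 / (q : ℝ) ≤ nint ((r : ℝ) / q) / 2 := by
          calc 2 / (q : ℝ) = (4 / q) / 2 := by ring
            _ ≤ _ := by gcongr
        linarith
      refine (wt_le_inv L (by positivity) h5).trans (le_of_eq ?_)
      field_simp; ring
  refine (Finset.sum_le_sum h1).trans ?_
  refine (sum_residue_le hq ha A W hW).trans ?_
  simp only [hWdef]
  rw [Finset.sum_add_distrib, ← Finset.mul_sum, ← Finset.sum_filter, Finset.sum_const, nsmul_eq_mul]
  have h2 := sum_inv_nint_le hq
  have h3 : (((range q).filter fun r : ℕ => nint ((r : ℝ) / q) < 4 / q).card : ℝ) ≤ 8 := by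
    have hsub : ((range q).filter fun r : ℕ => nint ((r : ℝ) / q) < 4 / q) ⊆
        range 4 ∪ Ico (q - 4) q := by
      intro r hr
      rw [Finset.mem_filter, Finset.mem_range] at hr
      obtain ⟨hrq, hr⟩ := hr
      rw [nint_natCast_div hrq, div_lt_div_iff_of_pos_right hq'] at hr
      have : min r (q - r) < 4 := by exact_mod_cast hr
      rw [Finset.mem_union, Finset.mem_range, Finset.mem_Ico]
      omega
    have hc : ((range q).filter fun r : ℕ => nint ((r : ℝ) / q) < 4 / q).card ≤ 8 := by
      refine (Finset.card_le_card hsub).trans ((Finset.card_union_le _ _).trans ?_)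
      rw [Finset.card_range, Nat.card_Ico]
      omega
    exact_mod_cast hc
  have : (((range q).filter fun r : ℕ => nint ((r : ℝ) / q) < 4 / q).card : ℝ) * L ≤ 8 * L := by
    gcongr
  linarith

lemma weylSum_le_of_card_divisors_le {L : ℕ} (θ D : ℝ)
    (hD : ∀ n ∈ Icc 1 (L ^ 2), ((Nat.divisors n).card : ℝ) ≤ D) :
    weylSum L θ ≤ D * ∑ n ∈ Icc 1 (L ^ 2), wt L (n * θ) := by
  unfold weylSum
  rw [← Finset.sum_product']
  have hmaps : ∀ p ∈ Icc 1 L ×ˢ Icc 1 L, p.1 * p.2 ∈ Icc 1 (L ^ 2) := by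
    intro p hp
    simp only [Finset.mem_product, Finset.mem_Icc] at hp ⊢
    constructor
    · exact Nat.mul_pos hp.1.1 hp.2.1
    · rw [sq]; exact Nat.mul_le_mul hp.1.2 hp.2.2
  rw [← Finset.sum_fiberwise_of_maps_to hmaps, Finset.mul_sum]
  refine Finset.sum_le_sum fun n hn => ?_
  have h1 : ∀ p ∈ (Icc 1 L ×ˢ Icc 1 L).filter (fun p => p.1 * p.2 = n),
      wt L ((p.1 : ℝ) * p.2 * θ) = wt L (n * θ) := by
    intro p hp
    rw [← (Finset.mem_filter.mp hp).2]; push_cast; rfl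
  rw [Finset.sum_congr rfl h1, Finset.sum_const, nsmul_eq_mul]
  refine mul_le_mul_of_nonneg_right ?_ (wt_nonneg _ _)
  refine le_trans ?_ (hD n hn)
  norm_cast
  refine Finset.card_le_card_of_injOn Prod.fst (fun p hp => ?_) fun p hp p' hp' h => ?_
  · rw [Finset.mem_coe, Finset.mem_filter] at hp
    rw [Finset.mem_Icc] at hn
    rw [Finset.mem_coe, Nat.mem_divisors]
    exact ⟨⟨p.2, hp.2.symm⟩, by omega⟩
  · rw [Finset.mem_coe, Finset.mem_filter, Finset.mem_product, Finset.mem_Icc] at hp hp'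
    refine Prod.ext h (Nat.eq_of_mul_eq_mul_left hp.1.1.1 ?_)
    rw [hp.2, h, hp'.2]

theorem weylSum_le_minor {L q : ℕ} (hq : 0 < q) {a : ℤ} (ha : IsCoprime a (q : ℤ)) {θ D : ℝ}
    (hθ : |θ - a / q| ≤ 1 / (q : ℝ) ^ 2) (hD0 : 0 ≤ D)
    (hD : ∀ n ∈ Icc 1 (L ^ 2), ((Nat.divisors n).card : ℝ) ≤ D) :
    weylSum L θ ≤ D * (((L : ℝ) ^ 2 / q + 1) * (8 * (L + q * (1 + Real.log q)))) := by
  refine (weylSum_le_of_card_divisors_le θ D hD).trans ?_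
  gcongr
  have := one_add_log_nonneg q
  have h := sum_Icc_le_blocks (fun n : ℕ => wt L (n * θ)) (fun _ => wt_nonneg _ _) hq (L ^ 2)
    (8 * (L + q * (1 + Real.log q))) (by positivity) (fun n₀ => sum_block_wt_le hq ha hθ L n₀)
  push_cast at h
  exact h

lemma sum_rpow_le (J : ℕ) :
    ∑ j ∈ Icc 1 J, (j : ℝ) ^ (-(2 / 3) : ℝ) ≤ 3 * (J : ℝ) ^ (1 / 3 : ℝ) := by
  induction J with
  | zero => simp
  | succ J ih =>
    rw [← Finset.insert_Icc_right_eq_Icc_add_one (by omega), Finset.sum_insert (by simp)]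
    set u := ((J + 1 : ℕ) : ℝ) ^ (1 / 3 : ℝ) with hu
    set v := (J : ℝ) ^ (1 / 3 : ℝ) with hv
    have hu0 : 0 < u := by positivity
    have hv0 : 0 ≤ v := by positivity
    have hu3 : u ^ 3 = J + 1 := by
      rw [hu, ← Real.rpow_natCast, ← Real.rpow_mul (by positivity)]; norm_num
    have hv3 : v ^ 3 = J := by
      rw [hv, ← Real.rpow_natCast, ← Real.rpow_mul (by positivity)]; norm_num
    have huv : v ≤ u := by
      rw [hu, hv]; gcongr; omega
    have h1 : ((J + 1 : ℕ) : ℝ) ^ (-(2 / 3) : ℝ) = (u ^ 2)⁻¹ := by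
      rw [hu, ← Real.rpow_natCast, ← Real.rpow_mul (by positivity), ← Real.rpow_neg (by positivity)]
      norm_num
    rw [h1]
    have h2 : (u ^ 2)⁻¹ ≤ 3 * (u - v) := by
      rw [inv_le_iff_one_le_mul₀ (by positivity)]
      have h3 : u ^ 3 - v ^ 3 = 1 := by rw [hu3, hv3]; ring
      nlinarith [mul_nonneg (sub_nonneg.mpr huv) (sub_nonneg.mpr huv), mul_nonneg hv0 (sub_nonneg.mpr huv),
        mul_nonneg hu0.le (mul_nonneg hv0 (sub_nonneg.mpr huv)),
        mul_nonneg hu0.le (mul_nonneg (sub_nonneg.mpr huv) (sub_nonneg.mpr huv))]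
    linarith

lemma sum_rpow_dvd_le {d : ℕ} (hd : 0 < d) (L : ℕ) :
    ∑ k ∈ (Icc 1 L).filter (fun k => d ∣ k), (k : ℝ) ^ (-(2 / 3) : ℝ) ≤
      3 * (L : ℝ) ^ (1 / 3 : ℝ) / d := by
  have hd' : (0 : ℝ) < d := by exact_mod_cast hd
  have h1 : (Icc 1 L).filter (fun k => d ∣ k) ⊆ (Icc 1 (L / d)).image (fun j => d * j) := by
    intro k hk
    rw [Finset.mem_filter, Finset.mem_Icc] at hk
    obtain ⟨⟨hk1, hk2⟩, j, rfl⟩ := hk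
    rw [Finset.mem_image]
    refine ⟨j, Finset.mem_Icc.mpr ⟨?_, ?_⟩, rfl⟩
    · exact Nat.pos_of_mul_pos_left hk1 |> fun h => by
        rcases Nat.eq_zero_or_pos j with rfl | h
        · simp at hk1
        · exact h
    · rw [Nat.le_div_iff_mul_le hd]; linarith [Nat.mul_comm d j]
  refine (Finset.sum_le_sum_of_subset_of_nonneg h1 fun _ _ _ => by positivity).trans ?_
  rw [Finset.sum_image (fun x _ y _ h => Nat.eq_of_mul_eq_mul_left hd h)]
  have h2 : ∀ j ∈ Icc 1 (L / d), ((d * j : ℕ) : ℝ) ^ (-(2 / 3) : ℝ) =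
      (d : ℝ) ^ (-(2 / 3) : ℝ) * (j : ℝ) ^ (-(2 / 3) : ℝ) := by
    intro j _
    push_cast
    rw [Real.mul_rpow (by positivity) (by positivity)]
  rw [Finset.sum_congr rfl h2, ← Finset.mul_sum]
  have h3 : (((L / d : ℕ) : ℝ)) ^ (1 / 3 : ℝ) ≤ ((L : ℝ) / d) ^ (1 / 3 : ℝ) := by
    gcongr; exact Nat.cast_div_le
  calc _ ≤ (d : ℝ) ^ (-(2 / 3) : ℝ) * (3 * ((L : ℝ) / d) ^ (1 / 3 : ℝ)) := by
        gcongr; exact (sum_rpow_le _).trans (by gcongr)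
    _ = 3 * (L : ℝ) ^ (1 / 3 : ℝ) * ((d : ℝ) ^ (-(2 / 3) : ℝ) / (d : ℝ) ^ (1 / 3 : ℝ)) := by
        rw [Real.div_rpow (by positivity) (by positivity)]; ring
    _ = 3 * (L : ℝ) ^ (1 / 3 : ℝ) / d := by
        rw [← Real.rpow_sub hd']
        norm_num [Real.rpow_neg_one]
        rfl

lemma sum_rpow_mul_gcd_le {q : ℕ} (hq : 0 < q) (L : ℕ) :
    ∑ h ∈ Icc 1 L, (h : ℝ) ^ (-(2 / 3) : ℝ) * (Nat.gcd h q : ℝ) ≤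
      3 * (L : ℝ) ^ (1 / 3 : ℝ) * (Nat.divisors q).card := by
  have h1 : ∀ h ∈ Icc 1 L, (h : ℝ) ^ (-(2 / 3) : ℝ) * (Nat.gcd h q : ℝ) ≤
      ∑ d ∈ Nat.divisors q, if d ∣ h then (d : ℝ) * (h : ℝ) ^ (-(2 / 3) : ℝ) else 0 := by
    intro h _
    have hmem : Nat.gcd h q ∈ Nat.divisors q :=
      Nat.mem_divisors.mpr ⟨Nat.gcd_dvd_right _ _, hq.ne'⟩
    refine le_trans (le_of_eq ?_) (Finset.single_le_sum (fun d _ => ?_) hmem)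
    · rw [if_pos (Nat.gcd_dvd_left _ _), mul_comm]
    · split_ifs <;> positivity
  refine (Finset.sum_le_sum h1).trans ?_
  rw [Finset.sum_comm]
  have h2 : ∀ d ∈ Nat.divisors q,
      (∑ h ∈ Icc 1 L, if d ∣ h then (d : ℝ) * (h : ℝ) ^ (-(2 / 3) : ℝ) else 0) ≤
        3 * (L : ℝ) ^ (1 / 3 : ℝ) := by
    intro d hd
    have hd0 : 0 < d := Nat.pos_of_mem_divisors hd
    have hd' : (0 : ℝ) < d := by exact_mod_cast hd0
    rw [← Finset.sum_filter, ← Finset.mul_sum]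
    calc _ ≤ (d : ℝ) * (3 * (L : ℝ) ^ (1 / 3 : ℝ) / d) := by
          gcongr; exact sum_rpow_dvd_le hd0 L
      _ = _ := by field_simp
  refine (Finset.sum_le_sum h2).trans (le_of_eq ?_)
  rw [Finset.sum_const, nsmul_eq_mul]; ring

lemma dvd_mul_iff_div_gcd_dvd {q : ℕ} (hq : 0 < q) (h k : ℕ) :
    q ∣ h * k ↔ q / Nat.gcd h q ∣ k := by
  have hg : 0 < Nat.gcd h q := Nat.gcd_pos_of_pos_right _ hq
  obtain ⟨g, h', q', hg', hcop, rfl, rfl⟩ := Nat.exists_coprime' (m := h) (n := q) hg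
  have hgq : Nat.gcd (h' * g) (q' * g) = g := by
    rw [Nat.gcd_mul_right, hcop, one_mul]
  rw [hgq, Nat.mul_div_cancel _ hg']
  rw [show h' * g * k = h' * k * g by ring, Nat.mul_dvd_mul_iff_right hg']
  exact hcop.symm.dvd_mul_left

lemma sum_rpow_dvd_mul_le {q : ℕ} (hq : 0 < q) (L : ℕ) :
    ∑ h ∈ Icc 1 L, ∑ k ∈ (Icc 1 L).filter (fun k => q ∣ h * k),
      (h : ℝ) ^ (-(2 / 3) : ℝ) * (k : ℝ) ^ (-(2 / 3) : ℝ) ≤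
      9 * (L : ℝ) ^ (2 / 3 : ℝ) * (Nat.divisors q).card / q := by
  have hq' : (0 : ℝ) < q := by exact_mod_cast hq
  have h1 : ∀ h ∈ Icc 1 L, ∑ k ∈ (Icc 1 L).filter (fun k => q ∣ h * k),
      (h : ℝ) ^ (-(2 / 3) : ℝ) * (k : ℝ) ^ (-(2 / 3) : ℝ) ≤
      (3 * (L : ℝ) ^ (1 / 3 : ℝ) / q) * ((h : ℝ) ^ (-(2 / 3) : ℝ) * (Nat.gcd h q : ℝ)) := by
    intro h _
    have hg : 0 < Nat.gcd h q := Nat.gcd_pos_of_pos_right _ hq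
    have hgd : Nat.gcd h q ∣ q := Nat.gcd_dvd_right _ _
    have hg' : (0 : ℝ) < Nat.gcd h q := by exact_mod_cast hg
    have hpos : 0 < q / Nat.gcd h q := Nat.div_pos (Nat.le_of_dvd hq hgd) hg
    simp_rw [dvd_mul_iff_div_gcd_dvd hq]
    rw [← Finset.mul_sum]
    calc _ ≤ (h : ℝ) ^ (-(2 / 3) : ℝ) *
          (3 * (L : ℝ) ^ (1 / 3 : ℝ) / (q / Nat.gcd h q : ℕ)) := by
          gcongr; exact sum_rpow_dvd_le hpos L
      _ = _ := by
          rw [Nat.cast_div hgd hg'.ne']; field_simp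
  refine (Finset.sum_le_sum h1).trans ?_
  rw [← Finset.mul_sum]
  calc _ ≤ (3 * (L : ℝ) ^ (1 / 3 : ℝ) / q) *
        (3 * (L : ℝ) ^ (1 / 3 : ℝ) * (Nat.divisors q).card) := by
        gcongr; exact sum_rpow_mul_gcd_le hq L
    _ = 9 * ((L : ℝ) ^ (1 / 3 : ℝ) * (L : ℝ) ^ (1 / 3 : ℝ)) * (Nat.divisors q).card / q := by ring
    _ = _ := by
        rw [← Real.rpow_add_of_nonneg (by positivity) (by norm_num) (by norm_num)]; norm_num

lemma div_le_rpow_mul {L m : ℕ} (hL : 0 < L) (hm : 0 < m) (hmL : m ≤ L ^ 2) {b : ℝ}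
    (hb : 0 ≤ b) :
    L / (1 + L * (m * b)) ≤ (L : ℝ) ^ (7 / 3 : ℝ) * (1 + (L : ℝ) ^ 3 * b) ^ (-(2 / 3) : ℝ) *
      (m : ℝ) ^ (-(2 / 3) : ℝ) := by
  have hL' : (0 : ℝ) < L := by exact_mod_cast hL
  have hm' : (0 : ℝ) < m := by exact_mod_cast hm
  have hmL' : (m : ℝ) ≤ (L : ℝ) ^ 2 := by exact_mod_cast hmL
  set u : ℝ := 1 + L * (m * b) with hu
  have hu1 : 1 ≤ u := by rw [hu]; have : 0 ≤ (L : ℝ) * (m * b) := by positivity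
                         linarith
  set v : ℝ := m * (1 + (L : ℝ) ^ 3 * b) / (L : ℝ) ^ 2 with hv
  have hv0 : 0 < v := by positivity
  have hvu : v ≤ u := by
    rw [hv, div_le_iff₀ (by positivity), hu]
    nlinarith
  have h1 : u⁻¹ ≤ v ^ (-(2 / 3) : ℝ) := by
    calc u⁻¹ = u ^ (-1 : ℝ) := (Real.rpow_neg_one u).symm
      _ ≤ u ^ (-(2 / 3) : ℝ) := Real.rpow_le_rpow_of_exponent_le hu1 (by norm_num)
      _ ≤ v ^ (-(2 / 3) : ℝ) := Real.rpow_le_rpow_of_nonpos hv0 hvu (by norm_num)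
  have h2 : v ^ (-(2 / 3) : ℝ) = (m : ℝ) ^ (-(2 / 3) : ℝ) *
      (1 + (L : ℝ) ^ 3 * b) ^ (-(2 / 3) : ℝ) * (L : ℝ) ^ (4 / 3 : ℝ) := by
    rw [hv, Real.div_rpow (by positivity) (by positivity),
      Real.mul_rpow (by positivity) (by positivity), div_eq_mul_inv,
      ← Real.rpow_natCast (L : ℝ) 2, ← Real.rpow_mul (by positivity),
      ← Real.rpow_neg (by positivity)]
    norm_num
  have h3 : (L : ℝ) ^ (7 / 3 : ℝ) = L * (L : ℝ) ^ (4 / 3 : ℝ) := by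
    rw [← Real.rpow_one_add' (by positivity) (by norm_num)]; norm_num
  rw [h3, div_eq_mul_inv]
  rw [h2] at h1
  calc (L : ℝ) * u⁻¹ ≤ L * ((m : ℝ) ^ (-(2 / 3) : ℝ) *
      (1 + (L : ℝ) ^ 3 * b) ^ (-(2 / 3) : ℝ) * (L : ℝ) ^ (4 / 3 : ℝ)) := by gcongr
    _ = _ := by ring

theorem weylSum_le_major {L q : ℕ} (hL : 0 < L) (hq : 0 < q) {a : ℤ} (ha : IsCoprime a (q : ℤ))
    {θ : ℝ} (hθ : |θ - a / q| ≤ 1 / (2 * q * (L : ℝ) ^ 2)) :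
    weylSum L θ ≤ 9 * (L : ℝ) ^ 3 * ((Nat.divisors q).card / q) *
        (1 + (L : ℝ) ^ 3 * |θ - a / q|) ^ (-(2 / 3) : ℝ) +
      8 * L * (L + q) * (1 + Real.log q) := by
  have hL' : (0 : ℝ) < L := by exact_mod_cast hL
  have hq' : (0 : ℝ) < q := by exact_mod_cast hq
  have hlog := one_add_log_nonneg q
  set β := θ - a / q with hβ
  have hmβ : ∀ h ∈ Icc 1 L, ∀ k ∈ Icc 1 L, |((h : ℝ) * k) * β| ≤ 1 / (2 * q) := by
    intro h hh k hk
    rw [Finset.mem_Icc] at hh hk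
    have h1 : (h : ℝ) ≤ L := by exact_mod_cast hh.2
    have h2 : (k : ℝ) ≤ L := by exact_mod_cast hk.2
    rw [abs_mul, abs_of_nonneg (by positivity)]
    calc (h : ℝ) * k * |β| ≤ L * L * (1 / (2 * q * (L : ℝ) ^ 2)) := by gcongr
      _ = 1 / (2 * q) := by field_simp
  set X : ℝ := (L : ℝ) ^ (7 / 3 : ℝ) * (1 + (L : ℝ) ^ 3 * |β|) ^ (-(2 / 3) : ℝ) with hX
  have hX0 : 0 ≤ X := by positivity
  have hpt : ∀ h ∈ Icc 1 L, ∀ k ∈ Icc 1 L, wt L ((h : ℝ) * k * θ) ≤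
      (if q ∣ h * k then X * ((h : ℝ) ^ (-(2 / 3) : ℝ) * (k : ℝ) ^ (-(2 / 3) : ℝ)) else 0) +
      2 * (nint ((k : ℝ) * ((h * a : ℤ) : ℝ) / q))⁻¹ := by
    intro h hh k hk
    have hm := hmβ h hh k hk
    have e1 : (h : ℝ) * k * θ = (h : ℝ) * k * β + (k : ℝ) * ((h * a : ℤ) : ℝ) / q := by
      rw [hβ]; push_cast; field_simp; ring
    have hnn := inv_nonneg.mpr (nint_nonneg ((k : ℝ) * ((h * a : ℤ) : ℝ) / q))
    split_ifs with hdvd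
    · obtain ⟨c, hc⟩ := hdvd
      have e2 : (k : ℝ) * ((h * a : ℤ) : ℝ) / q = ((c * a : ℤ) : ℝ) := by
        have : (h : ℝ) * k = q * c := by exact_mod_cast hc
        push_cast
        rw [div_eq_iff hq'.ne']
        linear_combination (a : ℝ) * this
      have h12 : |(h : ℝ) * k * β| ≤ 1 / 2 := by
        refine hm.trans ?_
        rw [div_le_div_iff₀ (by positivity) (by norm_num)]
        have : (1 : ℝ) ≤ q := by exact_mod_cast hq
        linarith
      have e3 : nint ((h : ℝ) * k * θ) = (h * k : ℕ) * |β| := by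
        rw [e1, e2, nint_add_int, nint_eq_abs h12, abs_mul, abs_of_nonneg (by positivity)]
        push_cast; ring
      rw [Finset.mem_Icc] at hh hk
      have h5 := div_le_rpow_mul hL (Nat.mul_pos hh.1 hk.1)
        (by rw [sq]; exact Nat.mul_le_mul hh.2 hk.2) (abs_nonneg β)
      rw [← e3] at h5
      have e4 : ((h * k : ℕ) : ℝ) ^ (-(2 / 3) : ℝ) =
          (h : ℝ) ^ (-(2 / 3) : ℝ) * (k : ℝ) ^ (-(2 / 3) : ℝ) := by
        push_cast; rw [Real.mul_rpow (by positivity) (by positivity)]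
      rw [e4] at h5
      unfold wt
      linarith
    · have hnd : 1 / (q : ℝ) ≤ nint ((k : ℝ) * ((h * a : ℤ) : ℝ) / q) := by
        have e2 : (k : ℝ) * ((h * a : ℤ) : ℝ) / q = ((k * (h * a) : ℤ) : ℝ) / q := by
          push_cast; ring
        rw [e2]
        have hne : ((k * (h * a) : ℤ)) % (q : ℤ) ≠ 0 := by
          intro h0
          apply hdvd
          have h1 := Int.dvd_of_emod_eq_zero h0
          rw [show (k * (h * a) : ℤ) = (h * k) * a by ring] at h1
          have := ha.symm.dvd_of_dvd_mul_right h1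
          exact_mod_cast this
        rw [nint_intCast_div hq]
        have hlt := Int.emod_lt_of_pos (k * (h * a) : ℤ) (by omega : (0 : ℤ) < q)
        have hnn := Int.emod_nonneg (k * (h * a) : ℤ) (by omega : (q : ℤ) ≠ 0)
        rw [nint_natCast_div (by omega)]
        gcongr
        have : 1 ≤ min ((k * (h * a) : ℤ) % (q : ℤ)).toNat
          (q - ((k * (h * a) : ℤ) % (q : ℤ)).toNat) := by omega
        exact_mod_cast this
      set t := nint ((k : ℝ) * ((h * a : ℤ) : ℝ) / q) with ht
      have ht0 : 0 < t := lt_of_lt_of_le (by positivity) hnd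
      have h6 : t / 2 ≤ nint ((h : ℝ) * k * θ) := by
        have h7 := nint_le_add ((k : ℝ) * ((h * a : ℤ) : ℝ) / q) ((h : ℝ) * k * θ)
        rw [e1] at h7 ⊢
        have : |(k : ℝ) * ((h * a : ℤ) : ℝ) / q - ((h : ℝ) * k * β +
            (k : ℝ) * ((h * a : ℤ) : ℝ) / q)| ≤ 1 / (2 * q) := by
          rw [sub_add_cancel_right, abs_neg]; exact hm
        have h8 : 1 / (2 * (q : ℝ)) = (1 / q) / 2 := by field_simp
        rw [h8] at this
        rw [← ht] at h7
        linarith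
      refine (wt_le_inv L (by positivity) h6).trans (le_of_eq ?_)
      field_simp; ring
  unfold weylSum
  refine (Finset.sum_le_sum fun h hh => Finset.sum_le_sum fun k hk => hpt h hh k hk).trans ?_
  simp_rw [Finset.sum_add_distrib]
  refine add_le_add ?_ ?_
  · simp_rw [← Finset.sum_filter, ← Finset.mul_sum]
    have h1 := sum_rpow_dvd_mul_le hq L
    simp_rw [← Finset.mul_sum] at h1
    have hLL : (L : ℝ) ^ (7 / 3 : ℝ) * (L : ℝ) ^ (2 / 3 : ℝ) = (L : ℝ) ^ 3 := by
      rw [← Real.rpow_add hL']; norm_num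
    calc _ ≤ X * (9 * (L : ℝ) ^ (2 / 3 : ℝ) * (Nat.divisors q).card / q) := by gcongr
      _ = 9 * ((L : ℝ) ^ (7 / 3 : ℝ) * (L : ℝ) ^ (2 / 3 : ℝ)) * ((Nat.divisors q).card / q) *
        (1 + (L : ℝ) ^ 3 * |β|) ^ (-(2 / 3) : ℝ) := by rw [hX]; ring
      _ = _ := by rw [hLL]
  · simp_rw [← Finset.mul_sum]
    calc _ ≤ 2 * ∑ h ∈ Icc 1 L, 4 * ((L : ℝ) + q) * (1 + Real.log q) := by
          gcongr with h _
          exact sum_inv_nint_mul_le hq (h * a) L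
      _ = _ := by simp; ring

theorem exists_card_divisors_le {ε : ℝ} (hε : 0 < ε) :
    ∃ C : ℝ, 1 ≤ C ∧ ∀ n : ℕ, 0 < n → ((Nat.divisors n).card : ℝ) ≤ C * (n : ℝ) ^ ε := by
  set P : ℕ := ⌈(2 : ℝ) ^ (1 / ε)⌉₊ with hP
  set C₀ : ℝ := max 1 (1 / (ε * Real.log 2)) with hC₀
  have hlog2 : 0 < Real.log 2 := Real.log_pos (by norm_num)
  have hC1 : 1 ≤ C₀ := le_max_left _ _
  have hC2 : 1 ≤ C₀ * (ε * Real.log 2) := by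
    have := le_max_right 1 (1 / (ε * Real.log 2))
    rw [← hC₀, div_le_iff₀ (by positivity)] at this
    exact this
  refine ⟨C₀ ^ P, one_le_pow₀ hC1, fun n hn => ?_⟩
  have hfac : (n : ℝ) ^ ε = ∏ p ∈ n.primeFactors, (p : ℝ) ^ (ε * n.factorization p) := by
    conv_lhs => rw [← Nat.prod_factorization_pow_eq_self hn.ne', Finsupp.prod,
      Nat.support_factorization]
    push_cast
    rw [← Real.finsetProd_rpow _ _ (fun _ _ => by positivity)]
    refine Finset.prod_congr rfl fun p _ => ?_
    rw [← Real.rpow_natCast, ← Real.rpow_mul (by positivity), mul_comm]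
  have hpt : ∀ p ∈ n.primeFactors, ((n.factorization p + 1 : ℕ) : ℝ) ≤
      (if p < P then C₀ else 1) * (p : ℝ) ^ (ε * n.factorization p) := by
    intro p hp
    have hp2 : (2 : ℝ) ≤ p := by exact_mod_cast (Nat.prime_of_mem_primeFactors hp).two_le
    set v := n.factorization p with hv
    split_ifs with h
    · have h1 : 1 + ε * v * Real.log 2 ≤ (2 : ℝ) ^ (ε * v) := by
        rw [Real.rpow_def_of_pos (by norm_num)]
        have := Real.add_one_le_exp (Real.log 2 * (ε * v))
        linarith
      have h2 : (2 : ℝ) ^ (ε * v) ≤ (p : ℝ) ^ (ε * v) := by gcongr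
      have h3 : (v : ℝ) ≤ C₀ * (ε * Real.log 2) * v := le_mul_of_one_le_left (by positivity) hC2
      push_cast
      calc (v : ℝ) + 1 ≤ C₀ * (1 + ε * v * Real.log 2) := by linarith
        _ ≤ C₀ * (p : ℝ) ^ (ε * v) := by gcongr; linarith
    · push Not at h
      have h1 : (2 : ℝ) ≤ (p : ℝ) ^ ε := by
        have h2 : (2 : ℝ) ^ (1 / ε) ≤ p := (Nat.le_ceil _).trans (by exact_mod_cast h)
        calc (2 : ℝ) = ((2 : ℝ) ^ (1 / ε)) ^ ε := by
              rw [← Real.rpow_mul (by norm_num), one_div_mul_cancel hε.ne', Real.rpow_one]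
          _ ≤ _ := by gcongr
      have h3 : ((v + 1 : ℕ) : ℝ) ≤ 2 ^ v := by exact_mod_cast Nat.lt_two_pow_self
      rw [one_mul, Real.rpow_mul (by positivity), Real.rpow_natCast]
      exact h3.trans (by gcongr)
  rw [Nat.card_divisors hn.ne']
  push_cast
  push_cast at hpt
  refine (Finset.prod_le_prod (fun _ _ => by positivity) hpt).trans ?_
  rw [Finset.prod_mul_distrib, ← hfac]
  gcongr
  rw [← Finset.prod_filter, Finset.prod_const]
  refine pow_le_pow_right₀ hC1 ?_
  calc _ ≤ (range P).card := Finset.card_le_card fun p hp => by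
        rw [Finset.mem_filter] at hp; exact Finset.mem_range.mpr hp.2
    _ = P := Finset.card_range _

lemma exists_coprime_approx (θ : ℝ) {N : ℕ} (hN : 0 < N) :
    ∃ (q : ℕ) (a : ℤ), 0 < q ∧ q ≤ N ∧ IsCoprime a (q : ℤ) ∧ |θ - a / q| ≤ 1 / (N * q) := by
  obtain ⟨r, hr, hrN⟩ := Real.exists_rat_abs_sub_le_and_den_le θ hN
  have hpos : (0 : ℝ) < r.den := by exact_mod_cast r.den_pos
  have hN' : (0 : ℝ) < N := by exact_mod_cast hN
  refine ⟨r.den, r.num, r.den_pos, hrN,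
    Int.isCoprime_iff_gcd_eq_one.mpr (by simpa [Int.gcd] using r.reduced), ?_⟩
  rw [Rat.cast_def] at hr
  refine hr.trans ?_
  gcongr
  linarith

theorem weylSum_dichotomy :
    ∀ᶠ M : ℕ in atTop, ∀ θ : ℝ, ∃ (q : ℕ) (a : ℤ), 0 < q ∧ IsCoprime a (q : ℤ) ∧
      |θ - a / q| ≤ 1 / (2 * q * (M : ℝ) ^ 2) ∧
      (weylSum M θ ≤ (M : ℝ) ^ (25 / 12 : ℝ) ∨
        (q ≤ M ∧ (M : ℝ) ^ 2 ≤ weylSum M θ ∧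
          weylSum M θ ≤ 18 * (M : ℝ) ^ 3 * ((Nat.divisors q).card / q) *
            (1 + (M : ℝ) ^ 3 * |θ - a / q|) ^ (-(2 / 3) : ℝ))) := by
  obtain ⟨C, hC1, hC⟩ := exists_card_divisors_le (ε := 1 / 100) (by norm_num)
  have hev : ∀ᶠ M : ℕ in atTop, 2472 * C ≤ (M : ℝ) ^ (13 / 300 : ℝ) :=
    ((tendsto_rpow_atTop (by norm_num)).comp tendsto_natCast_atTop_atTop).eventually_ge_atTop _
  filter_upwards [hev, eventually_ge_atTop 1] with M hM hM1 θ
  have hM1' : (1 : ℝ) ≤ M := by exact_mod_cast hM1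
  have hM0 : (0 : ℝ) < M := by linarith
  obtain ⟨q, a, hq, hqN, hcop, hβ⟩ := exists_coprime_approx θ (N := 2 * M ^ 2) (by positivity)
  have hq' : (0 : ℝ) < q := by exact_mod_cast hq
  have hqN' : (q : ℝ) ≤ 2 * (M : ℝ) ^ 2 := by exact_mod_cast hqN
  have hβ1 : |θ - a / q| ≤ 1 / (2 * q * (M : ℝ) ^ 2) := by
    refine hβ.trans (le_of_eq ?_); push_cast; ring
  have hβ2 : |θ - a / q| ≤ 1 / (q : ℝ) ^ 2 := by
    refine hβ1.trans ?_
    gcongr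
    nlinarith
  refine ⟨q, a, hq, hcop, hβ1, ?_⟩
  set y := (M : ℝ) ^ (1 / 50 : ℝ) with hy
  have hy1 : 1 ≤ y := Real.one_le_rpow hM1' (by norm_num)
  have hlogM : Real.log M ≤ 50 * y := by
    have := Real.log_le_rpow_div hM0.le (ε := 1 / 50) (by norm_num)
    rw [hy]; linarith
  have hyy : (M : ℝ) ^ 2 * (y * y) * (M : ℝ) ^ (13 / 300 : ℝ) = (M : ℝ) ^ (25 / 12 : ℝ) := by
    rw [hy, ← Real.rpow_natCast, ← Real.rpow_add hM0, ← Real.rpow_add hM0, ← Real.rpow_add hM0]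
    norm_num
  rcases le_or_gt (weylSum M θ) ((M : ℝ) ^ (25 / 12 : ℝ)) with hle | hgt
  · exact Or.inl hle
  right
  have hMsq : (M : ℝ) ^ 2 ≤ weylSum M θ := by
    refine le_trans ?_ hgt.le
    rw [← Real.rpow_natCast]
    exact Real.rpow_le_rpow_of_exponent_le hM1' (by norm_num)
  have hqM : q ≤ M := by
    by_contra hcon
    push Not at hcon
    have hMq : (M : ℝ) ≤ q := by exact_mod_cast hcon.le
    have hD : ∀ n ∈ Icc 1 (M ^ 2), ((Nat.divisors n).card : ℝ) ≤ C * y := by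
      intro n hn
      rw [Finset.mem_Icc] at hn
      refine (hC n (by omega)).trans ?_
      have hnM : (n : ℝ) ≤ (M : ℝ) ^ 2 := by exact_mod_cast hn.2
      calc C * (n : ℝ) ^ (1 / 100 : ℝ) ≤ C * ((M : ℝ) ^ 2) ^ (1 / 100 : ℝ) := by gcongr
        _ = C * y := by
          rw [hy, ← Real.rpow_natCast, ← Real.rpow_mul hM0.le]; norm_num
    have hmin := weylSum_le_minor hq hcop hβ2 (by positivity) hD
    have hlogq : 1 + Real.log q ≤ 102 * y := by
      have h1 : Real.log q ≤ Real.log (2 * (M : ℝ) ^ 2) := Real.log_le_log hq' hqN'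
      rw [Real.log_mul (by norm_num) (by positivity), Real.log_pow] at h1
      have := Real.log_two_lt_d9
      push_cast at h1
      linarith
    have h1 : (M : ℝ) ^ 2 / q + 1 ≤ 3 * (M : ℝ) ^ 2 / q := by
      rw [div_add_one hq'.ne']; gcongr; linarith
    have h2 : 8 * (M + q * (1 + Real.log q)) ≤ 8 * (q * (103 * y)) := by
      have : (q : ℝ) * (1 + Real.log q) ≤ q * (102 * y) := by gcongr
      have : (q : ℝ) * 1 ≤ q * y := by gcongr
      linarith
    have hl := one_add_log_nonneg q
    have h3 : weylSum M θ ≤ C * y * (3 * (M : ℝ) ^ 2 / q * (8 * (q * (103 * y)))) := by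
      refine hmin.trans ?_
      gcongr
    have h4 : C * y * (3 * (M : ℝ) ^ 2 / q * (8 * (q * (103 * y)))) =
        (M : ℝ) ^ 2 * (y * y) * (2472 * C) := by field_simp; ring
    have h5 : (M : ℝ) ^ 2 * (y * y) * (2472 * C) ≤
        (M : ℝ) ^ 2 * (y * y) * (M : ℝ) ^ (13 / 300 : ℝ) := by gcongr
    linarith
  refine ⟨hqM, hMsq, ?_⟩
  have hmaj := weylSum_le_major (L := M) (by omega) hq hcop hβ1
  have hqM' : (q : ℝ) ≤ M := by exact_mod_cast hqM
  have hlogq : 1 + Real.log q ≤ 51 * y := by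
    have := Real.log_le_log hq' hqM'
    linarith
  have hsec : 8 * M * (M + q) * (1 + Real.log q) ≤ weylSum M θ / 2 := by
    calc 8 * (M : ℝ) * (M + q) * (1 + Real.log q) ≤ 8 * M * (M + M) * (51 * y) := by gcongr
      _ = (M : ℝ) ^ 2 * (1 * y) * 816 := by ring
      _ ≤ (M : ℝ) ^ 2 * (y * y) * ((M : ℝ) ^ (13 / 300 : ℝ) / 2) := by gcongr; linarith
      _ = (M : ℝ) ^ (25 / 12 : ℝ) / 2 := by rw [← hyy]; ring
      _ ≤ _ := by linarith
  linarith

/-- Short sums: with length `R` and modulus `q ≤ 4 R ^ (3/2)`, saving a power of `q`. -/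
theorem exists_norm_cubeSum_pow_four_le : ∃ C : ℝ, 0 < C ∧ ∀ (c α : ℝ) (R q : ℕ) (a : ℤ),
    0 < R → 0 < q → IsCoprime a (q : ℤ) → (q : ℝ) ^ 2 ≤ 16 * (R : ℝ) ^ 3 →
    |6 * α - a / q| ≤ 1 / (2 * q * (R : ℝ) ^ 2) →
    ‖cubeSum c R α‖ ^ 4 ≤ C * (R : ℝ) ^ 4 * (q : ℝ) ^ (-(1 / 4) : ℝ) := by
  obtain ⟨C, hC1, hC⟩ := exists_card_divisors_le (ε := 1 / 2) (by norm_num)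
  refine ⟨16 * (16 + 9 * C + 1000000), by positivity, fun c α R q a hR hq hcop hqR hβ => ?_⟩
  have hq' : (1 : ℝ) ≤ q := by exact_mod_cast hq
  have hR' : (1 : ℝ) ≤ R := by exact_mod_cast hR
  have hq0 : (0 : ℝ) < q := by linarith
  have hR0 : (0 : ℝ) < R := by linarith
  have hmaj := weylSum_le_major hR hq hcop hβ
  have h1 : (1 + (R : ℝ) ^ 3 * |6 * α - a / q|) ^ (-(2 / 3) : ℝ) ≤ 1 :=
    Real.rpow_le_one_of_one_le_of_nonpos (by
      have : 0 ≤ (R : ℝ) ^ 3 * |6 * α - a / q| := by positivity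
      linarith) (by norm_num)
  have hlog : 1 + Real.log q ≤ 13 * (q : ℝ) ^ (1 / 12 : ℝ) := by
    have := Real.log_le_rpow_div hq0.le (ε := 1 / 12) (by norm_num)
    have := Real.one_le_rpow hq' (z := 1 / 12) (by norm_num)
    linarith
  have hl := one_add_log_nonneg q
  set z := (q : ℝ) ^ (-(1 / 4) : ℝ) with hz
  have hz0 : 0 < z := by positivity
  -- powers of `q` in terms of `R`
  have hq43 : (q : ℝ) ^ (4 / 3 : ℝ) ≤ 16 * (R : ℝ) ^ 2 := by
    have h2 : ((q : ℝ) ^ 2) ^ (2 / 3 : ℝ) ≤ (16 * (R : ℝ) ^ 3) ^ (2 / 3 : ℝ) := by gcongr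
    rw [← Real.rpow_natCast, ← Real.rpow_mul hq0.le, Real.mul_rpow (by norm_num) (by positivity),
      ← Real.rpow_natCast (R : ℝ) 3, ← Real.rpow_mul hR0.le] at h2
    norm_num at h2
    have h3 : (16 : ℝ) ^ (2 / 3 : ℝ) ≤ 16 := by
      calc (16 : ℝ) ^ (2 / 3 : ℝ) ≤ 16 ^ (1 : ℝ) :=
            Real.rpow_le_rpow_of_exponent_le (by norm_num) (by norm_num)
        _ = 16 := Real.rpow_one _
    calc (q : ℝ) ^ (4 / 3 : ℝ) ≤ 16 ^ (2 / 3 : ℝ) * (R : ℝ) ^ 2 := h2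
      _ ≤ _ := by gcongr
  have hq14 : ∀ t : ℝ, t ≤ 4 / 3 → (q : ℝ) ^ t ≤ 16 * (R : ℝ) ^ 2 := fun t ht =>
    (Real.rpow_le_rpow_of_exponent_le hq' ht).trans hq43
  have hq13 : (q : ℝ) ^ (1 / 3 : ℝ) ≤ 16 * R := by
    have h2 : ((q : ℝ) ^ (4 / 3 : ℝ)) ^ (1 / 4 : ℝ) ≤ (16 * (R : ℝ) ^ 2) ^ (1 / 4 : ℝ) := by gcongr
    rw [← Real.rpow_mul hq0.le] at h2
    norm_num at h2
    refine h2.trans ?_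
    have hone : (1 : ℝ) ≤ 16 * (R : ℝ) ^ 2 := by nlinarith
    calc (16 * (R : ℝ) ^ 2) ^ (1 / 4 : ℝ) ≤ (16 * (R : ℝ) ^ 2) ^ (1 / 2 : ℝ) :=
          Real.rpow_le_rpow_of_exponent_le hone (by norm_num)
      _ = 4 * R := by
          rw [← Real.sqrt_eq_rpow, show 16 * (R : ℝ) ^ 2 = (4 * R) ^ 2 by ring,
            Real.sqrt_sq (by positivity)]
      _ ≤ 16 * R := by linarith
  have hzmul : ∀ t : ℝ, (q : ℝ) ^ t = (q : ℝ) ^ (t + 1 / 4) * z := fun t => by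
    rw [hz, ← Real.rpow_add hq0]; congr 1; ring
  have t1 : (1 : ℝ) ≤ 16 * R * z := by
    have := hzmul 0
    rw [Real.rpow_zero] at this
    rw [this]
    gcongr
    exact (Real.rpow_le_rpow_of_exponent_le hq' (by norm_num)).trans hq13
  have t2 : ((Nat.divisors q).card : ℝ) / q ≤ C * z := by
    rw [div_le_iff₀ hq0]
    refine (hC q hq).trans ?_
    rw [mul_assoc]
    gcongr
    rw [hz, ← Real.rpow_add_one hq0.ne']
    exact Real.rpow_le_rpow_of_exponent_le hq' (by norm_num)
  have t3 : 1 + Real.log q ≤ 13 * (16 * R) * z := by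
    refine hlog.trans ?_
    rw [hzmul, ← mul_assoc]
    gcongr
    refine le_trans (le_of_eq ?_) hq13
    norm_num
  have t4 : (q : ℝ) * (1 + Real.log q) ≤ 13 * (16 * (R : ℝ) ^ 2) * z := by
    calc (q : ℝ) * (1 + Real.log q) ≤ q * (13 * (q : ℝ) ^ (1 / 12 : ℝ)) := by gcongr
      _ = 13 * ((q : ℝ) * (q : ℝ) ^ (1 / 12 : ℝ)) := by ring
      _ = 13 * (q : ℝ) ^ (13 / 12 : ℝ) := by
          rw [← Real.rpow_one_add' hq0.le (by norm_num)]; norm_num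
      _ ≤ _ := by
          rw [hzmul, ← mul_assoc]
          gcongr
          exact hq14 _ (by norm_num)
  have hw : weylSum R (6 * α) ≤ 9 * (R : ℝ) ^ 3 * (C * z) * 1 +
      8 * R * (R * (13 * (16 * R) * z) + 13 * (16 * (R : ℝ) ^ 2) * z) := by
    refine hmaj.trans ?_
    have : 8 * (R : ℝ) * (R + q) * (1 + Real.log q) =
      8 * R * (R * (1 + Real.log q) + q * (1 + Real.log q)) := by ring
    rw [this]
    gcongr
  calc ‖cubeSum c R α‖ ^ 4 ≤ 16 * R * (R ^ 2 + weylSum R (6 * α)) := norm_cubeSum_pow_four_le _ _ _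
    _ ≤ 16 * R * ((R : ℝ) ^ 2 * (16 * R * z) + (9 * (R : ℝ) ^ 3 * (C * z) * 1 +
      8 * R * (R * (13 * (16 * R) * z) + 13 * (16 * (R : ℝ) ^ 2) * z))) := by
        gcongr
        exact le_mul_of_one_le_right (by positivity) t1
    _ = 16 * (16 + 9 * C + 3328) * (R : ℝ) ^ 4 * z := by ring
    _ ≤ _ := by gcongr; norm_num

noncomputable def corr (t : ℝ) : ℝ := if t = 0 then 1 else |t|⁻¹

lemma corr_le_inv {t b : ℝ} (hb : 0 < b) (h : b ≤ |t|) : corr t ≤ 1 / b := by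
  have ht : t ≠ 0 := by rintro rfl; simp at h; linarith
  unfold corr
  rw [if_neg ht, one_div]
  gcongr

lemma norm_integral_e_le (t : ℝ) (n : ℤ) :
    ‖∫ α in (n : ℝ)..(n + 1), e (α * t)‖ ≤ corr t := by
  unfold corr
  split_ifs with ht
  · subst ht; simp [e_zero]
  · have hc : (2 * Real.pi * t * Complex.I : ℂ) ≠ 0 := by
      simp [Real.pi_ne_zero, ht]
    have h1 : ∀ α : ℝ, e (α * t) = Complex.exp ((2 * Real.pi * t * Complex.I) * α) := by
      intro α; unfold e; congr 1; push_cast; ring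
    simp_rw [h1]
    rw [integral_exp_mul_complex hc, norm_div]
    have h2 : ‖(2 * Real.pi * t * Complex.I : ℂ)‖ = 2 * Real.pi * |t| := by
      simp [abs_of_pos Real.pi_pos]
    rw [h2]
    have h3 : ‖Complex.exp ((2 * Real.pi * t * Complex.I) * ((n + 1 : ℝ) : ℂ)) -
        Complex.exp ((2 * Real.pi * t * Complex.I) * ((n : ℝ) : ℂ))‖ ≤ 2 := by
      rw [← h1, ← h1]
      refine (norm_sub_le _ _).trans ?_
      rw [norm_e, norm_e]; norm_num
    have ht' : 0 < |t| := abs_pos.mpr ht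
    have hpi := Real.pi_gt_three
    rw [div_le_iff₀ (by positivity)]
    have : |t|⁻¹ * (2 * Real.pi * |t|) = 2 * Real.pi := by field_simp
    linarith

lemma integral_norm_sq_sum_le {ι : Type*} (P : Finset ι) (v : ι → ℝ) (n : ℤ) (B : ℝ)
    (hB : ∀ p ∈ P, ∑ p' ∈ P, corr (v p - v p') ≤ B) :
    ∫ α in (n : ℝ)..(n + 1), ‖∑ p ∈ P, e (α * v p)‖ ^ 2 ≤ P.card * B := by
  have hcont : ∀ t : ℝ, Continuous fun α : ℝ => e (α * t) := fun t =>
    continuous_e.comp (continuous_id.mul continuous_const)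
  have h1 : ∀ α : ℝ, ((‖∑ p ∈ P, e (α * v p)‖ ^ 2 : ℝ) : ℂ) =
      ∑ p ∈ P, ∑ p' ∈ P, e (α * (v p - v p')) := by
    intro α
    rw [← Complex.normSq_eq_norm_sq, ← Complex.mul_conj, map_sum, Finset.sum_mul_sum]
    refine Finset.sum_congr rfl fun p _ => Finset.sum_congr rfl fun p' _ => ?_
    rw [e_mul_conj, mul_sub]
  have h2 : ((∫ α in (n : ℝ)..(n + 1), ‖∑ p ∈ P, e (α * v p)‖ ^ 2 : ℝ) : ℂ) =
      ∑ p ∈ P, ∑ p' ∈ P, ∫ α in (n : ℝ)..(n + 1), e (α * (v p - v p')) := by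
    rw [← intervalIntegral.integral_ofReal]
    simp_rw [h1]
    rw [intervalIntegral.integral_finsetSum]
    · refine Finset.sum_congr rfl fun p _ => ?_
      rw [intervalIntegral.integral_finsetSum]
      exact fun p' _ => (hcont _).intervalIntegrable _ _
    · intro p _
      exact (continuous_finsetSum _ fun p' _ => hcont _).intervalIntegrable _ _
  calc ∫ α in (n : ℝ)..(n + 1), ‖∑ p ∈ P, e (α * v p)‖ ^ 2
      ≤ ‖((∫ α in (n : ℝ)..(n + 1), ‖∑ p ∈ P, e (α * v p)‖ ^ 2 : ℝ) : ℂ)‖ := by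
        rw [Complex.norm_real]; exact le_abs_self _
    _ ≤ ∑ p ∈ P, ∑ p' ∈ P, corr (v p - v p') := by
        rw [h2]
        refine (norm_sum_le _ _).trans (Finset.sum_le_sum fun p _ => ?_)
        refine (norm_sum_le _ _).trans (Finset.sum_le_sum fun p' _ => norm_integral_e_le _ _)
    _ ≤ ∑ p ∈ P, B := Finset.sum_le_sum hB
    _ = P.card * B := by rw [Finset.sum_const, nsmul_eq_mul]

lemma three_mul_sq_le_abs_cube_sub {X Y A : ℝ} (hA : 0 ≤ A) (hX : A ≤ X) (hY : A ≤ Y)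
    (h : 1 ≤ |X - Y|) : 3 * A ^ 2 ≤ |X ^ 3 - Y ^ 3| := by
  have h1 : X ^ 3 - Y ^ 3 = (X - Y) * (X ^ 2 + X * Y + Y ^ 2) := by ring
  have h2 : 3 * A ^ 2 ≤ X ^ 2 + X * Y + Y ^ 2 := by nlinarith
  rw [h1, abs_mul, abs_of_nonneg ((by positivity : 0 ≤ 3 * A ^ 2).trans h2)]
  nlinarith [sq_nonneg A]

lemma cubeSum_mul_cubeSum (c c' : ℝ) (L L' : ℕ) (α : ℝ) :
    cubeSum c L α * cubeSum c' L' α =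
      ∑ p ∈ Ico (0 : ℤ) L ×ˢ Ico (0 : ℤ) L', e (α * (((p.1 : ℝ) + c) ^ 3 + ((p.2 : ℝ) + c') ^ 3)) := by
  unfold cubeSum
  rw [Finset.sum_mul_sum, Finset.sum_product]
  refine Finset.sum_congr rfl fun x _ => Finset.sum_congr rfl fun y _ => ?_
  rw [← e_add, mul_add]

theorem integral_norm_sq_cubeSum_mul_le (μ ν : ℝ) :
    ∀ᶠ k : ℕ in atTop, ∀ n : ℤ,
      ∫ α in (n : ℝ)..(n + 1), ‖cubeSum ((4 * k ^ 3 : ℕ) - μ) (4 * k ^ 3) α *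
        cubeSum ((k ^ 2 : ℕ) - ν) (k ^ 2) α‖ ^ 2 ≤ 24 * (k : ℝ) ^ 5 := by
  filter_upwards [eventually_ge_atTop 1, eventually_ge_atTop ⌈10 * |μ|⌉₊,
    eventually_ge_atTop ⌈10 * |ν|⌉₊] with k hk1 hkμ hkν n
  have hk1' : (1 : ℝ) ≤ k := by exact_mod_cast hk1
  have hk0 : (0 : ℝ) < k := by linarith
  have hμ : |μ| ≤ (k : ℝ) ^ 2 / 10 := by
    have : 10 * |μ| ≤ k := Nat.ceil_le.mp hkμ
    nlinarith
  have hν : |ν| ≤ (k : ℝ) ^ 2 / 10 := by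
    have : 10 * |ν| ≤ k := Nat.ceil_le.mp hkν
    nlinarith
  rw [abs_le] at hμ hν
  have hk23 : (k : ℝ) ^ 2 ≤ (k : ℝ) ^ 3 := pow_le_pow_right₀ hk1' (by norm_num)
  simp_rw [cubeSum_mul_cubeSum]
  set P := Ico (0 : ℤ) (4 * k ^ 3 : ℕ) ×ˢ Ico (0 : ℤ) (k ^ 2 : ℕ) with hP
  have hcard : (P.card : ℝ) = 4 * (k : ℝ) ^ 5 := by
    rw [hP, Finset.card_product, Int.card_Ico, Int.card_Ico]
    simp only [sub_zero, Int.toNat_natCast]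
    push_cast; ring
  have hx : ∀ x ∈ Ico (0 : ℤ) (4 * k ^ 3 : ℕ),
      3 * (k : ℝ) ^ 3 ≤ (x : ℝ) + ((4 * k ^ 3 : ℕ) - μ) := by
    intro x hx
    rw [Finset.mem_Ico] at hx
    have : (0 : ℝ) ≤ x := by exact_mod_cast hx.1
    push_cast; linarith
  have hy : ∀ y ∈ Ico (0 : ℤ) (k ^ 2 : ℕ),
      9 / 10 * (k : ℝ) ^ 2 ≤ (y : ℝ) + ((k ^ 2 : ℕ) - ν) ∧
        (y : ℝ) + ((k ^ 2 : ℕ) - ν) ≤ 21 / 10 * (k : ℝ) ^ 2 := by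
    intro y hy
    rw [Finset.mem_Ico] at hy
    have h1 : (0 : ℝ) ≤ y := by exact_mod_cast hy.1
    have h2 : (y : ℝ) ≤ (k : ℝ) ^ 2 := by exact_mod_cast hy.2.le
    push_cast
    constructor <;> linarith
  refine (integral_norm_sq_sum_le P _ n 6 ?_).trans (le_of_eq (by rw [hcard]; ring))
  intro p hp
  rw [hP, Finset.mem_product] at hp
  have hterm : ∀ p' ∈ P, corr (((p.1 : ℝ) + ((4 * k ^ 3 : ℕ) - μ)) ^ 3 +
      ((p.2 : ℝ) + ((k ^ 2 : ℕ) - ν)) ^ 3 - (((p'.1 : ℝ) + ((4 * k ^ 3 : ℕ) - μ)) ^ 3 +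
      ((p'.2 : ℝ) + ((k ^ 2 : ℕ) - ν)) ^ 3)) ≤
      (if p' = p then 1 else 0) + (if p'.1 = p.1 then 1 / (k : ℝ) ^ 4 else 0) +
        1 / (k : ℝ) ^ 6 := by
    intro p' hp'
    rw [hP, Finset.mem_product] at hp'
    have hxp := hx _ hp.1
    have hxp' := hx _ hp'.1
    have hyp := hy _ hp.2
    have hyp' := hy _ hp'.2
    have hk4 : 0 < 1 / (k : ℝ) ^ 4 := by positivity
    have hk6 : 0 < 1 / (k : ℝ) ^ 6 := by positivity
    have hint : ∀ x y : ℤ, x ≠ y → ∀ c : ℝ, 1 ≤ |((x : ℝ) + c) - (y + c)| := by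
      intro x y hxy c
      rw [add_sub_add_right_eq_sub]
      have : 1 ≤ |x - y| := Int.one_le_abs (sub_ne_zero.mpr hxy)
      exact_mod_cast this
    by_cases h1 : p'.1 = p.1
    · by_cases h2 : p'.2 = p.2
      · have h3 : p' = p := Prod.ext h1 h2
        rw [if_pos h3, if_pos h1, h3]
        have : corr (0 : ℝ) = 1 := by simp [corr]
        rw [sub_self, this]
        linarith
      · have h3 : p' ≠ p := fun h => h2 (by rw [h])
        rw [if_neg h3, if_pos h1, h1, add_sub_add_left_eq_sub]
        have h4 := three_mul_sq_le_abs_cube_sub (by positivity) hyp.1 hyp'.1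
          (hint _ _ (Ne.symm h2) _)
        refine (corr_le_inv (b := (k : ℝ) ^ 4) (by positivity) (le_trans ?_ h4)).trans (by linarith)
        nlinarith [pow_pos hk0 4]
    · have h3 : p' ≠ p := fun h => h1 (by rw [h])
      rw [if_neg h3, if_neg h1]
      refine (corr_le_inv (b := (k : ℝ) ^ 6) (by positivity) ?_).trans (by linarith)
      have h4 := three_mul_sq_le_abs_cube_sub (by positivity) hxp hxp' (hint _ _ (Ne.symm h1) _)
      set X := (p.1 : ℝ) + ((4 * k ^ 3 : ℕ) - μ)
      set X' := (p'.1 : ℝ) + ((4 * k ^ 3 : ℕ) - μ)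
      set Y := (p.2 : ℝ) + ((k ^ 2 : ℕ) - ν)
      set Y' := (p'.2 : ℝ) + ((k ^ 2 : ℕ) - ν)
      have hYu : Y ^ 3 ≤ (21 / 10 * (k : ℝ) ^ 2) ^ 3 :=
        pow_le_pow_left₀ ((by positivity : (0 : ℝ) ≤ 9 / 10 * (k : ℝ) ^ 2).trans hyp.1) hyp.2 3
      have hYu' : Y' ^ 3 ≤ (21 / 10 * (k : ℝ) ^ 2) ^ 3 :=
        pow_le_pow_left₀ ((by positivity : (0 : ℝ) ≤ 9 / 10 * (k : ℝ) ^ 2).trans hyp'.1) hyp'.2 3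
      have hYl : 0 ≤ Y ^ 3 :=
        pow_nonneg ((by positivity : (0 : ℝ) ≤ 9 / 10 * (k : ℝ) ^ 2).trans hyp.1) 3
      have hYl' : 0 ≤ Y' ^ 3 :=
        pow_nonneg ((by positivity : (0 : ℝ) ≤ 9 / 10 * (k : ℝ) ^ 2).trans hyp'.1) 3
      have h5 : X ^ 3 + Y ^ 3 - (X' ^ 3 + Y' ^ 3) = (X ^ 3 - X' ^ 3) - (Y' ^ 3 - Y ^ 3) := by ring
      have h6 : |Y' ^ 3 - Y ^ 3| ≤ (21 / 10 * (k : ℝ) ^ 2) ^ 3 := by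
        rw [abs_le]; constructor <;> linarith
      rw [h5]
      have h7 := abs_sub_abs_le_abs_sub (X ^ 3 - X' ^ 3) (Y' ^ 3 - Y ^ 3)
      have h8 : 3 * (3 * (k : ℝ) ^ 3) ^ 2 - (21 / 10 * (k : ℝ) ^ 2) ^ 3 ≥ (k : ℝ) ^ 6 := by
        have : 0 ≤ (k : ℝ) ^ 6 := by positivity
        nlinarith
      linarith
  refine (Finset.sum_le_sum hterm).trans ?_
  rw [Finset.sum_add_distrib, Finset.sum_add_distrib]
  have s1 : ∑ p' ∈ P, (if p' = p then (1 : ℝ) else 0) ≤ 1 := by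
    rw [Finset.sum_ite_eq']; split_ifs <;> norm_num
  have s2 : ∑ p' ∈ P, (if p'.1 = p.1 then 1 / (k : ℝ) ^ 4 else 0) ≤ 1 := by
    rw [hP, Finset.sum_product_right]
    simp only [Finset.sum_ite_eq']
    rw [if_pos hp.1, Finset.sum_const, nsmul_eq_mul, Int.card_Ico, sub_zero, Int.toNat_natCast]
    push_cast
    rw [mul_one_div, div_le_one (by positivity)]
    exact pow_le_pow_right₀ hk1' (by norm_num)
  have s3 : ∑ p' ∈ P, 1 / (k : ℝ) ^ 6 ≤ 4 := by
    rw [Finset.sum_const, nsmul_eq_mul, hcard, mul_one_div, div_le_iff₀ (by positivity)]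
    have : (k : ℝ) ^ 5 ≤ (k : ℝ) ^ 6 := pow_le_pow_right₀ hk1' (by norm_num)
    linarith
  linarith

/-- The generating function: four long variables and one short variable. -/
noncomputable def prodSum (μ : Fin 5 → ℝ) (k : ℕ) (α : ℝ) : ℂ :=
  cubeSum ((4 * k ^ 3 : ℕ) - μ 0) (4 * k ^ 3) α * cubeSum ((k ^ 2 : ℕ) - μ 1) (k ^ 2) α *
    (cubeSum ((4 * k ^ 3 : ℕ) - μ 2) (4 * k ^ 3) α *
      cubeSum ((4 * k ^ 3 : ℕ) - μ 3) (4 * k ^ 3) α *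
      cubeSum ((4 * k ^ 3 : ℕ) - μ 4) (4 * k ^ 3) α)

lemma sq_le_sqrt_of_pow_four_le {x B : ℝ} (h : x ^ 4 ≤ B) : x ^ 2 ≤ √B := by
  apply Real.le_sqrt_of_sq_le
  calc (x ^ 2) ^ 2 = x ^ 4 := by ring
    _ ≤ B := h

set_option maxHeartbeats 1000000 in
theorem norm_sq_prodSum_dichotomy : ∃ C : ℝ, 0 < C ∧ ∀ᶠ k : ℕ in atTop,
    ∀ (μ : Fin 5 → ℝ) (α : ℝ),
      ‖prodSum μ k α‖ ^ 2 ≤ ‖cubeSum ((4 * k ^ 3 : ℕ) - μ 0) (4 * k ^ 3) α *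
        cubeSum ((k ^ 2 : ℕ) - μ 1) (k ^ 2) α‖ ^ 2 * (C * (k : ℝ) ^ (111 / 8 : ℝ)) ∨
      ∃ (q : ℕ) (a : ℤ), 0 < q ∧ q ≤ 4 * k ^ 3 ∧ IsCoprime a (q : ℤ) ∧
        |6 * α - a / q| ≤ 1 / 2 ∧
        ‖prodSum μ k α‖ ^ 2 ≤ C * (k : ℝ) ^ 28 * (q : ℝ) ^ (-(33 / 16) : ℝ) *
          (1 + 64 * (k : ℝ) ^ 9 * |6 * α - a / q|) ^ (-(4 / 3) : ℝ) := by
  obtain ⟨C₁, hC₁1, hC₁⟩ := exists_card_divisors_le (ε := 1 / 32) (by norm_num)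
  obtain ⟨C₂, hC₂0, hC₂⟩ := exists_norm_cubeSum_pow_four_le
  set Cm : ℝ := (32 : ℝ) ^ (3 / 2 : ℝ) * 4 ^ (37 / 8 : ℝ) with hCm
  set CM : ℝ := 576 ^ 2 * 4 ^ 8 * C₁ ^ 2 * √C₂ with hCM
  have hCm0 : 0 < Cm := by positivity
  have hCM0 : 0 < CM := by positivity
  have htend : Tendsto (fun k : ℕ => 4 * k ^ 3) atTop atTop :=
    tendsto_atTop_mono (fun k => by
      have : k ≤ k ^ 3 := Nat.le_self_pow (by norm_num) k
      show k ≤ 4 * k ^ 3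
      omega) tendsto_id
  refine ⟨Cm + CM, by positivity, ?_⟩
  filter_upwards [htend.eventually weylSum_dichotomy, eventually_ge_atTop 1] with k hk hk1 μ α
  have hk1' : (1 : ℝ) ≤ k := by exact_mod_cast hk1
  have hk0 : (0 : ℝ) < k := by linarith
  set M : ℕ := 4 * k ^ 3 with hM
  have hMk : (M : ℝ) = 4 * (k : ℝ) ^ 3 := by rw [hM]; push_cast; ring
  have hM1 : (1 : ℝ) ≤ M := by
    rw [hMk]; nlinarith [pow_le_pow_left₀ (by norm_num) hk1' 3]
  have hM0 : (0 : ℝ) < M := by linarith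
  obtain ⟨q, a, hq, hcop, hβ, hcase⟩ := hk (6 * α)
  have hS : ∀ (f₁ f₂ f₃ f₄ f₅ : ℂ), ‖f₁ * f₂ * (f₃ * f₄ * f₅)‖ ^ 2 =
      ‖f₁ * f₂‖ ^ 2 * (‖f₃‖ ^ 2 * ‖f₄‖ ^ 2 * ‖f₅‖ ^ 2) := by
    intro f₁ f₂ f₃ f₄ f₅; simp only [norm_mul]; ring
  rcases hcase with hmin | ⟨hqM, hwM, hmaj⟩
  · left
    have hf : ∀ c : ℝ, ‖cubeSum c M α‖ ^ 2 ≤ √(32 * (M : ℝ) ^ (37 / 12 : ℝ)) := by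
      intro c
      refine sq_le_sqrt_of_pow_four_le ((norm_cubeSum_pow_four_le c M α).trans ?_)
      have h1 : (M : ℝ) ^ 2 ≤ (M : ℝ) ^ (25 / 12 : ℝ) := by
        rw [← Real.rpow_natCast]
        exact Real.rpow_le_rpow_of_exponent_le hM1 (by norm_num)
      have h2 : (M : ℝ) ^ (37 / 12 : ℝ) = M * (M : ℝ) ^ (25 / 12 : ℝ) := by
        rw [← Real.rpow_one_add' hM0.le (by norm_num)]; norm_num
      rw [h2]
      have : (M : ℝ) * ((M : ℝ) ^ 2 + weylSum M (6 * α)) ≤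
          M * ((M : ℝ) ^ (25 / 12 : ℝ) + (M : ℝ) ^ (25 / 12 : ℝ)) := by gcongr
      linarith
    unfold prodSum
    rw [hS]
    refine mul_le_mul_of_nonneg_left ?_ (by positivity)
    refine (mul_le_mul (mul_le_mul (hf _) (hf _) (by positivity) (by positivity)) (hf _)
      (by positivity) (by positivity)).trans ?_
    have h3 : √(32 * (M : ℝ) ^ (37 / 12 : ℝ)) * √(32 * (M : ℝ) ^ (37 / 12 : ℝ)) *
        √(32 * (M : ℝ) ^ (37 / 12 : ℝ)) = Cm * (k : ℝ) ^ (111 / 8 : ℝ) := by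
      have h4 : ∀ x : ℝ, 0 ≤ x → √x * √x * √x = x ^ (3 / 2 : ℝ) := by
        intro x hx
        rw [Real.sqrt_eq_rpow, ← Real.rpow_add_of_nonneg hx (by norm_num) (by norm_num),
          ← Real.rpow_add_of_nonneg hx (by norm_num) (by norm_num)]
        norm_num
      rw [h4 _ (by positivity), Real.mul_rpow (by norm_num) (by positivity),
        ← Real.rpow_mul hM0.le, hMk, Real.mul_rpow (by norm_num) (by positivity),
        ← Real.rpow_natCast (k : ℝ) 3, ← Real.rpow_mul hk0.le, hCm]
      norm_num
      ring
    rw [h3]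
    gcongr
    linarith
  · right
    have hq1 : (1 : ℝ) ≤ q := by exact_mod_cast hq
    have hq0 : (0 : ℝ) < q := by linarith
    refine ⟨q, a, hq, hqM, hcop, hβ.trans ?_, ?_⟩
    · rw [div_le_div_iff₀ (by positivity) (by norm_num)]
      nlinarith [one_le_pow₀ hM1 (n := 2)]
    set u := (1 + (M : ℝ) ^ 3 * |6 * α - a / q|) ^ (-(2 / 3) : ℝ) with hu
    have hu0 : 0 ≤ u := by positivity
    set d : ℝ := ((Nat.divisors q).card : ℝ) with hd
    have hf : ∀ c : ℝ, ‖cubeSum c M α‖ ^ 2 ≤ √(576 * (M : ℝ) ^ 4 * (d / q) * u) := by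
      intro c
      refine sq_le_sqrt_of_pow_four_le ((norm_cubeSum_pow_four_le c M α).trans ?_)
      calc 16 * (M : ℝ) * ((M : ℝ) ^ 2 + weylSum M (6 * α))
          ≤ 16 * M * (2 * (18 * (M : ℝ) ^ 3 * (d / q) * u)) := by gcongr; linarith
        _ = _ := by ring
    have hf₂ : ∀ c : ℝ, ‖cubeSum c (k ^ 2) α‖ ^ 2 ≤
        √C₂ * (k : ℝ) ^ 4 * (q : ℝ) ^ (-(1 / 8) : ℝ) := by
      intro c
      have h1 := hC₂ c α (k ^ 2) q a (by positivity) hq hcop (by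
          have : (q : ℝ) ≤ 4 * (k : ℝ) ^ 3 := by rw [← hMk]; exact_mod_cast hqM
          push_cast
          calc (q : ℝ) ^ 2 ≤ (4 * (k : ℝ) ^ 3) ^ 2 := by gcongr
            _ = _ := by ring) (hβ.trans (by
          push_cast
          gcongr
          rw [hMk]
          have : (k : ℝ) ^ 2 ≤ (k : ℝ) ^ 3 := pow_le_pow_right₀ hk1' (by norm_num)
          nlinarith [pow_pos hk0 3]))
      refine (sq_le_sqrt_of_pow_four_le h1).trans (le_of_eq ?_)
      rw [Real.sqrt_mul (by positivity), Real.sqrt_mul hC₂0.le]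
      congr 1
      · congr 1
        push_cast
        rw [show ((k : ℝ) ^ 2) ^ 4 = ((k : ℝ) ^ 4) ^ 2 by ring, Real.sqrt_sq (by positivity)]
      · rw [Real.sqrt_eq_rpow, ← Real.rpow_mul hq0.le]; norm_num
    have hdq : (d / q) ^ 2 * (q : ℝ) ^ (-(1 / 8) : ℝ) ≤ C₁ ^ 2 * (q : ℝ) ^ (-(33 / 16) : ℝ) := by
      calc (d / q) ^ 2 * (q : ℝ) ^ (-(1 / 8) : ℝ)
          ≤ (C₁ * (q : ℝ) ^ (1 / 32 : ℝ) / q) ^ 2 * (q : ℝ) ^ (-(1 / 8) : ℝ) := by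
            gcongr; exact hC₁ q hq
        _ = C₁ ^ 2 * (((q : ℝ) ^ (1 / 32 : ℝ)) ^ 2 * (q : ℝ) ^ (-2 : ℝ) *
            (q : ℝ) ^ (-(1 / 8) : ℝ)) := by
            rw [Real.rpow_neg hq0.le 2, Real.rpow_two]; field_simp
        _ = _ := by
            rw [← Real.rpow_natCast ((q : ℝ) ^ (1 / 32 : ℝ)), ← Real.rpow_mul hq0.le,
              ← Real.rpow_add hq0,
              ← Real.rpow_add hq0]
            norm_num
    have hu2 : u ^ 2 = (1 + 64 * (k : ℝ) ^ 9 * |6 * α - a / q|) ^ (-(4 / 3) : ℝ) := by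
      rw [hu, ← Real.rpow_natCast, ← Real.rpow_mul (by positivity), hMk]
      norm_num
      congr 2
      ring
    have hB : ∀ x : ℝ, 0 ≤ x → (√x * √x) * (√x * √x) = x ^ 2 := by
      intro x hx; rw [Real.mul_self_sqrt hx, sq]
    unfold prodSum
    rw [hS, norm_mul, mul_pow]
    set s := √(576 * (M : ℝ) ^ 4 * (d / q) * u) with hs
    have hs0 : 0 ≤ s := Real.sqrt_nonneg _
    calc _ ≤ s * (√C₂ * (k : ℝ) ^ 4 * (q : ℝ) ^ (-(1 / 8) : ℝ)) * (s * s * s) := by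
          exact mul_le_mul (mul_le_mul (hf _) (hf₂ _) (by positivity) hs0)
            (mul_le_mul (mul_le_mul (hf _) (hf _) (by positivity) hs0) (hf _) (by positivity)
              (by positivity)) (by positivity) (by positivity)
      _ = ((s * s) * (s * s)) * (√C₂ * (k : ℝ) ^ 4 * (q : ℝ) ^ (-(1 / 8) : ℝ)) := by ring
      _ = (576 * (M : ℝ) ^ 4 * (d / q) * u) ^ 2 *
          (√C₂ * (k : ℝ) ^ 4 * (q : ℝ) ^ (-(1 / 8) : ℝ)) := by
          rw [hs, hB _ (by positivity)]
      _ = 576 ^ 2 * 4 ^ 8 * √C₂ * (k : ℝ) ^ 28 *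
          ((d / q) ^ 2 * (q : ℝ) ^ (-(1 / 8) : ℝ)) * u ^ 2 := by
          rw [hMk]; ring
      _ ≤ 576 ^ 2 * 4 ^ 8 * √C₂ * (k : ℝ) ^ 28 *
          (C₁ ^ 2 * (q : ℝ) ^ (-(33 / 16) : ℝ)) * u ^ 2 := by gcongr
      _ = CM * (k : ℝ) ^ 28 * (q : ℝ) ^ (-(33 / 16) : ℝ) * u ^ 2 := by rw [hCM]; ring
      _ ≤ _ := by
          rw [hu2]
          gcongr
          linarith

/-- Frequencies `α` for which `6α` is close to a rational of denominator at most `K`. -/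
def nearRat (K k : ℕ) : Set ℝ :=
  {α | ∃ (q : ℕ) (a : ℤ), 0 < q ∧ q ≤ K ∧ IsCoprime a (q : ℤ) ∧
    |6 * α - a / q| ≤ K / (64 * (k : ℝ) ^ 9)}

/-- The major arc profile, truncated to the complement of the arcs already removed. -/
noncomputable def profile (K q : ℕ) (t : ℝ) : ℝ≥0∞ :=
  if q ≤ K ∧ |t| ≤ K then 0 else ENNReal.ofReal ((1 + |t|) ^ (-(4 / 3) : ℝ))

lemma profile_le (K q : ℕ) (t : ℝ) :
    profile K q t ≤ ENNReal.ofReal ((1 + |t|) ^ (-(4 / 3) : ℝ)) := by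
  unfold profile; split_ifs <;> simp

lemma measurable_profile (K q : ℕ) : Measurable (profile K q) := by
  unfold profile
  refine Measurable.ite (p := fun t : ℝ => q ≤ K ∧ |t| ≤ K) ?_ measurable_const (by fun_prop)
  refine (MeasurableSet.const (q ≤ K)).inter ?_
  exact measurableSet_le (f := fun t : ℝ => |t|) (by fun_prop) measurable_const

lemma lintegral_profile_bound :
    ∫⁻ t : ℝ, ENNReal.ofReal ((1 + |t|) ^ (-(4 / 3) : ℝ)) ≠ ∞ := by
  have := finite_integral_one_add_norm (E := ℝ) (μ := volume) (r := 4 / 3) (by norm_num)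
  simpa only [Real.norm_eq_abs] using this.ne

/-- The tail of the singular series and integral beyond the removed arcs. -/
noncomputable def tailMass (K : ℕ) : ℝ≥0∞ :=
  ∑' q : ℕ, ENNReal.ofReal ((q : ℝ) ^ (-(17 / 16) : ℝ)) * ∫⁻ t, profile K q t

lemma tailMass_bound : ∑' q : ℕ, ENNReal.ofReal ((q : ℝ) ^ (-(17 / 16) : ℝ)) *
    ∫⁻ t : ℝ, ENNReal.ofReal ((1 + |t|) ^ (-(4 / 3) : ℝ)) ≠ ∞ := by
  rw [ENNReal.tsum_mul_right]
  refine ENNReal.mul_ne_top ?_ lintegral_profile_bound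
  exact (Real.summable_nat_rpow.2 (by norm_num)).tsum_ofReal_ne_top

lemma tailMass_ne_top (K : ℕ) : tailMass K ≠ ∞ := by
  refine ne_top_of_le_ne_top tailMass_bound (ENNReal.tsum_le_tsum fun q => ?_)
  gcongr
  exact profile_le _ _ _

lemma tendsto_tailMass : Tendsto tailMass atTop (𝓝 0) := by
  have h1 : ∀ q : ℕ, Tendsto (fun K => ∫⁻ t, profile K q t) atTop (𝓝 0) := by
    intro q
    have := tendsto_lintegral_of_dominated_convergence (μ := volume)
      (F := fun K => profile K q) (f := fun _ => 0) _
      (fun K => measurable_profile K q)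
      (fun K => Eventually.of_forall fun t => profile_le K q t) lintegral_profile_bound
      (Eventually.of_forall fun t => by
        refine tendsto_const_nhds.congr' ?_
        filter_upwards [eventually_ge_atTop q, eventually_ge_atTop ⌈|t|⌉₊] with K h1 h2
        rw [profile, if_pos ⟨h1, Nat.ceil_le.1 h2⟩])
    simpa using this
  have h2 := tendsto_lintegral_of_dominated_convergence (μ := Measure.count (α := ℕ))
    (F := fun K (q : ℕ) => ENNReal.ofReal ((q : ℝ) ^ (-(17 / 16) : ℝ)) * ∫⁻ t, profile K q t)
    (f := fun _ => 0)
    (fun q : ℕ => ENNReal.ofReal ((q : ℝ) ^ (-(17 / 16) : ℝ)) *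
      ∫⁻ t : ℝ, ENNReal.ofReal ((1 + |t|) ^ (-(4 / 3) : ℝ)))
    (fun K => measurable_of_countable _)
    (fun K => Eventually.of_forall fun q => by
      dsimp only
      gcongr
      exact profile_le _ _ _)
    (by rw [lintegral_count]; exact tailMass_bound)
    (Eventually.of_forall fun q => by
      simpa using ENNReal.Tendsto.const_mul (h1 q) (Or.inr ENNReal.ofReal_ne_top))
  simp only [lintegral_count, tsum_zero] at h2
  exact h2

lemma lintegral_comp_mul_sub (f : ℝ → ℝ≥0∞) (hf : Measurable f) {c : ℝ} (hc : 0 < c) (d : ℝ) :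
    ∫⁻ x, f (c * x - d) = ENNReal.ofReal c⁻¹ * ∫⁻ x, f x := by
  have h1 : ∫⁻ x, f (c * x - d) = ∫⁻ y, f (y - d) ∂(Measure.map (c * ·) volume) := by
    rw [lintegral_map (by fun_prop) (by fun_prop)]
  rw [h1, Real.map_volume_mul_left hc.ne', lintegral_smul_measure, abs_of_pos (by positivity),
    lintegral_sub_right_eq_self (fun y => f y)]
  rfl

lemma continuous_cubeSum (c : ℝ) (L : ℕ) : Continuous (cubeSum c L) := by
  unfold cubeSum
  exact continuous_finsetSum _ fun n _ => continuous_e.comp (by fun_prop)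

lemma continuous_prodSum (μ : Fin 5 → ℝ) (k : ℕ) : Continuous (prodSum μ k) := by
  have := continuous_cubeSum
  unfold prodSum
  fun_prop

lemma measurableSet_nearRat (K k : ℕ) : MeasurableSet (nearRat K k) := by
  have : nearRat K k = ⋃ q : ℕ, ⋃ a : ℤ, {α : ℝ | 0 < q ∧ q ≤ K ∧ IsCoprime a (q : ℤ) ∧
    |6 * α - a / q| ≤ K / (64 * (k : ℝ) ^ 9)} := by
    ext; simp [nearRat]
  rw [this]
  refine MeasurableSet.iUnion fun q => MeasurableSet.iUnion fun a => ?_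
  refine (MeasurableSet.const _).inter ((MeasurableSet.const _).inter
    ((MeasurableSet.const _).inter ?_))
  exact measurableSet_le (f := fun α : ℝ => |6 * α - a / q|) (by fun_prop) measurable_const

set_option maxHeartbeats 1000000 in
theorem lintegral_norm_sq_prodSum_le : ∃ C : ℝ, 0 < C ∧ ∀ μ : Fin 5 → ℝ, ∀ ε : ℝ, 0 < ε →
    ∀ᶠ k : ℕ in atTop, ∀ (K : ℕ) (n : ℤ),
      ∫⁻ α in Set.Icc (n : ℝ) (n + 1) \ nearRat K k, ENNReal.ofReal (‖prodSum μ k α‖ ^ 2) ≤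
        (ENNReal.ofReal C * tailMass K + ENNReal.ofReal ε) * ENNReal.ofReal ((k : ℝ) ^ 19) := by
  obtain ⟨C, hC, hdich⟩ := norm_sq_prodSum_dichotomy
  refine ⟨C, hC, fun μ ε hε => ?_⟩
  have hlim : Tendsto (fun k : ℕ => 24 * C * (k : ℝ) ^ (-(1 / 8) : ℝ)) atTop (𝓝 0) := by
    have := ((tendsto_rpow_neg_atTop (y := 1 / 8) (by norm_num)).comp
      (tendsto_natCast_atTop_atTop (R := ℝ))).const_mul (24 * C)
    simpa using this
  filter_upwards [hdich, integral_norm_sq_cubeSum_mul_le (μ 0) (μ 1), eventually_ge_atTop 1,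
    hlim.eventually (gt_mem_nhds hε)] with k hk hmean hk1 hkε K n
  have hk0 : (0 : ℝ) < k := by exact_mod_cast hk1
  set g : ℝ → ℂ := fun α => cubeSum ((4 * k ^ 3 : ℕ) - μ 0) (4 * k ^ 3) α *
    cubeSum ((k ^ 2 : ℕ) - μ 1) (k ^ 2) α with hg
  have hgc : Continuous g := by
    have := continuous_cubeSum
    fun_prop
  set G : ℝ → ℝ≥0∞ := fun α => ENNReal.ofReal (‖g α‖ ^ 2 * (C * (k : ℝ) ^ (111 / 8 : ℝ)))
  set c : ℕ → ℝ≥0∞ := fun q => ENNReal.ofReal (C * (k : ℝ) ^ 28 * (q : ℝ) ^ (-(33 / 16) : ℝ))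
  set P : ℕ → ℤ → ℝ → ℝ≥0∞ := fun q a α =>
    profile K q (384 * (k : ℝ) ^ 9 * α - 64 * (k : ℝ) ^ 9 * (a / q))
  set A : ℕ → Finset ℤ := fun q => Finset.Icc (q * (6 * n - 1)) (q * (6 * n + 7))
  have hPm : ∀ q a, Measurable (P q a) := fun q a =>
    (measurable_profile K q).comp (by fun_prop)
  have hpt : ∀ α ∈ Set.Icc (n : ℝ) (n + 1) \ nearRat K k,
      ENNReal.ofReal (‖prodSum μ k α‖ ^ 2) ≤
        G α + ∑ q ∈ Finset.Icc 1 (4 * k ^ 3), ∑ a ∈ A q, c q * P q a α := by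
    rintro α ⟨⟨hα1, hα2⟩, hαE⟩
    rcases hk μ α with h | ⟨q, a, hq, hqk, hcop, h2, h⟩
    · exact le_add_of_le_of_nonneg (ENNReal.ofReal_le_ofReal h) zero_le
    · refine le_add_of_nonneg_of_le zero_le ?_
      have hq1 : (1 : ℝ) ≤ q := by exact_mod_cast hq
      have ha : a ∈ A q := by
        have e1 : (a : ℝ) = q * (a / q) := by field_simp
        rw [abs_le] at h2
        simp only [A, Finset.mem_Icc]
        constructor
        · have : (q : ℝ) * (6 * n - 1) ≤ a := by
            rw [e1]; gcongr; linarith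
          exact_mod_cast this
        · have : (a : ℝ) ≤ q * (6 * n + 7) := by
            rw [e1]; gcongr; linarith
          exact_mod_cast this
      refine le_trans ?_ (Finset.single_le_sum (f := fun q => ∑ a ∈ A q, c q * P q a α)
        (fun _ _ => zero_le) (Finset.mem_Icc.2 ⟨hq, hqk⟩))
      refine le_trans ?_ (Finset.single_le_sum (f := fun a => c q * P q a α)
        (fun _ _ => zero_le) ha)
      have e2 : |384 * (k : ℝ) ^ 9 * α - 64 * (k : ℝ) ^ 9 * (a / q)| =
          64 * (k : ℝ) ^ 9 * |6 * α - a / q| := by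
        rw [← abs_of_pos (show (0 : ℝ) < 64 * (k : ℝ) ^ 9 by positivity), ← abs_mul,
          abs_of_pos (show (0 : ℝ) < 64 * (k : ℝ) ^ 9 by positivity)]
        ring_nf
      simp only [P, profile, c]
      rw [if_neg, ← ENNReal.ofReal_mul (by positivity), e2]
      · exact ENNReal.ofReal_le_ofReal h
      · rintro ⟨hqK, hle⟩
        refine hαE ⟨q, a, hq, hqK, hcop, ?_⟩
        rw [e2] at hle
        rw [le_div_iff₀ (by positivity)]
        linarith
  have hGint : ∫⁻ α in Set.Icc (n : ℝ) (n + 1), G α ≤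
      ENNReal.ofReal ε * ENNReal.ofReal ((k : ℝ) ^ 19) := by
    have hGc : Continuous fun α => ‖g α‖ ^ 2 * (C * (k : ℝ) ^ (111 / 8 : ℝ)) := by fun_prop
    rw [← ofReal_integral_eq_lintegral_ofReal
      (hGc.integrableOn_Icc) (Eventually.of_forall fun α => by positivity),
      ← ENNReal.ofReal_mul hε.le]
    apply ENNReal.ofReal_le_ofReal
    rw [integral_Icc_eq_integral_Ioc, ← intervalIntegral.integral_of_le (by linarith),
      intervalIntegral.integral_mul_const]
    calc _ ≤ 24 * (k : ℝ) ^ 5 * (C * (k : ℝ) ^ (111 / 8 : ℝ)) := by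
          gcongr; exact hmean n
      _ = 24 * C * (k : ℝ) ^ (-(1 / 8) : ℝ) * (k : ℝ) ^ 19 := by
          have : (k : ℝ) ^ 5 * (k : ℝ) ^ (111 / 8 : ℝ) =
              (k : ℝ) ^ (-(1 / 8) : ℝ) * (k : ℝ) ^ 19 := by
            rw [← Real.rpow_natCast, ← Real.rpow_natCast, ← Real.rpow_add hk0,
              ← Real.rpow_add hk0]
            norm_num
          linear_combination 24 * C * this
      _ ≤ _ := by gcongr
  have hPint : ∀ q a, ∫⁻ α, P q a α =
      ENNReal.ofReal (384 * (k : ℝ) ^ 9)⁻¹ * ∫⁻ t, profile K q t := fun q a =>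
    lintegral_comp_mul_sub _ (measurable_profile K q) (by positivity) _
  have hterm : ∀ q ∈ Finset.Icc 1 (4 * k ^ 3), ∑ a ∈ A q, c q * ∫⁻ α, P q a α ≤
      ENNReal.ofReal C * ENNReal.ofReal ((k : ℝ) ^ 19) *
        (ENNReal.ofReal ((q : ℝ) ^ (-(17 / 16) : ℝ)) * ∫⁻ t, profile K q t) := by
    intro q hq
    have hq1 : 1 ≤ q := (Finset.mem_Icc.1 hq).1
    have hq0 : (0 : ℝ) < q := by exact_mod_cast hq1
    simp only [hPint, Finset.sum_const, nsmul_eq_mul]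
    have hcard : ((A q).card : ℝ≥0∞) ≤ ENNReal.ofReal (9 * q) := by
      rw [← ENNReal.ofReal_natCast]
      apply ENNReal.ofReal_le_ofReal
      have : ((A q).card : ℤ) ≤ 9 * q := by
        simp only [A, Int.card_Icc]
        rw [Int.toNat_of_nonneg (by nlinarith)]
        have : (1 : ℤ) ≤ q := by exact_mod_cast hq1
        nlinarith
      exact_mod_cast this
    calc _ ≤ ENNReal.ofReal (9 * q) * (c q * (ENNReal.ofReal (384 * (k : ℝ) ^ 9)⁻¹ *
            ∫⁻ t, profile K q t)) := by gcongr
      _ = ENNReal.ofReal (9 * q * (C * (k : ℝ) ^ 28 * (q : ℝ) ^ (-(33 / 16) : ℝ)) *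
            (384 * (k : ℝ) ^ 9)⁻¹) * ∫⁻ t, profile K q t := by
          simp only [c]
          rw [ENNReal.ofReal_mul
              (p := 9 * q * (C * (k : ℝ) ^ 28 * (q : ℝ) ^ (-(33 / 16) : ℝ))) (by positivity),
            ENNReal.ofReal_mul (p := 9 * q) (by positivity)]
          ring
      _ ≤ ENNReal.ofReal (C * (k : ℝ) ^ 19 * (q : ℝ) ^ (-(17 / 16) : ℝ)) *
            ∫⁻ t, profile K q t := by
          refine mul_le_mul_left (ENNReal.ofReal_le_ofReal ?_) _
          have e3 : (q : ℝ) ^ (-(17 / 16) : ℝ) = q * (q : ℝ) ^ (-(33 / 16) : ℝ) := by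
            rw [← Real.rpow_one_add' hq0.le (by norm_num)]; norm_num
          rw [e3]
          have e4 : 9 * (q : ℝ) * (C * (k : ℝ) ^ 28 * (q : ℝ) ^ (-(33 / 16) : ℝ)) *
              (384 * (k : ℝ) ^ 9)⁻¹ =
              (9 / 384) * (C * (k : ℝ) ^ 19 * (q * (q : ℝ) ^ (-(33 / 16) : ℝ))) := by
            field_simp
          rw [e4]
          have : 0 ≤ C * (k : ℝ) ^ 19 * (q * (q : ℝ) ^ (-(33 / 16) : ℝ)) := by positivity
          linarith
      _ = _ := by
          rw [ENNReal.ofReal_mul (by positivity), ENNReal.ofReal_mul hC.le]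
          ring
  calc ∫⁻ α in Set.Icc (n : ℝ) (n + 1) \ nearRat K k, ENNReal.ofReal (‖prodSum μ k α‖ ^ 2)
      ≤ ∫⁻ α in Set.Icc (n : ℝ) (n + 1) \ nearRat K k,
          (G α + ∑ q ∈ Finset.Icc 1 (4 * k ^ 3), ∑ a ∈ A q, c q * P q a α) :=
        setLIntegral_mono' (measurableSet_Icc.diff (measurableSet_nearRat K k)) hpt
    _ = (∫⁻ α in Set.Icc (n : ℝ) (n + 1) \ nearRat K k, G α) +
          ∫⁻ α in Set.Icc (n : ℝ) (n + 1) \ nearRat K k,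
            ∑ q ∈ Finset.Icc 1 (4 * k ^ 3), ∑ a ∈ A q, c q * P q a α := by
        rw [lintegral_add_left]
        have := hgc.measurable
        fun_prop
    _ ≤ (∫⁻ α in Set.Icc (n : ℝ) (n + 1), G α) +
          ∫⁻ α, ∑ q ∈ Finset.Icc 1 (4 * k ^ 3), ∑ a ∈ A q, c q * P q a α :=
        add_le_add (lintegral_mono_set Set.sdiff_subset) (setLIntegral_le_lintegral _ _)
    _ = (∫⁻ α in Set.Icc (n : ℝ) (n + 1), G α) +
          ∑ q ∈ Finset.Icc 1 (4 * k ^ 3), ∑ a ∈ A q, c q * ∫⁻ α, P q a α := by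
        congr 1
        rw [lintegral_finsetSum _ fun q _ => Finset.measurable_sum _ fun a _ =>
          (hPm q a).const_mul _]
        refine Finset.sum_congr rfl fun q _ => ?_
        rw [lintegral_finsetSum _ fun a _ => (hPm q a).const_mul _]
        refine Finset.sum_congr rfl fun a _ => ?_
        rw [lintegral_const_mul _ (hPm q a)]
    _ ≤ ENNReal.ofReal ε * ENNReal.ofReal ((k : ℝ) ^ 19) +
          ∑ q ∈ Finset.Icc (1 : ℕ) (4 * k ^ 3), ENNReal.ofReal C * ENNReal.ofReal ((k : ℝ) ^ 19) *
            (ENNReal.ofReal ((q : ℝ) ^ (-(17 / 16) : ℝ)) * ∫⁻ t, profile K q t) :=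
        add_le_add hGint (Finset.sum_le_sum hterm)
    _ ≤ ENNReal.ofReal ε * ENNReal.ofReal ((k : ℝ) ^ 19) +
          ENNReal.ofReal C * ENNReal.ofReal ((k : ℝ) ^ 19) * tailMass K := by
        rw [← Finset.mul_sum]
        gcongr
        exact ENNReal.sum_le_tsum _
    _ = _ := by ring

lemma norm_sum_sub_shift_le (g : ℤ → ℂ) (hg : ∀ n, ‖g n‖ ≤ 1) (L d : ℕ) :
    ‖∑ n ∈ Ico (0 : ℤ) L, g n - ∑ n ∈ Ico (0 : ℤ) L, g (n + d)‖ ≤ 2 * d := by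
  have hbd : ∀ a : ℤ, ‖∑ n ∈ Ico a (a + d), g n‖ ≤ d := by
    intro a
    calc _ ≤ ∑ n ∈ Ico a (a + d), (1 : ℝ) := norm_sum_le_of_le _ fun n _ => hg n
      _ = d := by simp
  have h1 : ∑ n ∈ Ico (0 : ℤ) L, g (n + d) = ∑ n ∈ Ico (d : ℤ) (L + d), g n := by
    refine Finset.sum_nbij' (fun n => n + d) (fun n => n - d) ?_ ?_ ?_ ?_ ?_ <;>
      simp
    intro n h1 h2
    omega
  have h2 : ∑ n ∈ Ico (0 : ℤ) L, g n + ∑ n ∈ Ico (L : ℤ) (L + d), g n =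
      ∑ n ∈ Ico (0 : ℤ) (0 + d), g n + ∑ n ∈ Ico (d : ℤ) (L + d), g n := by
    rw [← Finset.sum_union (Ico_disjoint_Ico_consecutive _ _ _), zero_add,
      ← Finset.sum_union (Ico_disjoint_Ico_consecutive _ _ _),
      Ico_union_Ico_eq_Ico (by positivity) (by linarith [Int.natCast_nonneg d]),
      Ico_union_Ico_eq_Ico (by positivity) (by linarith [Int.natCast_nonneg L])]
  have h3 : ∑ n ∈ Ico (0 : ℤ) L, g n - ∑ n ∈ Ico (d : ℤ) (L + d), g n =
      ∑ n ∈ Ico (0 : ℤ) (0 + d), g n - ∑ n ∈ Ico (L : ℤ) (L + d), g n := by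
    linear_combination h2
  rw [h1, h3]
  calc _ ≤ _ := norm_sub_le _ _
    _ ≤ d + d := add_le_add (hbd 0) (hbd L)
    _ = _ := by ring

lemma van_der_corput (g : ℤ → ℂ) (hg : ∀ n, ‖g n‖ ≤ 1) (L r H : ℕ) {W : ℝ} (hW : 0 ≤ W)
    (hcorr : ∀ h < H, ∀ h' < H, h ≠ h' →
      ‖∑ n ∈ Ico (0 : ℤ) L, g (n + (r * h : ℕ)) * (starRingEnd ℂ) (g (n + (r * h' : ℕ)))‖ ≤ W) :
    H * ‖∑ n ∈ Ico (0 : ℤ) L, g n‖ ≤ √(L * (H * L + H ^ 2 * W)) + 2 * r * H ^ 2 := by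
  set G : ℤ → ℂ := fun n => ∑ h ∈ range H, g (n + (r * h : ℕ)) with hG
  have hshift : ‖(H : ℂ) * ∑ n ∈ Ico (0 : ℤ) L, g n - ∑ n ∈ Ico (0 : ℤ) L, G n‖ ≤
      2 * r * H ^ 2 := by
    have : (H : ℂ) * ∑ n ∈ Ico (0 : ℤ) L, g n - ∑ n ∈ Ico (0 : ℤ) L, G n =
        ∑ h ∈ range H, (∑ n ∈ Ico (0 : ℤ) L, g n -
          ∑ n ∈ Ico (0 : ℤ) L, g (n + (r * h : ℕ))) := by
      rw [Finset.sum_sub_distrib, hG, Finset.sum_comm]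
      simp
    rw [this]
    calc _ ≤ ∑ h ∈ range H, (2 * r * H : ℝ) := norm_sum_le_of_le _ fun h hh => by
          refine (norm_sum_sub_shift_le g hg L (r * h)).trans ?_
          have : (h : ℝ) ≤ H := by exact_mod_cast (mem_range.1 hh).le
          push_cast
          rw [mul_assoc]
          gcongr
      _ = _ := by simp; ring
  have hsq : ∑ n ∈ Ico (0 : ℤ) L, ‖G n‖ ^ 2 ≤ H * L + H ^ 2 * W := by
    have e1 : ((∑ n ∈ Ico (0 : ℤ) L, ‖G n‖ ^ 2 : ℝ) : ℂ) =
        ∑ h ∈ range H, ∑ h' ∈ range H, ∑ n ∈ Ico (0 : ℤ) L,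
          g (n + (r * h : ℕ)) * (starRingEnd ℂ) (g (n + (r * h' : ℕ))) := by
      push_cast
      have : ∀ n, (‖G n‖ : ℂ) ^ 2 = ∑ h ∈ range H, ∑ h' ∈ range H,
          g (n + (r * h : ℕ)) * (starRingEnd ℂ) (g (n + (r * h' : ℕ))) := by
        intro n
        rw [← Complex.mul_conj', hG, map_sum, Finset.sum_mul_sum]
      simp only [this]
      rw [Finset.sum_comm]
      refine Finset.sum_congr rfl fun h _ => ?_
      exact Finset.sum_comm
    have hn : ∑ n ∈ Ico (0 : ℤ) L, ‖G n‖ ^ 2 =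
        ‖((∑ n ∈ Ico (0 : ℤ) L, ‖G n‖ ^ 2 : ℝ) : ℂ)‖ := by
      rw [Complex.norm_real, Real.norm_of_nonneg (by positivity)]
    rw [hn, e1]
    calc _ ≤ ∑ h ∈ range H, ∑ h' ∈ range H, ((if h = h' then (L : ℝ) else 0) + W) := by
          refine norm_sum_le_of_le _ fun h hh => norm_sum_le_of_le _ fun h' hh' => ?_
          split_ifs with heq
          · subst heq
            calc _ ≤ ∑ n ∈ Ico (0 : ℤ) L, (1 : ℝ) := norm_sum_le_of_le _ fun n _ => by
                  rw [norm_mul, RCLike.norm_conj]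
                  exact mul_le_one₀ (hg _) (norm_nonneg _) (hg _)
              _ = L := by simp
              _ ≤ L + W := by linarith
          · rw [zero_add]
            exact hcorr h (mem_range.1 hh) h' (mem_range.1 hh') heq
      _ = _ := by
          simp only [Finset.sum_add_distrib, Finset.sum_ite_eq, Finset.sum_const, card_range,
            nsmul_eq_mul]
          rw [Finset.sum_congr rfl (g := fun _ => (L : ℝ)) fun h hh => if_pos hh]
          simp; ring
  have hGs : ‖∑ n ∈ Ico (0 : ℤ) L, G n‖ ≤ √(L * (H * L + H ^ 2 * W)) := by
    apply Real.le_sqrt_of_sq_le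
    calc ‖∑ n ∈ Ico (0 : ℤ) L, G n‖ ^ 2 ≤ (∑ n ∈ Ico (0 : ℤ) L, ‖G n‖) ^ 2 := by
          gcongr; exact norm_sum_le _ _
      _ ≤ (Ico (0 : ℤ) L).card * ∑ n ∈ Ico (0 : ℤ) L, ‖G n‖ ^ 2 := sq_sum_le_card_mul_sum_sq
      _ ≤ _ := by simp; gcongr
  calc H * ‖∑ n ∈ Ico (0 : ℤ) L, g n‖ = ‖(H : ℂ) * ∑ n ∈ Ico (0 : ℤ) L, g n‖ := by simp
    _ = ‖∑ n ∈ Ico (0 : ℤ) L, G n +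
          ((H : ℂ) * ∑ n ∈ Ico (0 : ℤ) L, g n - ∑ n ∈ Ico (0 : ℤ) L, G n)‖ := by
        congr 1; ring
    _ ≤ _ := (norm_add_le _ _).trans (add_le_add hGs hshift)

set_option maxHeartbeats 2000000 in
/-- On the arc around `a / (6 * q)` with `a ≠ 0`, the derivative of the differenced phase is a nonzero
integer multiple of the irrational shift, so the cubic sum is `o(L)`. -/
theorem norm_cubeSum_le_of_irrational {μ : ℝ} (hμ : Irrational μ) {q : ℕ} (hq : 0 < q) {a : ℤ}
    (ha : a ≠ 0) (K : ℝ) {ε : ℝ} (hε : 0 < ε) :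
    ∀ᶠ L : ℕ in atTop, ∀ α : ℝ, |6 * α - a / q| ≤ K / (L : ℝ) ^ 3 →
      ‖cubeSum (L - μ) L α‖ ≤ ε * L := by
  by_cases hK : K < 0
  · filter_upwards [eventually_ge_atTop 1] with L hL α hα
    have : (0 : ℝ) < L := by exact_mod_cast hL
    exact absurd ((abs_nonneg _).trans hα) (not_le.2 (div_neg_of_neg_of_pos hK (by positivity)))
  push Not at hK
  obtain ⟨H, hH⟩ := exists_nat_gt (8 / ε ^ 2)
  have hH0 : (0 : ℝ) < H := lt_trans (by positivity) hH
  set r : ℕ := 6 * q with hr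
  have hr0 : (0 : ℝ) < r := by rw [hr]; push_cast; positivity
  -- lower bound for the distances of the relevant frequencies to the integers
  have hδ : ∀ h < H, ∀ h' < H, h ≠ h' → 0 < nint (6 * a * (((h : ℤ) - h' : ℤ) : ℝ) * μ) := by
    intro h _ h' _ hne
    rw [nint, abs_pos, sub_ne_zero]
    have h1 : (6 * a * ((h : ℤ) - h') : ℤ) ≠ 0 := by
      have : ((h : ℤ) - h') ≠ 0 := sub_ne_zero.2 (by exact_mod_cast hne)
      positivity
    have h2 := (hμ.intCast_mul h1).ne_int (round (6 * a * (((h : ℤ) - h' : ℤ) : ℝ) * μ))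
    push_cast at h2 ⊢
    exact h2
  set W₀ : ℝ := ∑ h ∈ range H, ∑ h' ∈ range H, 2 / nint (6 * a * (((h : ℤ) - h' : ℤ) : ℝ) * μ)
  have hW₀ : ∀ h < H, ∀ h' < H, h ≠ h' → ∀ L,
      2 * wt L (6 * a * (((h : ℤ) - h' : ℤ) : ℝ) * μ) ≤ W₀ := by
    intro h hh h' hh' hne L
    have h1 := wt_le_inv L (hδ h hh h' hh' hne) le_rfl
    have hnn : ∀ h h' : ℕ, 0 ≤ 2 / nint (6 * a * (((h : ℤ) - h' : ℤ) : ℝ) * μ) :=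
      fun h h' => div_nonneg (by norm_num) (nint_nonneg _)
    calc _ ≤ 2 / nint (6 * a * (((h : ℤ) - h' : ℤ) : ℝ) * μ) := by
          rw [div_eq_mul_one_div]; gcongr
      _ ≤ _ := single_le_sum (f := fun h' : ℕ => 2 / nint (6 * a * (((h : ℤ) - h' : ℤ) : ℝ) * μ))
          (fun h' _ => hnn h h') (mem_range.2 hh')
      _ ≤ _ := single_le_sum (f := fun h : ℕ => ∑ h' ∈ range H,
          2 / nint (6 * a * (((h : ℤ) - h' : ℤ) : ℝ) * μ))
          (fun h _ => sum_nonneg fun h' _ => hnn h h') (mem_range.2 hh)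
  have hW₀0 : 0 ≤ W₀ := sum_nonneg fun h _ => sum_nonneg fun h' _ =>
    div_nonneg (by norm_num) (nint_nonneg _)
  set W : ℝ := W₀ + 2 * Real.pi * (8 * K * (r * H))
  have hW0 : 0 ≤ W := by positivity
  filter_upwards [eventually_ge_atTop 1, eventually_ge_atTop ⌈|μ|⌉₊, eventually_ge_atTop (r * H),
    eventually_ge_atTop ⌈H * W⌉₊, eventually_ge_atTop ⌈4 * r * H / ε⌉₊]
    with L hL1 hLμ hLr hLW hLε α hα
  have hL0 : (0 : ℝ) < L := by exact_mod_cast hL1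
  replace hLμ : |μ| ≤ L := Nat.ceil_le.1 hLμ
  replace hLr : (r : ℝ) * H ≤ L := by exact_mod_cast hLr
  replace hLW := Nat.ceil_le.1 hLW
  replace hLε := Nat.ceil_le.1 hLε
  have hcorr : ∀ h < H, ∀ h' < H, h ≠ h' →
      ‖∑ n ∈ Ico (0 : ℤ) L, e (α * (((n + (r * h : ℕ) : ℤ) : ℝ) + (L - μ)) ^ 3) *
        (starRingEnd ℂ) (e (α * (((n + (r * h' : ℕ) : ℤ) : ℝ) + (L - μ)) ^ 3))‖ ≤ W := by
    intro h hh h' hh' hne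
    set δ : ℤ := (h : ℤ) - h' with hδdef
    set β : ℝ := α - a / r with hβdef
    have hβ : |β| ≤ K / (6 * (L : ℝ) ^ 3) := by
      have e1 : 6 * |β| = |6 * α - a / q| := by
        rw [← abs_of_pos (show (0 : ℝ) < 6 by norm_num), ← abs_mul,
          abs_of_pos (show (0 : ℝ) < 6 by norm_num), hβdef, hr]
        congr 1
        push_cast
        field_simp
      rw [← e1] at hα
      rw [show K / (6 * (L : ℝ) ^ 3) = K / (L : ℝ) ^ 3 / 6 by field_simp]
      linarith
    set θ : ℝ := -(6 * a * δ * μ) with hθ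
    set γ : ℝ := -6 * a * δ * μ * L + 3 * a * δ * μ ^ 2 -
      3 * a * r * μ * ((h : ℝ) ^ 2 - (h' : ℝ) ^ 2) + a * (r : ℝ) ^ 2 * ((h : ℝ) ^ 3 - (h' : ℝ) ^ 3)
      with hγ
    set Q : ℤ → ℝ := fun n => β * ((n + r * h + (L - μ)) ^ 3 - (n + r * h' + (L - μ)) ^ 3) with hQdef
    have hterm : ∀ n : ℤ, e (α * (((n + (r * h : ℕ) : ℤ) : ℝ) + (L - μ)) ^ 3) *
        (starRingEnd ℂ) (e (α * (((n + (r * h' : ℕ) : ℤ) : ℝ) + (L - μ)) ^ 3)) =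
        e (θ * n + γ) + e (θ * n + γ) * (e (Q n) - 1) := by
      intro n
      rw [e_mul_conj, show ∀ x y : ℂ, x + x * (y - 1) = x * y by intros; ring, ← e_add]
      have hZ : α * (((n + (r * h : ℕ) : ℤ) : ℝ) + (L - μ)) ^ 3 -
          α * (((n + (r * h' : ℕ) : ℤ) : ℝ) + (L - μ)) ^ 3 =
          θ * n + γ + Q n + ((3 * a * δ * (n + L) ^ 2 +
            3 * a * r * (n + L) * ((h : ℤ) ^ 2 - (h' : ℤ) ^ 2) : ℤ) : ℝ) := by
        have : α = β + a / r := by rw [hβdef]; ring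
        rw [hθ, hγ, hQdef, this, hδdef]
        push_cast
        field_simp
        ring
      rw [hZ, e_add _ ((_ : ℤ) : ℝ), e_int, mul_one]
    have hQ : ∀ n ∈ Ico (0 : ℤ) L, ‖e (θ * n + γ) * (e (Q n) - 1)‖ ≤
        2 * Real.pi * (8 * K * (r * H)) / L := by
      intro n hn
      obtain ⟨hn0, hn1⟩ := mem_Ico.1 hn
      have hn0' : (0 : ℝ) ≤ n := by exact_mod_cast hn0
      have hn1' : (n : ℝ) ≤ L := by exact_mod_cast hn1.le
      have hX : ∀ j < H, |(n : ℝ) + r * j + (L - μ)| ≤ 4 * L := by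
        intro j hj
        have : (j : ℝ) ≤ H := by exact_mod_cast hj.le
        have h5 : (r : ℝ) * j ≤ r * H := by gcongr
        have h6 : (0 : ℝ) ≤ r * j := by positivity
        have h7 := abs_le.1 hLμ
        rw [abs_le]; constructor <;> linarith
      have hXY : |((n : ℝ) + r * h + (L - μ)) ^ 3 - ((n : ℝ) + r * h' + (L - μ)) ^ 3| ≤
          r * H * (48 * (L : ℝ) ^ 2) := by
        have hx := hX h hh
        have hy := hX h' hh'
        set X := (n : ℝ) + r * h + (L - μ) with hXdef
        set Y := (n : ℝ) + r * h' + (L - μ) with hYdef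
        have hd : |X - Y| ≤ r * H := by
          have e1 : X - Y = r * ((h : ℝ) - h') := by rw [hXdef, hYdef]; ring
          rw [e1, abs_mul, abs_of_pos hr0]
          gcongr
          have : (h : ℝ) ≤ H := by exact_mod_cast hh.le
          have : (h' : ℝ) ≤ H := by exact_mod_cast hh'.le
          have : (0 : ℝ) ≤ h := by positivity
          have : (0 : ℝ) ≤ h' := by positivity
          rw [abs_le]; constructor <;> linarith
        rw [show X ^ 3 - Y ^ 3 = (X - Y) * (X ^ 2 + X * Y + Y ^ 2) by ring, abs_mul]
        gcongr
        have hx2 : X ^ 2 ≤ (4 * L) ^ 2 := sq_le_sq' (abs_le.1 hx).1 (abs_le.1 hx).2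
        have hy2 : Y ^ 2 ≤ (4 * L) ^ 2 := sq_le_sq' (abs_le.1 hy).1 (abs_le.1 hy).2
        rw [abs_of_nonneg (by nlinarith [sq_nonneg (X + Y)])]
        nlinarith [sq_nonneg (X - Y)]
      rw [norm_mul, norm_e, one_mul]
      calc _ ≤ 2 * Real.pi * |Q n| := norm_e_sub_one_le _
        _ ≤ 2 * Real.pi * (K / (6 * (L : ℝ) ^ 3) * (r * H * (48 * (L : ℝ) ^ 2))) := by
            rw [hQdef, abs_mul]
            gcongr
        _ = _ := by field_simp; ring
    rw [Finset.sum_congr rfl fun n _ => hterm n, Finset.sum_add_distrib]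
    have h1 : ‖∑ n ∈ Ico (0 : ℤ) L, e (θ * n + γ)‖ ≤ W₀ := by
      refine (norm_geom_le θ γ L 0 L (by simp)).trans ?_
      rw [hθ, wt_neg]
      exact hW₀ h hh h' hh' hne L
    have h2 : ‖∑ n ∈ Ico (0 : ℤ) L, e (θ * n + γ) * (e (Q n) - 1)‖ ≤
        2 * Real.pi * (8 * K * (r * H)) := by
      refine (norm_sum_le_of_le _ hQ).trans (le_of_eq ?_)
      simp
      field_simp
    exact (norm_add_le _ _).trans (add_le_add h1 h2)
  have hv := van_der_corput (fun n => e (α * ((n : ℝ) + (L - μ)) ^ 3)) (fun n => (norm_e _).le)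
    L r H hW0 hcorr
  change H * ‖cubeSum (L - μ) L α‖ ≤ _ at hv
  have h1 : √(L * (H * L + H ^ 2 * W)) ≤ ε * H * L / 2 := by
    apply Real.sqrt_le_iff.2 ⟨by positivity, ?_⟩
    rw [div_lt_iff₀ (by positivity)] at hH
    calc L * (H * L + H ^ 2 * W) = L * H * (L + H * W) := by ring
      _ ≤ L * H * (L + L) := by gcongr
      _ = L ^ 2 * H * 8 / 4 := by ring
      _ ≤ L ^ 2 * H * (H * ε ^ 2) / 4 := by gcongr
      _ = _ := by ring
  have h2 : 2 * r * (H : ℝ) ^ 2 ≤ ε * H * L / 2 := by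
    rw [div_le_iff₀ hε] at hLε
    nlinarith
  have h3 : H * ‖cubeSum (L - μ) L α‖ ≤ H * (ε * L) := by linarith
  exact le_of_mul_le_mul_left h3 hH0

/-- Frequencies `α` for which `6α` is close to a nonzero rational of denominator at most `K`. -/
def nearNonzeroRat (K k : ℕ) : Set ℝ :=
  {α | ∃ (q : ℕ) (a : ℤ), 0 < q ∧ q ≤ K ∧ a ≠ 0 ∧ |6 * α - a / q| ≤ K / (64 * (k : ℝ) ^ 9)}

lemma measurableSet_nearNonzeroRat (K k : ℕ) : MeasurableSet (nearNonzeroRat K k) := by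
  have : nearNonzeroRat K k = ⋃ q : ℕ, ⋃ a : ℤ, {α : ℝ | 0 < q ∧ q ≤ K ∧ a ≠ 0 ∧
    |6 * α - a / q| ≤ K / (64 * (k : ℝ) ^ 9)} := by
    ext; simp [nearNonzeroRat]
  rw [this]
  refine MeasurableSet.iUnion fun q => MeasurableSet.iUnion fun a => ?_
  refine (MeasurableSet.const _).inter ((MeasurableSet.const _).inter
    ((MeasurableSet.const _).inter ?_))
  exact measurableSet_le (f := fun α : ℝ => |6 * α - a / q|) (by fun_prop) measurable_const

lemma norm_cubeSum_le (c : ℝ) (L : ℕ) (α : ℝ) : ‖cubeSum c L α‖ ≤ L := by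
  refine (norm_sum_le_of_le _ fun n _ => (norm_e _).le).trans ?_
  simp

lemma abs_numerator_le {T K k q : ℕ} {a : ℤ} {α : ℝ} (hk : 0 < k) (hKk : K ≤ k)
    (hα : α ∈ Set.Icc (-T : ℝ) T) (hq : 0 < q) (hqK : q ≤ K)
    (h : |6 * α - a / q| ≤ K / (64 * (k : ℝ) ^ 9)) : |a| ≤ K * (6 * T + 1) := by
  obtain ⟨h1, h2⟩ := hα
  have hk1 : (1 : ℝ) ≤ k := by exact_mod_cast hk
  have hq0 : (0 : ℝ) < q := by exact_mod_cast hq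
  have hqK' : (q : ℝ) ≤ K := by exact_mod_cast hqK
  have hρ : K / (64 * (k : ℝ) ^ 9) ≤ 1 := by
    rw [div_le_one (by positivity)]
    have : (k : ℝ) ≤ (k : ℝ) ^ 9 := le_self_pow₀ hk1 (by norm_num)
    have : (K : ℝ) ≤ k := by exact_mod_cast hKk
    nlinarith
  have hT : |6 * α| ≤ 6 * T := by rw [abs_le]; constructor <;> linarith
  have ha : |(a : ℝ)| ≤ K * (6 * T + 1) := by
    have e1 : (a : ℝ) = q * (a / q) := by field_simp
    rw [e1, abs_mul, abs_of_pos hq0]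
    gcongr
    calc |(a : ℝ) / q| = |6 * α - (6 * α - a / q)| := by congr 1; ring
      _ ≤ |6 * α| + |6 * α - a / q| := abs_sub _ _
      _ ≤ _ := by linarith
  exact_mod_cast ha

lemma volume_nearNonzeroRat_le (T K k : ℕ) (hk : 0 < k) (hKk : K ≤ k) :
    volume (Set.Icc (-T : ℝ) T ∩ nearNonzeroRat K k) ≤
      ENNReal.ofReal (K * (2 * (K * (6 * T + 1)) + 1) * (K / (192 * (k : ℝ) ^ 9))) := by
  have hk1 : (1 : ℝ) ≤ k := by exact_mod_cast hk
  set A : ℤ := K * (6 * T + 1) with hA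
  have hsub : Set.Icc (-T : ℝ) T ∩ nearNonzeroRat K k ⊆
      ⋃ p ∈ Icc 1 K ×ˢ Icc (-A) A,
        Metric.closedBall ((p.2 : ℝ) / (6 * p.1)) (K / (384 * (k : ℝ) ^ 9)) := by
    rintro α ⟨⟨h1, h2⟩, q, a, hq, hqK, -, h⟩
    have hq0 : (0 : ℝ) < q := by exact_mod_cast hq
    have ha' := abs_numerator_le hk hKk ⟨h1, h2⟩ hq hqK h
    simp only [Set.mem_iUnion]
    refine ⟨(q, a), mem_product.2 ⟨mem_Icc.2 ⟨hq, hqK⟩, mem_Icc.2 (abs_le.1 ha')⟩, ?_⟩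
    rw [Metric.mem_closedBall, Real.dist_eq]
    have e2 : 6 * |α - a / (6 * q)| = |6 * α - a / q| := by
      rw [← abs_of_pos (show (0 : ℝ) < 6 by norm_num), ← abs_mul,
        abs_of_pos (show (0 : ℝ) < 6 by norm_num)]
      congr 1
      field_simp
    have e3 : K / (384 * (k : ℝ) ^ 9) = K / (64 * (k : ℝ) ^ 9) / 6 := by field_simp; ring
    rw [e3]
    simp only
    linarith
  refine (measure_mono hsub).trans ((measure_biUnion_finset_le _ _).trans (le_of_eq ?_))
  simp only [Real.volume_closedBall, sum_const, nsmul_eq_mul, card_product]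
  rw [← ENNReal.ofReal_natCast, ← ENNReal.ofReal_mul (by positivity)]
  congr 1
  have hA0 : 0 ≤ A := by positivity
  have : ((Icc (-A) A).card : ℝ) = 2 * A + 1 := by
    have : ((Icc (-A) A).card : ℤ) = 2 * A + 1 := by
      rw [Int.card_Icc, Int.toNat_of_nonneg (by omega)]; ring
    exact_mod_cast this
  push_cast
  rw [this, hA]
  simp only [Nat.card_Icc, add_tsub_cancel_right]
  push_cast
  ring

theorem lintegral_norm_sq_prodSum_nearNonzeroRat_le (μ : Fin 5 → ℝ) (hμ : Irrational (μ 0))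
    (T K : ℕ) {ε : ℝ} (hε : 0 < ε) : ∀ᶠ k : ℕ in atTop,
      ∫⁻ α in Set.Icc (-T : ℝ) T ∩ nearNonzeroRat K k, ENNReal.ofReal (‖prodSum μ k α‖ ^ 2) ≤
        ENNReal.ofReal (ε * (k : ℝ) ^ 19) := by
  set C : ℝ := K * (2 * (K * (6 * T + 1)) + 1) * K / 192 with hC
  have hC0 : 0 ≤ C := by positivity
  set ε' : ℝ := √(ε / (4 ^ 8 * (C + 1))) with hε'
  have hε'0 : 0 < ε' := Real.sqrt_pos.2 (by positivity)
  have hε'sq : ε' ^ 2 * (4 ^ 8 * (C + 1)) = ε := by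
    rw [hε', Real.sq_sqrt (by positivity)]; field_simp
  set A : ℤ := K * (6 * T + 1) with hA
  have htend : Tendsto (fun k : ℕ => 4 * k ^ 3) atTop atTop :=
    tendsto_atTop_mono (fun k => by
      have : k ≤ k ^ 3 := Nat.le_self_pow (by norm_num) k
      show k ≤ 4 * k ^ 3
      omega) tendsto_id
  have hall : ∀ᶠ L : ℕ in atTop, ∀ q ∈ Icc 1 K, ∀ a ∈ (Icc (-A) A).filter (· ≠ 0), ∀ α : ℝ,
      |6 * α - a / q| ≤ K / (L : ℝ) ^ 3 → ‖cubeSum (L - μ 0) L α‖ ≤ ε' * L := by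
    refine (eventually_all_finset _).2 fun q hq => (eventually_all_finset _).2 fun a ha => ?_
    exact norm_cubeSum_le_of_irrational hμ (mem_Icc.1 hq).1 (mem_filter.1 ha).2 K hε'0
  filter_upwards [htend.eventually hall, eventually_ge_atTop 1, eventually_ge_atTop K]
    with k hk hk1 hkK
  have hk0 : (0 : ℝ) < k := by exact_mod_cast hk1
  have hL3 : ((4 * k ^ 3 : ℕ) : ℝ) ^ 3 = 64 * (k : ℝ) ^ 9 := by push_cast; ring
  have hpt : ∀ α ∈ Set.Icc (-T : ℝ) T ∩ nearNonzeroRat K k,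
      ENNReal.ofReal (‖prodSum μ k α‖ ^ 2) ≤ ENNReal.ofReal (ε' ^ 2 * 4 ^ 8 * (k : ℝ) ^ 28) := by
    rintro α ⟨hα, q, a, hq, hqK, ha, h⟩
    apply ENNReal.ofReal_le_ofReal
    have hA' := abs_numerator_le hk1 hkK hα hq hqK h
    have h0 := hk q (mem_Icc.2 ⟨hq, hqK⟩) a
      (mem_filter.2 ⟨mem_Icc.2 (abs_le.1 hA'), ha⟩) α (by rw [hL3]; exact h)
    have h1 := norm_cubeSum_le ((k ^ 2 : ℕ) - μ 1) (k ^ 2) α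
    have h2 := fun i => norm_cubeSum_le ((4 * k ^ 3 : ℕ) - μ i) (4 * k ^ 3) α
    rw [prodSum, norm_mul, norm_mul, norm_mul, norm_mul]
    calc _ ≤ (ε' * (4 * k ^ 3 : ℕ) * (k ^ 2 : ℕ) *
            ((4 * k ^ 3 : ℕ) * (4 * k ^ 3 : ℕ) * (4 * k ^ 3 : ℕ))) ^ 2 := by
          gcongr
          exacts [h2 2, h2 3, h2 4]
      _ = _ := by push_cast; ring
  calc _ ≤ ∫⁻ _ in Set.Icc (-T : ℝ) T ∩ nearNonzeroRat K k,
          ENNReal.ofReal (ε' ^ 2 * 4 ^ 8 * (k : ℝ) ^ 28) :=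
        setLIntegral_mono' (measurableSet_Icc.inter (measurableSet_nearNonzeroRat K k)) hpt
    _ ≤ ENNReal.ofReal (ε' ^ 2 * 4 ^ 8 * (k : ℝ) ^ 28) *
          ENNReal.ofReal (K * (2 * (K * (6 * T + 1)) + 1) * (K / (192 * (k : ℝ) ^ 9))) := by
        rw [setLIntegral_const]
        gcongr
        exact volume_nearNonzeroRat_le T K k hk1 hkK
    _ = ENNReal.ofReal (ε' ^ 2 * (4 ^ 8 * C) * (k : ℝ) ^ 19) := by
        rw [← ENNReal.ofReal_mul (by positivity), hC]
        congr 1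
        field_simp
    _ ≤ _ := by
        apply ENNReal.ofReal_le_ofReal
        gcongr
        rw [← hε'sq]
        gcongr
        linarith

lemma fourier_eq_integral_e (f : 𝓢(ℝ, ℂ)) (ξ : ℝ) : 𝓕 f ξ = ∫ t, e (-(t * ξ)) * f t := by
  rw [SchwartzMap.fourier_coe, Real.fourier_real_eq_integral_exp_smul]
  refine integral_congr_ae (Eventually.of_forall fun t => ?_)
  simp only [e, smul_eq_mul]
  congr 2
  push_cast
  ring

/-- The `L¹`-normalised dilate of a Schwartz function. -/
noncomputable def dilate (b : 𝓢(ℝ, ℂ)) {c : ℝ} (hc : c ≠ 0) : 𝓢(ℝ, ℂ) :=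
  c⁻¹ • SchwartzMap.compCLMOfContinuousLinearEquiv ℂ
    (ContinuousLinearEquiv.unitsEquivAut ℝ (Units.mk0 c⁻¹ (inv_ne_zero hc))) b

lemma dilate_apply (b : 𝓢(ℝ, ℂ)) {c : ℝ} (hc : c ≠ 0) (t : ℝ) :
    dilate b hc t = c⁻¹ * b (t * c⁻¹) := by
  simp [dilate]

lemma fourier_dilate (b : 𝓢(ℝ, ℂ)) {c : ℝ} (hc : 0 < c) (ξ : ℝ) :
    𝓕 (dilate b hc.ne') ξ = 𝓕 b (c * ξ) := by
  rw [fourier_eq_integral_e, fourier_eq_integral_e]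
  have := Measure.integral_comp_mul_right (fun u : ℝ => e (-(u * (c * ξ))) * b u) c⁻¹
  rw [inv_inv, abs_of_pos hc] at this
  have h2 : ∫ t, e (-(t * ξ)) * dilate b hc.ne' t =
      (c : ℂ)⁻¹ * ∫ x : ℝ, e (-(x * c⁻¹ * (c * ξ))) * b (x * c⁻¹) := by
    rw [← integral_const_mul]
    refine integral_congr_ae (Eventually.of_forall fun t => ?_)
    simp only [dilate_apply]
    rw [show t * c⁻¹ * (c * ξ) = t * ξ by field_simp]
    push_cast
    ring
  have hc' : (c : ℂ) ≠ 0 := by exact_mod_cast hc.ne'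
  rw [h2, this]
  simp [hc']

lemma fourier_compSubConst (f : 𝓢(ℝ, ℂ)) (v ξ : ℝ) :
    𝓕 (f.compSubConstCLM ℂ v) ξ = e (-(v * ξ)) * 𝓕 f ξ := by
  rw [fourier_eq_integral_e, fourier_eq_integral_e, ← integral_const_mul,
    ← integral_add_right_eq_self _ v]
  refine integral_congr_ae (Eventually.of_forall fun t => ?_)
  simp only [SchwartzMap.compSubConstCLM_apply, ← mul_assoc, ← e_add]
  rw [add_sub_cancel_right]
  congr 2
  ring

lemma lintegral_norm_sq_fourier (f : 𝓢(ℝ, ℂ)) :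
    ∫⁻ t, ENNReal.ofReal (‖f t‖ ^ 2) = ∫⁻ ξ, ENNReal.ofReal (‖𝓕 f ξ‖ ^ 2) := by
  have hint : ∀ g : 𝓢(ℝ, ℂ), Integrable fun t => ‖g t‖ ^ 2 := fun g =>
    (g.memLp 2 volume).integrable_norm_pow (by norm_num)
  rw [← ofReal_integral_eq_lintegral_ofReal (hint f) (Eventually.of_forall fun _ => by positivity),
    ← ofReal_integral_eq_lintegral_ofReal (hint (𝓕 f))
      (Eventually.of_forall fun _ => by positivity), SchwartzMap.integral_norm_sq_fourier]

theorem lintegral_norm_sq_kernel_sum (b : 𝓢(ℝ, ℂ)) {η Λ : ℝ} (hη : 0 < η) (hΛ : 0 < Λ)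
    {ι : Type*} (P : Finset ι) (v : ι → ℝ) :
    ∫⁻ τ, ENNReal.ofReal (‖∑ p ∈ P, ((η : ℂ)⁻¹ * b ((τ - v p) * η⁻¹) -
        (Λ : ℂ)⁻¹ * b ((τ - v p) * Λ⁻¹))‖ ^ 2) =
      ∫⁻ α, ENNReal.ofReal (‖∑ p ∈ P, e (α * v p)‖ ^ 2) *
        ENNReal.ofReal (‖𝓕 b (η * α) - 𝓕 b (Λ * α)‖ ^ 2) := by
  set κ : 𝓢(ℝ, ℂ) := dilate b hη.ne' - dilate b hΛ.ne' with hκ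
  set D : 𝓢(ℝ, ℂ) := ∑ p ∈ P, κ.compSubConstCLM ℂ (v p) with hD
  have hFκ : ∀ ξ, 𝓕 κ ξ = 𝓕 b (η * ξ) - 𝓕 b (Λ * ξ) := by
    intro ξ
    rw [← fourier_dilate b hη, ← fourier_dilate b hΛ, hκ,
      show 𝓕 (dilate b hη.ne' - dilate b hΛ.ne') = _ from
        map_sub (SchwartzMap.fourierTransformCLM ℂ) _ _]
    rfl
  have hFD : ∀ ξ, 𝓕 D ξ = (∑ p ∈ P, e (-(v p * ξ))) * 𝓕 κ ξ := by
    intro ξ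
    have : 𝓕 D = ∑ p ∈ P, 𝓕 (κ.compSubConstCLM ℂ (v p)) :=
      map_sum (SchwartzMap.fourierTransformCLM ℂ) _ _
    rw [this, _root_.sum_apply, Finset.sum_mul]
    exact Finset.sum_congr rfl fun p _ => fourier_compSubConst _ _ _
  have hDv : ∀ t, D t = ∑ p ∈ P, ((η : ℂ)⁻¹ * b ((t - v p) * η⁻¹) -
        (Λ : ℂ)⁻¹ * b ((t - v p) * Λ⁻¹)) := by
    intro t
    rw [hD, _root_.sum_apply]
    refine Finset.sum_congr rfl fun p _ => ?_
    rw [SchwartzMap.compSubConstCLM_apply, hκ, _root_.sub_apply, dilate_apply, dilate_apply]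
    push_cast
    rfl
  have := lintegral_norm_sq_fourier D
  simp only [hDv, hFD, hFκ] at this
  rw [this]
  refine lintegral_congr fun α => ?_
  rw [← ENNReal.ofReal_mul (by positivity), norm_mul, mul_pow]
  have : ∑ p ∈ P, e (-(v p * α)) = (starRingEnd ℂ) (∑ p ∈ P, e (α * v p)) := by
    rw [map_sum]
    exact Finset.sum_congr rfl fun p _ => by rw [conj_e, mul_comm]
  rw [this, RCLike.norm_conj]

lemma exists_fourier_bounds (f : 𝓢(ℝ, ℂ)) : ∃ C : ℝ, 0 < C ∧ ∀ x : ℝ,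
    ‖𝓕 f x‖ ≤ C ∧ |x| * ‖𝓕 f x‖ ≤ C ∧ ‖𝓕 f x - 𝓕 f 0‖ ≤ C * |x| := by
  obtain ⟨C₀, hC₀, h₀⟩ := (𝓕 f).decay 0 0
  obtain ⟨C₁, hC₁, h₁⟩ := (𝓕 f).decay 1 0
  obtain ⟨C₂, hC₂, h₂⟩ := (𝓕 f).decay 0 1
  simp only [pow_zero, one_mul, norm_iteratedFDeriv_zero, pow_one, Real.norm_eq_abs,
    norm_iteratedFDeriv_one] at h₀ h₁ h₂
  refine ⟨C₀ + C₁ + C₂, by linarith, fun x => ⟨(h₀ x).trans (by linarith),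
    (h₁ x).trans (by linarith), ?_⟩⟩
  have := Convex.norm_image_sub_le_of_norm_fderiv_le (𝕜 := ℝ) (f := fun y => 𝓕 f y) (s := Set.univ)
    (fun y _ => (𝓕 f).differentiableAt) (fun y _ => h₂ y) convex_univ (Set.mem_univ 0)
    (Set.mem_univ x)
  rw [sub_zero, Real.norm_eq_abs] at this
  refine this.trans ?_
  gcongr
  linarith

lemma exists_bump : ∃ (b : 𝓢(ℝ, ℂ)) (β : ℝ → ℝ), (∀ t, b t = β t) ∧ (∀ t, 0 ≤ β t) ∧
    (∀ t, |t| ≤ 1 / 2 → β t = 1) ∧ ∀ t, 1 ≤ |t| → β t = 0 := by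
  let B : ContDiffBump (0 : ℝ) := ⟨1 / 2, 1, by norm_num, by norm_num⟩
  have hc : HasCompactSupport fun t => (B t : ℂ) :=
    B.hasCompactSupport.comp_left (g := fun x : ℝ => (x : ℂ)) (by simp)
  have hd : ContDiff ℝ (⊤ : ℕ∞) fun t => (B t : ℂ) :=
    Complex.ofRealCLM.contDiff.comp B.contDiff
  refine ⟨hc.toSchwartzMap hd, B, fun t => rfl, fun t => B.nonneg, fun t ht => ?_, fun t ht => ?_⟩
  · exact B.one_of_mem_closedBall (by rwa [mem_closedBall_zero_iff])
  · exact B.zero_of_le_dist (by rwa [dist_zero_right])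

/-- The box of integer points behind `prodSum`; the last coordinate carries the irrational
shift, the first one is the short variable. -/
noncomputable def box (k : ℕ) : Finset ((ℤ × ℤ × ℤ × ℤ) × ℤ) :=
  (Ico 0 ((k ^ 2 : ℕ) : ℤ) ×ˢ Ico 0 ((4 * k ^ 3 : ℕ) : ℤ) ×ˢ Ico 0 ((4 * k ^ 3 : ℕ) : ℤ) ×ˢ
    Ico 0 ((4 * k ^ 3 : ℕ) : ℤ)) ×ˢ Ico 0 ((4 * k ^ 3 : ℕ) : ℤ)

/-- The value of the form except for its last variable. -/
noncomputable def restValue (μ : Fin 5 → ℝ) (k : ℕ) (p : ℤ × ℤ × ℤ × ℤ) : ℝ :=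
  (p.1 + ((k ^ 2 : ℕ) - μ 1)) ^ 3 + ((p.2.1 + ((4 * k ^ 3 : ℕ) - μ 2)) ^ 3 +
    ((p.2.2.1 + ((4 * k ^ 3 : ℕ) - μ 3)) ^ 3 + (p.2.2.2 + ((4 * k ^ 3 : ℕ) - μ 4)) ^ 3))

/-- The value of the form at the shifted point of the box. -/
noncomputable def value (μ : Fin 5 → ℝ) (k : ℕ) (p : (ℤ × ℤ × ℤ × ℤ) × ℤ) : ℝ :=
  restValue μ k p.1 + (p.2 + ((4 * k ^ 3 : ℕ) - μ 0)) ^ 3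

lemma sum_box_e (μ : Fin 5 → ℝ) (k : ℕ) (α : ℝ) :
    ∑ p ∈ box k, e (α * value μ k p) = prodSum μ k α := by
  have h {ι κ : Type} (s : Finset ι) (t : Finset κ) (f : ι → ℂ) (g : κ → ℂ) :
      ∑ p ∈ s ×ˢ t, f p.1 * g p.2 = (∑ x ∈ s, f x) * ∑ y ∈ t, g y := by
    rw [sum_mul_sum, sum_product]
  have h1 (x y z u v : ℝ) : e (α * (x + (y + (z + u)) + v)) =
      e (α * x) * (e (α * y) * (e (α * z) * e (α * u))) * e (α * v) := by
    simp only [mul_add, e_add]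
  simp only [box, value, restValue, h1]
  rw [h _ _ (fun p : ℤ × ℤ × ℤ × ℤ => e (α * (p.1 + ((k ^ 2 : ℕ) - μ 1)) ^ 3) *
      (e (α * (p.2.1 + ((4 * k ^ 3 : ℕ) - μ 2)) ^ 3) *
      (e (α * (p.2.2.1 + ((4 * k ^ 3 : ℕ) - μ 3)) ^ 3) *
        e (α * (p.2.2.2 + ((4 * k ^ 3 : ℕ) - μ 4)) ^ 3))))
      (fun n : ℤ => e (α * (n + ((4 * k ^ 3 : ℕ) - μ 0)) ^ 3)),
    h _ _ (fun n : ℤ => e (α * (n + ((k ^ 2 : ℕ) - μ 1)) ^ 3))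
      (fun p : ℤ × ℤ × ℤ => e (α * (p.1 + ((4 * k ^ 3 : ℕ) - μ 2)) ^ 3) *
      (e (α * (p.2.1 + ((4 * k ^ 3 : ℕ) - μ 3)) ^ 3) *
        e (α * (p.2.2 + ((4 * k ^ 3 : ℕ) - μ 4)) ^ 3))),
    h _ _ (fun n : ℤ => e (α * (n + ((4 * k ^ 3 : ℕ) - μ 2)) ^ 3))
      (fun p : ℤ × ℤ => e (α * (p.1 + ((4 * k ^ 3 : ℕ) - μ 3)) ^ 3) *
        e (α * (p.2 + ((4 * k ^ 3 : ℕ) - μ 4)) ^ 3)),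
    h _ _ (fun n : ℤ => e (α * (n + ((4 * k ^ 3 : ℕ) - μ 3)) ^ 3))
      (fun n : ℤ => e (α * (n + ((4 * k ^ 3 : ℕ) - μ 4)) ^ 3))]
  simp only [prodSum, cubeSum]
  ring

lemma le_card_Ico_filter {z w : ℝ} {M : ℕ} (hw : 1 ≤ w) (h0 : 0 ≤ z - w) (h1 : z + w < M) :
    w ≤ ((Ico (0 : ℤ) M).filter fun n : ℤ => |(n : ℝ) - z| ≤ w).card := by
  have hsub : Icc ⌈z - w⌉ ⌊z + w⌋ ⊆ (Ico (0 : ℤ) M).filter fun n : ℤ => |(n : ℝ) - z| ≤ w := by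
    intro n hn
    obtain ⟨h2, h3⟩ := mem_Icc.1 hn
    have h2' := Int.ceil_le.1 h2
    have h3' := Int.le_floor.1 h3
    refine mem_filter.2 ⟨mem_Ico.2 ⟨?_, ?_⟩, abs_le.2 ⟨by linarith, by linarith⟩⟩
    · have : (0 : ℝ) ≤ n := by linarith
      exact_mod_cast this
    · have : (n : ℝ) < M := by linarith
      exact_mod_cast this
  have h2 : ((Icc ⌈z - w⌉ ⌊z + w⌋).card : ℤ) ≥ ⌊z + w⌋ + 1 - ⌈z - w⌉ := by
    rw [Int.card_Icc]; exact Int.self_le_toNat _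
  have h2' : ((Icc ⌈z - w⌉ ⌊z + w⌋).card : ℝ) ≥ ⌊z + w⌋ + 1 - ⌈z - w⌉ := by exact_mod_cast h2
  have h3 : ((Icc ⌈z - w⌉ ⌊z + w⌋).card : ℝ) ≤ _ := Nat.cast_le.2 (card_le_card hsub)
  have := Int.lt_floor_add_one (z + w)
  have := Int.ceil_lt_add_one (z - w)
  linarith

lemma le_card_cube_filter {M : ℕ} {μ t l : ℝ} (hl0 : 0 < l) (hl1 : l ≤ 1)
    (hM : 24 ≤ l * M) (hμ : |μ| ≤ M / 100) (ht0 : 17 / 10 * (M : ℝ) ^ 3 ≤ t)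
    (ht1 : t ≤ 71 / 10 * (M : ℝ) ^ 3) :
    l * M / 24 ≤ ((Ico (0 : ℤ) M).filter fun n : ℤ =>
      |t - (n + (M - μ)) ^ 3| ≤ l * (M : ℝ) ^ 3 / 2).card := by
  have hM0 : (0 : ℝ) < M := by
    by_contra h
    have : (M : ℝ) = 0 := le_antisymm (not_lt.1 h) (by positivity)
    rw [this] at hM; linarith
  have ht : 0 ≤ t := le_trans (by positivity) ht0
  obtain ⟨y, hy0, hy⟩ : ∃ y : ℝ, 0 ≤ y ∧ y ^ 3 = t :=
    ⟨t ^ (1 / 3 : ℝ), by positivity, by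
      rw [← Real.rpow_natCast, ← Real.rpow_mul ht]; norm_num⟩
  have hy1 : 119 / 100 * M ≤ y := by
    refine le_of_pow_le_pow_left₀ (n := 3) (by norm_num) hy0 ?_
    rw [hy]
    nlinarith [pow_pos hM0 3]
  have hy2 : y ≤ 193 / 100 * M := by
    refine le_of_pow_le_pow_left₀ (n := 3) (by norm_num) (by positivity) ?_
    rw [hy]
    nlinarith [pow_pos hM0 3]
  obtain ⟨hμ1, hμ2⟩ := abs_le.1 hμ
  have hlM : l * M ≤ M := by nlinarith
  refine (le_card_Ico_filter (z := y + μ - M) (w := l * M / 24) (M := M) (by linarith) (by linarith)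
    (by linarith)).trans ?_
  refine Nat.cast_le.2 (card_le_card fun n hn => ?_)
  obtain ⟨hn, hnz⟩ := mem_filter.1 hn
  refine mem_filter.2 ⟨hn, ?_⟩
  set x : ℝ := n + (M - μ) with hx
  have hxy : |y - x| ≤ l * M / 24 := by
    rw [abs_sub_comm]; convert hnz using 2; rw [hx]; ring
  obtain ⟨h1, h2⟩ := abs_le.1 hxy
  have hx0 : 0 ≤ x := by linarith
  have hx2 : x ≤ 2 * M := by linarith
  have hy2' : y ≤ 2 * M := by linarith
  rw [← hy, show y ^ 3 - x ^ 3 = (y - x) * (y ^ 2 + y * x + x ^ 2) by ring, abs_mul,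
    abs_of_nonneg (show 0 ≤ y ^ 2 + y * x + x ^ 2 by positivity)]
  calc _ ≤ l * M / 24 * ((2 * M) ^ 2 + 2 * M * (2 * M) + (2 * M) ^ 2) := by gcongr
    _ = _ := by ring

theorem le_card_box_filter (μ : Fin 5 → ℝ) {l : ℝ} (hl0 : 0 < l) (hl1 : l ≤ 1) :
    ∀ᶠ k : ℕ in atTop, ∀ τ ∈ Set.Icc (384 * (k : ℝ) ^ 9) (640 * (k : ℝ) ^ 9),
      l * (64 * (k : ℝ) ^ 9) * (4 * (k : ℝ) ^ 5) / 192000 ≤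
        ((box k).filter fun p => |τ - value μ k p| ≤ l * (64 * (k : ℝ) ^ 9) / 2).card := by
  have hμk : ∀ᶠ k : ℕ in atTop, ∀ i, |μ i| ≤ (k : ℝ) / 100 := eventually_all.2 fun i => by
    filter_upwards [eventually_ge_atTop ⌈100 * |μ i|⌉₊] with k hk
    have := Nat.ceil_le.1 hk
    linarith
  filter_upwards [hμk, eventually_ge_atTop ⌈24 / l⌉₊, eventually_ge_atTop 20]
    with k hμ hkl hk20 τ ⟨hτ1, hτ2⟩
  have hk20' : (20 : ℝ) ≤ k := by exact_mod_cast hk20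
  have hk0 : (0 : ℝ) < k := by linarith
  replace hkl : 24 ≤ l * k := by
    have := Nat.ceil_le.1 hkl
    rwa [div_le_iff₀ hl0, mul_comm] at this
  set M : ℕ := 4 * k ^ 3 with hM
  have hMk : (M : ℝ) = 4 * (k : ℝ) ^ 3 := by rw [hM]; push_cast; ring
  have hk3 : (k : ℝ) ≤ (k : ℝ) ^ 3 := le_self_pow₀ (by linarith) (by norm_num)
  have hk2 : (k : ℝ) ≤ (k : ℝ) ^ 2 := le_self_pow₀ (by linarith) (by norm_num)
  have hkM : (k : ℝ) ≤ M := by rw [hMk]; linarith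
  have hM3 : (M : ℝ) ^ 3 = 64 * (k : ℝ) ^ 9 := by rw [hMk]; ring
  have hM0 : (0 : ℝ) < M := by linarith
  set A : ℕ := M / 10 with hA
  have hA1 : (10 : ℝ) * A ≤ M := by
    have : 10 * A ≤ M := by omega
    exact_mod_cast this
  have hA2 : (M : ℝ) ≤ 20 * A := by
    have h20 : 20 ≤ M := by
      have : (20 : ℝ) ≤ M := by linarith
      exact_mod_cast this
    have : M ≤ 20 * A := by omega
    exact_mod_cast this
  set Q : Finset (ℤ × ℤ × ℤ × ℤ) :=
    Ico 0 ((k ^ 2 : ℕ) : ℤ) ×ˢ Ico 0 (A : ℤ) ×ˢ Ico 0 (A : ℤ) ×ˢ Ico 0 (A : ℤ) with hQ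
  have hcube : ∀ i, ∀ n ∈ Ico (0 : ℤ) A, 97 / 100 * (M : ℝ) ^ 3 ≤ (n + ((M : ℝ) - μ i)) ^ 3 ∧
      (n + ((M : ℝ) - μ i)) ^ 3 ≤ 1368 / 1000 * (M : ℝ) ^ 3 := by
    intro i n hn
    obtain ⟨h0, h1⟩ := mem_Ico.1 hn
    have h0' : (0 : ℝ) ≤ n := by exact_mod_cast h0
    have h1' : (n : ℝ) ≤ A := by exact_mod_cast h1.le
    obtain ⟨h2, h3⟩ := abs_le.1 (hμ i)
    constructor
    · calc 97 / 100 * (M : ℝ) ^ 3 ≤ (99 / 100 * M) ^ 3 := by nlinarith [pow_pos hM0 3]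
        _ ≤ _ := by gcongr; linarith
    · calc (n + ((M : ℝ) - μ i)) ^ 3 ≤ (111 / 100 * M) ^ 3 := by
            gcongr
            · linarith
            · linarith
        _ ≤ _ := by nlinarith [pow_pos hM0 3]
  have hrest : ∀ p ∈ Q, 29 / 10 * (M : ℝ) ^ 3 ≤ restValue μ k p ∧
      restValue μ k p ≤ 43 / 10 * (M : ℝ) ^ 3 := by
    rintro ⟨n₁, n₂, n₃, n₄⟩ hp
    simp only [hQ, mem_product] at hp
    obtain ⟨h1, h2, h3, h4⟩ := hp
    have h2 := hcube 2 _ h2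
    have h3 := hcube 3 _ h3
    have h4 := hcube 4 _ h4
    obtain ⟨h10, h11⟩ := mem_Ico.1 h1
    have h10' : (0 : ℝ) ≤ n₁ := by exact_mod_cast h10
    have h11' : (n₁ : ℝ) ≤ (k : ℝ) ^ 2 := by exact_mod_cast h11.le
    obtain ⟨h12, h13⟩ := abs_le.1 (hμ 1)
    have hz0 : 0 ≤ (n₁ + ((k : ℝ) ^ 2 - μ 1)) := by linarith
    have hz : (n₁ + ((k : ℝ) ^ 2 - μ 1)) ^ 3 ≤ 1 / 10 * (M : ℝ) ^ 3 := by
      calc (n₁ + ((k : ℝ) ^ 2 - μ 1)) ^ 3 ≤ (3 * (k : ℝ) ^ 2) ^ 3 := by gcongr; linarith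
        _ = 27 * (k : ℝ) ^ 6 := by ring
        _ ≤ 64 / 10 * ((k : ℝ) ^ 6 * (k : ℝ) ^ 3) := by
            nlinarith [pow_pos hk0 6]
        _ = _ := by rw [hM3]; ring
    have hz1 : 0 ≤ (n₁ + ((k : ℝ) ^ 2 - μ 1)) ^ 3 := by positivity
    simp only [restValue]
    push_cast [← hM] at *
    constructor <;> linarith
  have hMl : 24 ≤ l * M := hkl.trans (by gcongr)
  have hμM : |μ 0| ≤ (M : ℝ) / 100 := (hμ 0).trans (by gcongr)
  have hinner : ∀ p ∈ Q, l * M / 24 ≤ ((Ico (0 : ℤ) M).filter fun n : ℤ =>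
      |τ - value μ k (p, n)| ≤ l * (64 * (k : ℝ) ^ 9) / 2).card := by
    intro p hp
    obtain ⟨h1, h2⟩ := hrest p hp
    have := le_card_cube_filter (μ := μ 0) (t := τ - restValue μ k p) hl0 hl1 hMl hμM
      (by linarith) (by linarith)
    simp only [value, ← hM, ← hM3, ← sub_sub]
    exact this
  have hQsub : Q ⊆ Ico 0 ((k ^ 2 : ℕ) : ℤ) ×ˢ Ico 0 (M : ℤ) ×ˢ Ico 0 (M : ℤ) ×ˢ Ico 0 (M : ℤ) := by
    have : Ico 0 (A : ℤ) ⊆ Ico 0 (M : ℤ) := Ico_subset_Ico_right (by omega)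
    exact product_subset_product_right
      (product_subset_product this (product_subset_product this this))
  have hQcard : (Q.card : ℝ) = (k : ℝ) ^ 2 * (A * (A * A)) := by
    rw [hQ]
    simp only [card_product, Int.card_Ico, sub_zero, Int.toNat_natCast]
    push_cast
    ring
  calc l * (64 * (k : ℝ) ^ 9) * (4 * (k : ℝ) ^ 5) / 192000
      = (k : ℝ) ^ 2 * (M / 20 * (M / 20 * (M / 20))) * (l * M / 24) := by rw [hMk]; ring
    _ ≤ (k : ℝ) ^ 2 * (A * (A * A)) * (l * M / 24) := by
        have : (M : ℝ) / 20 ≤ A := by linarith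
        gcongr
    _ = ∑ p ∈ Q, l * M / 24 := by rw [sum_const, nsmul_eq_mul, hQcard]
    _ ≤ ∑ p ∈ Q, (((Ico (0 : ℤ) M).filter fun n : ℤ =>
          |τ - value μ k (p, n)| ≤ l * (64 * (k : ℝ) ^ 9) / 2).card : ℝ) := sum_le_sum hinner
    _ ≤ ∑ p ∈ Ico 0 ((k ^ 2 : ℕ) : ℤ) ×ˢ Ico 0 (M : ℤ) ×ˢ Ico 0 (M : ℤ) ×ˢ Ico 0 (M : ℤ),
          (((Ico (0 : ℤ) M).filter fun n : ℤ =>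
          |τ - value μ k (p, n)| ≤ l * (64 * (k : ℝ) ^ 9) / 2).card : ℝ) :=
        sum_le_sum_of_subset_of_nonneg hQsub fun _ _ _ => by positivity
    _ = _ := by
        simp only [Finset.card_filter, box, sum_product]
        push_cast
        rfl

lemma setLIntegral_le_unit_intervals (f : ℝ → ℝ≥0∞) (E : Set ℝ) (T : ℕ) {B : ℝ≥0∞}
    (hB : ∀ n : ℤ, ∫⁻ α in Set.Icc (n : ℝ) (n + 1) \ E, f α ≤ B) :
    ∫⁻ α in Set.Icc (-T : ℝ) T \ E, f α ≤ 2 * (T + 1) * B := by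
  have hsub : Set.Icc (-T : ℝ) T \ E ⊆
      ⋃ n : Icc (-T : ℤ) (T + 1), Set.Icc ((n : ℤ) : ℝ) ((n : ℤ) + 1) \ E := by
    rintro α ⟨⟨h1, h2⟩, hE⟩
    refine Set.mem_iUnion.2 ⟨⟨⌊α⌋, mem_Icc.2 ⟨?_, ?_⟩⟩, ⟨Int.floor_le α, ?_⟩, hE⟩
    · exact Int.le_floor.2 (by push_cast; exact h1)
    · have : (⌊α⌋ : ℝ) ≤ T + 1 := (Int.floor_le α).trans (by linarith)
      exact_mod_cast this
    · exact (Int.lt_floor_add_one α).le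
  calc _ ≤ _ := lintegral_mono_set hsub
    _ ≤ _ := lintegral_iUnion_le _ _
    _ ≤ ∑' n : Icc (-T : ℤ) (T + 1), B := ENNReal.tsum_le_tsum fun n => hB n
    _ = 2 * (T + 1) * B := by
      rw [tsum_fintype, sum_const, card_univ, Fintype.card_coe, Int.card_Icc, nsmul_eq_mul]
      congr 1
      have : ((T : ℤ) + 1 + 1 - -T).toNat = 2 * (T + 1) := by omega
      rw [this]; push_cast; rfl

lemma setLIntegral_compl_le_unit_intervals (f : ℝ → ℝ≥0∞) {w : ℕ → ℝ≥0∞} (hw : Antitone w) (T : ℕ)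
    {B : ℝ≥0∞} (hf : Measurable f)
    (hB : ∀ n : ℤ, ∫⁻ α in Set.Icc (n : ℝ) (n + 1), f α ≤ B) :
    ∫⁻ α in (Set.Icc (-T : ℝ) T)ᶜ, f α * w ⌊|α|⌋₊ ≤ 2 * (∑' n : ℕ, w (n + T)) * B := by
  have hsub : (Set.Icc (-T : ℝ) T)ᶜ ⊆
      (⋃ n : ℕ, Set.Icc (((n + T : ℕ) : ℤ) : ℝ) (((n + T : ℕ) : ℤ) + 1)) ∪
      ⋃ n : ℕ, Set.Icc ((-((n + T : ℕ) : ℤ) - 1 : ℤ) : ℝ) ((-((n + T : ℕ) : ℤ) - 1 : ℤ) + 1) := by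
    intro α hα
    have h1 : (T : ℝ) ≤ |α| := by
      by_contra h
      exact hα (abs_le.1 (not_le.1 h).le)
    have h2 : T ≤ ⌊|α|⌋₊ := Nat.le_floor h1
    have h3 := Nat.floor_le (abs_nonneg α)
    have h4 := Nat.lt_floor_add_one |α|
    rcases le_total 0 α with h | h
    · left
      rw [abs_of_nonneg h] at h2 h3 h4
      refine Set.mem_iUnion.2 ⟨⌊α⌋₊ - T, ?_⟩
      rw [Nat.sub_add_cancel h2]
      exact ⟨by exact_mod_cast h3, by exact_mod_cast h4.le⟩
    · right
      rw [abs_of_nonpos h] at h2 h3 h4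
      refine Set.mem_iUnion.2 ⟨⌊-α⌋₊ - T, ?_⟩
      rw [Nat.sub_add_cancel h2]
      push_cast
      exact ⟨by linarith, by linarith⟩
  have hpiece : ∀ (n : ℕ) (m : ℤ), (∀ α ∈ Set.Icc (m : ℝ) (m + 1), (n : ℝ) ≤ |α|) →
      ∫⁻ α in Set.Icc (m : ℝ) (m + 1), f α * w ⌊|α|⌋₊ ≤ w n * B := by
    intro n m h
    calc _ ≤ ∫⁻ α in Set.Icc (m : ℝ) (m + 1), w n * f α := by
          refine setLIntegral_mono (hf.const_mul _) fun α hα => ?_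
          rw [mul_comm]
          gcongr
          exact hw (Nat.le_floor (h α hα))
      _ = w n * ∫⁻ α in Set.Icc (m : ℝ) (m + 1), f α := lintegral_const_mul _ hf
      _ ≤ _ := by gcongr; exact hB m
  calc _ ≤ _ := lintegral_mono_set hsub
    _ ≤ _ := lintegral_union_le _ _ _
    _ ≤ _ := add_le_add (lintegral_iUnion_le _ _) (lintegral_iUnion_le _ _)
    _ ≤ (∑' n : ℕ, w (n + T) * B) + ∑' n : ℕ, w (n + T) * B := by
      refine add_le_add (ENNReal.tsum_le_tsum fun n => hpiece _ _ ?_)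
        (ENNReal.tsum_le_tsum fun n => hpiece _ _ ?_)
      · rintro α ⟨h1, -⟩
        exact le_trans (by exact_mod_cast h1) (le_abs_self α)
      · rintro α ⟨-, h1⟩
        refine le_trans ?_ (neg_le_abs α)
        push_cast at h1 ⊢
        linarith
    _ = _ := by rw [ENNReal.tsum_mul_right]; ring

lemma setLIntegral_mul_sq_le (f : ℝ → ℝ≥0∞) (hf : Measurable f) (κ : ℝ → ℂ) (s : Set ℝ) {D : ℝ}
    (h : ∀ α ∈ s, ‖κ α‖ ≤ D) :
    ∫⁻ α in s, f α * ENNReal.ofReal (‖κ α‖ ^ 2) ≤ ENNReal.ofReal (D ^ 2) * ∫⁻ α in s, f α := by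
  calc _ ≤ ∫⁻ α in s, ENNReal.ofReal (D ^ 2) * f α := by
        refine setLIntegral_mono (hf.const_mul _) fun α hα => ?_
        rw [mul_comm]
        have := h α hα
        gcongr
    _ = _ := lintegral_const_mul _ hf

lemma exists_uniform_bound (μ : Fin 5 → ℝ) : ∃ B : ℝ≥0∞, B ≠ ⊤ ∧ ∀ᶠ k : ℕ in atTop, ∀ n : ℤ,
    ∫⁻ α in Set.Icc (n : ℝ) (n + 1), ENNReal.ofReal (‖prodSum μ k α‖ ^ 2) ≤
      B * ENNReal.ofReal ((k : ℝ) ^ 19) := by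
  obtain ⟨C, -, h⟩ := lintegral_norm_sq_prodSum_le
  refine ⟨ENNReal.ofReal C * tailMass 0 + ENNReal.ofReal 1, ENNReal.add_ne_top.2
    ⟨ENNReal.mul_ne_top ENNReal.ofReal_ne_top (tailMass_ne_top 0), ENNReal.ofReal_ne_top⟩, ?_⟩
  filter_upwards [h μ 1 one_pos] with k hk n
  have h0 : nearRat 0 k = ∅ := by
    ext α
    simp only [nearRat, Set.mem_ofPred_eq, Set.mem_empty_iff_false, iff_false]
    rintro ⟨q, a, hq, hq', -⟩
    omega
  simpa [h0] using hk 0 n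

lemma measurable_prodSum_sq (μ : Fin 5 → ℝ) (k : ℕ) :
    Measurable fun α => ENNReal.ofReal (‖prodSum μ k α‖ ^ 2) :=
  ((continuous_prodSum μ k).norm.pow 2).measurable.ennreal_ofReal

theorem lintegral_prodSum_kernel_le (μ : Fin 5 → ℝ) (hμ : Irrational (μ 0)) (b : 𝓢(ℝ, ℂ)) {η ε : ℝ}
    (hη : 0 < η) (hε : 0 < ε) : ∃ l : ℝ, 0 < l ∧ l ≤ 1 ∧ ∀ᶠ k : ℕ in atTop,
      ∫⁻ α, ENNReal.ofReal (‖prodSum μ k α‖ ^ 2) *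
        ENNReal.ofReal (‖𝓕 b (η * α) - 𝓕 b (l * (64 * (k : ℝ) ^ 9) * α)‖ ^ 2) ≤
      ENNReal.ofReal (ε * (k : ℝ) ^ 19) := by
  obtain ⟨C, hC, hb⟩ := exists_fourier_bounds b
  obtain ⟨B, hBtop, hB⟩ := exists_uniform_bound μ
  obtain ⟨C', hC', hout⟩ := lintegral_norm_sq_prodSum_le
  set δ := ENNReal.ofReal (ε / 4) with hδ
  have hδ0 : 0 < δ := ENNReal.ofReal_pos.2 (by positivity)
  -- the weight for large frequencies
  set w : ℕ → ℝ≥0∞ := fun n =>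
    ENNReal.ofReal ((2 * C / η) ^ 2 * (1 / ((max n 1 : ℕ) : ℝ) ^ 2)) with hw
  have hwanti : Antitone w := fun m n hmn => by
    refine ENNReal.ofReal_le_ofReal ?_
    have : 0 < max m 1 := by omega
    gcongr
  have hwsum : ∑' n, w n ≠ ⊤ := by
    have hs : Summable fun n : ℕ => (2 * C / η) ^ 2 * (1 / ((max n 1 : ℕ) : ℝ) ^ 2) := by
      refine Summable.mul_left _ ?_
      rw [← summable_nat_add_iff 1]
      have := (summable_nat_add_iff 1).2 (Real.summable_one_div_nat_pow.2 (one_lt_two))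
      refine this.congr fun n => ?_
      rw [max_eq_left (by omega)]
    exact hs.tsum_ofReal_ne_top
  have hwtail : Tendsto (fun T => 2 * B * ∑' n, w (n + T)) atTop (𝓝 0) := by
    have := ENNReal.Tendsto.const_mul (a := 2 * B) (ENNReal.tendsto_sum_nat_add w hwsum)
      (Or.inr (ENNReal.mul_ne_top (by simp) hBtop))
    simpa using this
  obtain ⟨T, hT1, hTδ⟩ := ((eventually_ge_atTop 1).and ((tendsto_order.1 hwtail).2 δ hδ0)).exists
  -- the number of small frequencies that are removed
  set G : ℝ≥0∞ := ENNReal.ofReal ((2 * C) ^ 2) * (2 * (T + 1)) with hG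
  have hGtop : G ≠ ⊤ := ENNReal.mul_ne_top ENNReal.ofReal_ne_top
    (ENNReal.mul_ne_top (by simp) (by simp))
  have htail : Tendsto (fun K => G * ENNReal.ofReal C' * tailMass K) atTop (𝓝 0) := by
    have := ENNReal.Tendsto.const_mul (a := G * ENNReal.ofReal C') tendsto_tailMass
      (Or.inr (ENNReal.mul_ne_top hGtop ENNReal.ofReal_ne_top))
    simpa using this
  have hδ2 : 0 < δ / 2 := ENNReal.half_pos hδ0.ne'
  obtain ⟨K, hK1, hKδ⟩ := ((eventually_ge_atTop 1).and ((tendsto_order.1 htail).2 _ hδ2)).exists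
  obtain ⟨ε₁, hε₁, hε₁δ⟩ : ∃ ε₁ : ℝ, 0 < ε₁ ∧ G * ENNReal.ofReal ε₁ ≤ δ / 2 := by
    refine ⟨(δ / 2 / (G + 1)).toReal, ENNReal.toReal_pos ?_ ?_, ?_⟩
    · exact (ENNReal.div_pos hδ2.ne' (by simp [hGtop])).ne'
    · exact (ENNReal.div_lt_top (by simp [hδ, ENNReal.div_eq_top]) (by simp)).ne
    · rw [ENNReal.ofReal_toReal
        (ENNReal.div_lt_top (by simp [hδ, ENNReal.div_eq_top]) (by simp)).ne]
      calc G * (δ / 2 / (G + 1)) ≤ (G + 1) * (δ / 2 / (G + 1)) := by gcongr; exact le_self_add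
        _ ≤ δ / 2 := ENNReal.mul_div_le
  obtain ⟨l, hl0, hl1, hl⟩ : ∃ l : ℝ, 0 < l ∧ l ≤ 1 ∧
      ENNReal.ofReal ((C * l * K) ^ 2) * (2 * (1 + 1) * B) ≤ δ := by
    set x : ℝ := ε / 4 / (4 * B.toReal + 1) / (C * K) ^ 2
    have hx : 0 < x := by positivity
    refine ⟨min 1 x, lt_min one_pos hx, min_le_left _ _, ?_⟩
    rw [← ENNReal.ofReal_toReal hBtop, show (2 * (1 + 1) : ℝ≥0∞) = ENNReal.ofReal 4 by
      rw [show (4 : ℝ) = 2 * (1 + 1) by norm_num]; simp [ENNReal.ofReal_mul, one_add_one_eq_two],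
      ← ENNReal.ofReal_mul (by norm_num), ← ENNReal.ofReal_mul (by positivity)]
    refine ENNReal.ofReal_le_ofReal ?_
    have h1 : (min 1 x) ^ 2 ≤ x := by
      have : 0 ≤ min 1 x := (lt_min one_pos hx).le
      calc (min 1 x) ^ 2 = min 1 x * min 1 x := sq _
        _ ≤ 1 * x := mul_le_mul (min_le_left _ _) (min_le_right _ _) this zero_le_one
        _ = x := one_mul x
    calc (C * min 1 x * K) ^ 2 * (4 * B.toReal)
        = (min 1 x) ^ 2 * ((C * K) ^ 2 * (4 * B.toReal)) := by
          ring
      _ ≤ x * ((C * K) ^ 2 * (4 * B.toReal + 1)) := by gcongr; linarith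
      _ = ε / 4 := by simp only [x]; field_simp
  refine ⟨l, hl0, hl1, ?_⟩
  have hlarge : ∀ᶠ k : ℕ in atTop, max η K ≤ l * (64 * (k : ℝ) ^ 9) := by
    have : Tendsto (fun k : ℕ => l * (64 * (k : ℝ) ^ 9)) atTop atTop :=
      (((tendsto_pow_atTop (by norm_num)).comp tendsto_natCast_atTop_atTop).const_mul_atTop
        (by norm_num)).const_mul_atTop hl0
    exact this.eventually_ge_atTop _
  filter_upwards [hB, hout μ ε₁ hε₁, hlarge,
    lintegral_norm_sq_prodSum_nearNonzeroRat_le μ hμ T K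
      (show 0 < ε / 4 / (2 * C) ^ 2 by positivity)] with k hB hout hlarge hnear
  set f : ℝ → ℝ≥0∞ := fun α => ENNReal.ofReal (‖prodSum μ k α‖ ^ 2)
  have hf : Measurable f := measurable_prodSum_sq μ k
  set Λ := l * (64 * (k : ℝ) ^ 9) with hΛ
  set κ : ℝ → ℂ := fun α => 𝓕 b (η * α) - 𝓕 b (Λ * α) with hκ
  set X := ENNReal.ofReal ((k : ℝ) ^ 19) with hX
  have hηΛ : η ≤ Λ := (le_max_left _ _).trans hlarge
  have hKΛ : K ≤ Λ := (le_max_right _ _).trans hlarge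
  have hΛ0 : 0 < Λ := hη.trans_le hηΛ
  have hκ1 : ∀ α, ‖κ α‖ ≤ 2 * C := fun α => by
    have := (hb (η * α)).1
    have := (hb (Λ * α)).1
    have := norm_sub_le (𝓕 b (η * α)) (𝓕 b (Λ * α))
    simp only [hκ]
    linarith
  have hκ2 : ∀ α, ‖κ α‖ ≤ C * (2 * Λ * |α|) := fun α => by
    have h1 := (hb (η * α)).2.2
    have h2 := (hb (Λ * α)).2.2
    have h3 := norm_sub_le (𝓕 b (η * α) - 𝓕 b 0) (𝓕 b (Λ * α) - 𝓕 b 0)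
    rw [sub_sub_sub_cancel_right] at h3
    rw [abs_mul, abs_of_pos hη] at h1
    rw [abs_mul, abs_of_pos hΛ0] at h2
    have h4 : C * (η * |α|) ≤ C * (Λ * |α|) := by gcongr
    simp only [hκ]
    linarith
  have hκ3 : ∀ α, ‖κ α‖ * |α| ≤ 2 * C / η := fun α => by
    have h1 := (hb (η * α)).2.1
    have h2 := (hb (Λ * α)).2.1
    have h3 := norm_sub_le (𝓕 b (η * α)) (𝓕 b (Λ * α))
    rw [abs_mul, abs_of_pos hη] at h1
    rw [abs_mul, abs_of_pos hΛ0] at h2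
    have h4 : η * |α| * ‖𝓕 b (Λ * α)‖ ≤ Λ * |α| * ‖𝓕 b (Λ * α)‖ := by gcongr
    rw [le_div_iff₀ hη]
    have h5 : η * |α| * ‖κ α‖ ≤ η * |α| * (‖𝓕 b (η * α)‖ + ‖𝓕 b (Λ * α)‖) := by gcongr
    linarith
  have hR1 : ∫⁻ α in (Set.Icc (-T : ℝ) T)ᶜ, f α * ENNReal.ofReal (‖κ α‖ ^ 2) ≤ δ * X := by
    calc _ ≤ ∫⁻ α in (Set.Icc (-T : ℝ) T)ᶜ, f α * w ⌊|α|⌋₊ := by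
          refine setLIntegral_mono (hf.mul (by fun_prop)) fun α hα => ?_
          have h1 : (T : ℝ) ≤ |α| := by
            by_contra h
            exact hα (abs_le.1 (not_le.1 h).le)
          have hT1' : (1 : ℝ) ≤ T := by exact_mod_cast hT1
          have h2 : 1 ≤ ⌊|α|⌋₊ := Nat.le_floor (by push_cast; linarith)
          have h3 : (⌊|α|⌋₊ : ℝ) ≤ |α| := Nat.floor_le (abs_nonneg α)
          have h2' : (0 : ℝ) < ⌊|α|⌋₊ := by exact_mod_cast h2
          simp only [hw]
          rw [max_eq_left h2]
          gcongr
          rw [mul_one_div, ← div_pow]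
          gcongr
          rw [le_div_iff₀ h2']
          exact le_trans (by gcongr) (hκ3 α)
      _ ≤ _ := setLIntegral_compl_le_unit_intervals f hwanti T hf hB
      _ = 2 * B * (∑' n, w (n + T)) * X := by ring
      _ ≤ _ := by gcongr
  have hR2 : ∫⁻ α in Set.Icc (-T : ℝ) T \ nearRat K k, f α * ENNReal.ofReal (‖κ α‖ ^ 2) ≤
      δ * X := by
    calc _ ≤ _ := setLIntegral_mul_sq_le f hf κ _ fun α _ => hκ1 α
      _ ≤ ENNReal.ofReal ((2 * C) ^ 2) * (2 * (T + 1) *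
          ((ENNReal.ofReal C' * tailMass K + ENNReal.ofReal ε₁) * X)) := by
        gcongr
        exact setLIntegral_le_unit_intervals f _ T fun n => hout K n
      _ = (G * ENNReal.ofReal C' * tailMass K + G * ENNReal.ofReal ε₁) * X := by rw [hG]; ring
      _ ≤ (δ / 2 + δ / 2) * X := by gcongr
      _ = _ := by rw [ENNReal.add_halves]
  have hR3 : ∫⁻ α in Set.Icc (-T : ℝ) T ∩ nearNonzeroRat K k, f α * ENNReal.ofReal (‖κ α‖ ^ 2) ≤
      δ * X := by
    calc _ ≤ _ := setLIntegral_mul_sq_le f hf κ _ fun α _ => hκ1 α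
      _ ≤ ENNReal.ofReal ((2 * C) ^ 2) * ENNReal.ofReal (ε / 4 / (2 * C) ^ 2 * (k : ℝ) ^ 19) := by
        gcongr
      _ = _ := by
        rw [← ENNReal.ofReal_mul (by positivity), ← ENNReal.ofReal_mul (by positivity)]
        congr 1
        field_simp
  have hR4 : ∫⁻ α in {α : ℝ | Λ * |α| ≤ l * K / 2} \ ∅, f α * ENNReal.ofReal (‖κ α‖ ^ 2) ≤
      δ * X := by
    calc _ ≤ ENNReal.ofReal ((C * l * K) ^ 2) * ∫⁻ α in {α : ℝ | Λ * |α| ≤ l * K / 2} \ ∅, f α :=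
          setLIntegral_mul_sq_le f hf κ _ fun α hα => (hκ2 α).trans (by
            calc C * (2 * Λ * |α|) = C * (2 * (Λ * |α|)) := by ring
              _ ≤ C * (2 * (l * K / 2)) := by gcongr; exact hα.1
              _ = C * l * K := by ring)
      _ ≤ ENNReal.ofReal ((C * l * K) ^ 2) * ∫⁻ α in Set.Icc (-(1 : ℕ) : ℝ) (1 : ℕ) \ ∅, f α := by
        gcongr
        intro α hα
        have h1 : Λ * |α| ≤ l * K / 2 := hα
        have h2 : l * K / 2 ≤ K := by
          have : l * K ≤ 1 * K := by gcongr
          have : (0 : ℝ) ≤ K := by positivity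
          linarith
        have h3 : |α| ≤ 1 := by
          refine le_of_mul_le_mul_left ?_ hΛ0
          linarith
        simpa using abs_le.1 h3
      _ ≤ ENNReal.ofReal ((C * l * K) ^ 2) * (2 * ((1 : ℕ) + 1) * (B * X)) := by
        gcongr
        exact setLIntegral_le_unit_intervals f _ 1 fun n => by simpa using hB n
      _ = ENNReal.ofReal ((C * l * K) ^ 2) * (2 * (1 + 1) * B) * X := by push_cast; ring
      _ ≤ _ := by gcongr
  have hcover : (Set.univ : Set ℝ) ⊆ (((Set.Icc (-T : ℝ) T)ᶜ ∪ Set.Icc (-T : ℝ) T \ nearRat K k) ∪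
      Set.Icc (-T : ℝ) T ∩ nearNonzeroRat K k) ∪ {α : ℝ | Λ * |α| ≤ l * K / 2} \ ∅ := by
    intro α _
    by_cases h1 : α ∈ Set.Icc (-T : ℝ) T
    swap
    · exact Or.inl (Or.inl (Or.inl h1))
    by_cases h2 : α ∈ nearRat K k
    swap
    · exact Or.inl (Or.inl (Or.inr ⟨h1, h2⟩))
    obtain ⟨q, a, hq, hqK, -, hα⟩ := h2
    by_cases ha : a = 0
    · right
      refine ⟨?_, by simp⟩
      rw [ha, Int.cast_zero, zero_div, sub_zero, abs_mul, abs_of_pos (by norm_num)] at hα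
      have hk : 0 < 64 * (k : ℝ) ^ 9 := by
        rw [hΛ] at hΛ0
        exact pos_of_mul_pos_right hΛ0 hl0.le
      rw [le_div_iff₀ hk] at hα
      change Λ * |α| ≤ l * K / 2
      have h3 : l * (6 * |α| * (64 * (k : ℝ) ^ 9)) ≤ l * K := by gcongr
      have h4 : 0 ≤ l * K := by positivity
      rw [hΛ]
      linarith
    · exact Or.inl (Or.inr ⟨h1, q, a, hq, hqK, ha, hα⟩)
  calc _ = ∫⁻ α in Set.univ, f α * ENNReal.ofReal (‖κ α‖ ^ 2) := by rw [setLIntegral_univ]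
    _ ≤ _ := lintegral_mono_set hcover
    _ ≤ _ := lintegral_union_le _ _ _
    _ ≤ _ := add_le_add_left (lintegral_union_le _ _ _) _
    _ ≤ _ := add_le_add_left (add_le_add_left (lintegral_union_le _ _ _) _) _
    _ ≤ δ * X + δ * X + δ * X + δ * X := add_le_add (add_le_add (add_le_add hR1 hR2) hR3) hR4
    _ = 4 * δ * X := by ring
    _ = _ := by
      rw [hδ, hX, show (4 : ℝ≥0∞) = ENNReal.ofReal 4 by simp, ← ENNReal.ofReal_mul (by norm_num),
        ← ENNReal.ofReal_mul (by positivity)]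
      congr 1
      ring

/-- The real numbers that are not approximated to within `η` by a sum of shifted cubes. -/
def exceptional {s : ℕ} (μ : Fin s → ℝ) (η : ℝ) : Set ℝ :=
  {τ | ¬ ∃ x : Fin s → ℤ, (∀ i, μ i < (x i : ℝ)) ∧ |(∑ i, ((x i : ℝ) - μ i) ^ 3) - τ| < η}

lemma eventually_le_abs_sub_value (μ : Fin 5 → ℝ) (η : ℝ) : ∀ᶠ k : ℕ in atTop,
    ∀ τ ∈ exceptional μ η, ∀ p ∈ box k, η ≤ |τ - value μ k p| := by
  have hμk : ∀ᶠ k : ℕ in atTop, ∀ i, μ i < (k : ℝ) := eventually_all.2 fun i =>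
    tendsto_natCast_atTop_atTop.eventually_gt_atTop _
  filter_upwards [hμk, eventually_ge_atTop 1] with k hμ hk τ hτ p hp
  by_contra! h
  refine hτ ⟨![p.2 + (4 * k ^ 3 : ℕ), p.1.1 + (k ^ 2 : ℕ), p.1.2.1 + (4 * k ^ 3 : ℕ),
    p.1.2.2.1 + (4 * k ^ 3 : ℕ), p.1.2.2.2 + (4 * k ^ 3 : ℕ)], ?_, ?_⟩
  · have hk1 : (1 : ℝ) ≤ k := by exact_mod_cast hk
    have h2 : (k : ℝ) ≤ (k : ℝ) ^ 2 := le_self_pow₀ hk1 (by norm_num)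
    have h3 : (k : ℝ) ≤ (k : ℝ) ^ 3 := le_self_pow₀ hk1 (by norm_num)
    have h4 : (k : ℝ) ≤ 4 * (k : ℝ) ^ 3 := by linarith
    simp only [box, mem_product, mem_Ico] at hp
    obtain ⟨⟨⟨p1, -⟩, ⟨p2, -⟩, ⟨p3, -⟩, ⟨p4, -⟩⟩, ⟨p0, -⟩⟩ := hp
    have p0' : (0 : ℝ) ≤ p.2 := by exact_mod_cast p0
    have p1' : (0 : ℝ) ≤ p.1.1 := by exact_mod_cast p1
    have p2' : (0 : ℝ) ≤ p.1.2.1 := by exact_mod_cast p2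
    have p3' : (0 : ℝ) ≤ p.1.2.2.1 := by exact_mod_cast p3
    have p4' : (0 : ℝ) ≤ p.1.2.2.2 := by exact_mod_cast p4
    intro i
    have := hμ i
    fin_cases i <;> simp at this ⊢ <;> linarith
  · rw [abs_sub_comm] at h
    refine lt_of_eq_of_lt (congrArg (fun y => |y - τ|) ?_) h
    rw [Fin.sum_univ_five]
    simp [value, restValue]
    ring

theorem volume_exceptional_inter_Icc_le (μ : Fin 5 → ℝ) (hμ : Irrational (μ 0)) {η ε : ℝ}
    (hη : 0 < η) (hε : 0 < ε) : ∀ᶠ k : ℕ in atTop,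
      volume (exceptional μ η ∩ Set.Icc (384 * (k : ℝ) ^ 9) (640 * (k : ℝ) ^ 9)) ≤
        ENNReal.ofReal (ε * (k : ℝ) ^ 9) := by
  obtain ⟨b, β, hb, hβ0, hβ1, hβ2⟩ := exists_bump
  obtain ⟨l, hl0, hl1, hl⟩ := lintegral_prodSum_kernel_le μ hμ b (ε := ε * (4 / 192000) ^ 2) hη
    (by positivity)
  filter_upwards [hl, le_card_box_filter μ hl0 hl1, eventually_le_abs_sub_value μ η,
    eventually_gt_atTop 0] with k hl hcard hexc hk
  have hk0 : (0 : ℝ) < k := by exact_mod_cast hk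
  set Λ := l * (64 * (k : ℝ) ^ 9) with hΛ
  have hΛ0 : 0 < Λ := by positivity
  set D : ℝ → ℂ := fun τ => ∑ p ∈ box k, ((η : ℂ)⁻¹ * b ((τ - value μ k p) * η⁻¹) -
    (Λ : ℂ)⁻¹ * b ((τ - value μ k p) * Λ⁻¹)) with hD
  have hDm : Measurable fun τ => ENNReal.ofReal (‖D τ‖ ^ 2) := by
    have := b.continuous
    have : Continuous D := by fun_prop
    exact (this.norm.pow 2).measurable.ennreal_ofReal
  set c : ℝ := 4 * (k : ℝ) ^ 5 / 192000 with hc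
  have hDint : ∫⁻ τ, ENNReal.ofReal (‖D τ‖ ^ 2) ≤
      ENNReal.ofReal (ε * (4 / 192000) ^ 2 * (k : ℝ) ^ 19) := by
    rw [hD, lintegral_norm_sq_kernel_sum b hη hΛ0]
    simp only [sum_box_e]
    exact hl
  have hlow : exceptional μ η ∩ Set.Icc (384 * (k : ℝ) ^ 9) (640 * (k : ℝ) ^ 9) ⊆
      {τ | ENNReal.ofReal (c ^ 2) ≤ ENNReal.ofReal (‖D τ‖ ^ 2)} := by
    rintro τ ⟨hτ, hτI⟩
    have hD1 : D τ = ((-∑ p ∈ box k, Λ⁻¹ * β ((τ - value μ k p) * Λ⁻¹) : ℝ) : ℂ) := by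
      rw [hD]
      push_cast
      rw [← sum_neg_distrib]
      refine sum_congr rfl fun p hp => ?_
      rw [hb, hb, hβ2 ((τ - value μ k p) * η⁻¹)]
      · simp
      · rw [abs_mul, abs_inv, abs_of_pos hη, ← div_eq_mul_inv, le_div_iff₀ hη, one_mul]
        exact hexc τ hτ p hp
    have h1 : c ≤ ‖D τ‖ := by
      rw [hD1, Complex.norm_real, norm_neg]
      refine le_trans ?_ (Real.le_norm_self _)
      calc c = Λ⁻¹ * (Λ * (4 * (k : ℝ) ^ 5) / 192000) := by rw [hc]; field_simp
        _ ≤ Λ⁻¹ * ((box k).filter fun p => |τ - value μ k p| ≤ Λ / 2).card := by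
          gcongr
          exact hcard τ hτI
        _ = ∑ p ∈ (box k).filter fun p => |τ - value μ k p| ≤ Λ / 2, Λ⁻¹ := by
          rw [sum_const, nsmul_eq_mul, mul_comm]
        _ = ∑ p ∈ (box k).filter fun p => |τ - value μ k p| ≤ Λ / 2,
            Λ⁻¹ * β ((τ - value μ k p) * Λ⁻¹) := by
          refine sum_congr rfl fun p hp => ?_
          rw [hβ1, mul_one]
          rw [abs_mul, abs_inv, abs_of_pos hΛ0, ← div_eq_mul_inv, div_le_iff₀ hΛ0]
          linarith [(mem_filter.1 hp).2]
        _ ≤ _ := sum_le_sum_of_subset_of_nonneg (filter_subset _ _) fun p _ _ =>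
          mul_nonneg (inv_nonneg.2 hΛ0.le) (hβ0 _)
    have hc0 : 0 ≤ c := by positivity
    exact ENNReal.ofReal_le_ofReal (by gcongr)
  have hc2 : 0 < c ^ 2 := by positivity
  have h := (mul_meas_ge_le_lintegral hDm (ENNReal.ofReal (c ^ 2))).trans hDint
  have h2 : ENNReal.ofReal (ε * (4 / 192000) ^ 2 * (k : ℝ) ^ 19) =
      ENNReal.ofReal (c ^ 2) * ENNReal.ofReal (ε * (k : ℝ) ^ 9) := by
    rw [← ENNReal.ofReal_mul hc2.le, hc]
    congr 1
    ring
  rw [h2] at h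
  refine (measure_mono hlow).trans ?_
  exact (ENNReal.mul_le_mul_iff_right (ENNReal.ofReal_pos.2 hc2).ne' ENNReal.ofReal_ne_top).1 h

lemma exists_shift_exceptional {t : ℕ} (μ : Fin (5 + t) → ℝ) (η : ℝ) : ∃ c : ℝ, 0 ≤ c ∧
    ∀ τ ∈ exceptional μ η, τ - c ∈ exceptional (fun i => μ (Fin.castAdd t i)) η := by
  refine ⟨∑ i : Fin t, (((⌊μ (Fin.natAdd 5 i)⌋ + 1 : ℤ) : ℝ) - μ (Fin.natAdd 5 i)) ^ 3, ?_, ?_⟩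
  · refine sum_nonneg fun i _ => pow_nonneg ?_ 3
    have := Int.lt_floor_add_one (μ (Fin.natAdd 5 i))
    push_cast
    linarith
  · rintro τ hτ ⟨x, hx, h⟩
    refine hτ ⟨Fin.append x fun i => ⌊μ (Fin.natAdd 5 i)⌋ + 1, fun i => ?_, ?_⟩
    · refine Fin.addCases (fun i => ?_) (fun i => ?_) i
      · simpa using hx i
      · have := Int.lt_floor_add_one (μ (Fin.natAdd 5 i))
        rw [Fin.append_right]
        push_cast
        exact this
    · rw [Fin.sum_univ_add]
      simp only [Fin.append_left, Fin.append_right]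
      convert h using 2
      ring

lemma exists_pow_bracket {c X : ℝ} (K : ℕ) (hK : 100 ≤ K) (hX : 577 * ((K : ℝ) + 1) ^ 9 + c ≤ X) :
    ∃ k : ℕ, K ≤ k ∧ 577 * (k : ℝ) ^ 9 + c ≤ X ∧ X ≤ 640 * (k : ℝ) ^ 9 + c := by
  have hex : ∃ k : ℕ, X < 577 * ((k : ℝ) + 1) ^ 9 + c := by
    have : Tendsto (fun k : ℕ => 577 * ((k : ℝ) + 1) ^ 9 + c) atTop atTop :=
      tendsto_atTop_add_const_right _ _ (((tendsto_pow_atTop (by norm_num)).comp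
        (tendsto_atTop_add_const_right _ _ tendsto_natCast_atTop_atTop)).const_mul_atTop
          (by norm_num))
    exact (this.eventually_gt_atTop X).exists
  classical
  have hk := Nat.find_spec hex
  have hmin := fun m => Nat.find_min hex (m := m)
  set k := Nat.find hex
  have hKk : K < k := by
    by_contra! h
    have h' : (k : ℝ) ≤ K := by exact_mod_cast h
    have : 577 * ((k : ℝ) + 1) ^ 9 ≤ 577 * ((K : ℝ) + 1) ^ 9 := by gcongr
    linarith
  refine ⟨k, hKk.le, ?_, ?_⟩
  · have := hmin (k - 1) (by omega)
    rw [Nat.cast_sub (by omega), Nat.cast_one, sub_add_cancel, not_lt] at this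
    exact this
  · have h100 : (100 : ℝ) ≤ k := by exact_mod_cast hK.trans hKk.le
    have : ((k : ℝ) + 1) ^ 9 ≤ (101 / 100 * k) ^ 9 := by gcongr; linarith
    have h9 : 0 ≤ (k : ℝ) ^ 9 := by positivity
    rw [mul_pow] at this
    norm_num at this
    linarith

theorem volume_inter_Icc_le_of_dyadic {E : Set ℝ} {c : ℝ} (hc : 0 ≤ c)
    (h : ∀ ε : ℝ, 0 < ε → ∀ᶠ k : ℕ in atTop,
      volume (E ∩ Set.Icc (384 * (k : ℝ) ^ 9 + c) (640 * (k : ℝ) ^ 9 + c)) ≤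
        ENNReal.ofReal (ε * (k : ℝ) ^ 9)) {ε : ℝ} (hε : 0 < ε) :
    ∃ N₀ : ℝ, 0 ≤ N₀ ∧ ∀ N : ℝ, N₀ ≤ N →
      volume (E ∩ Set.Icc 0 N) ≤ ENNReal.ofReal (ε * N) := by
  set δ := ε / 6 with hδ
  have hδ0 : 0 < δ := by positivity
  obtain ⟨K₁, hK₁⟩ := eventually_atTop.1 (h δ hδ0)
  set K := max (max K₁ 100) ⌈c⌉₊ with hK
  have hcK : c ≤ K := (Nat.le_ceil c).trans (by exact_mod_cast le_max_right _ _)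
  have h100 : 100 ≤ K := le_trans (le_max_right _ _) (le_max_left _ _)
  have hK1K : K₁ ≤ K := le_trans (le_max_left _ _) (le_max_left _ _)
  set X₀ : ℝ := 577 * ((K : ℝ) + 1) ^ 9 + c with hX₀
  have hX₀0 : 0 < X₀ := by positivity
  have hstep : ∀ X, X₀ ≤ X → volume (E ∩ Set.Icc 0 X) ≤
      volume (E ∩ Set.Icc 0 (2 / 3 * X)) + ENNReal.ofReal (δ * X) := by
    intro X hX
    obtain ⟨k, hKk, hk1, hk2⟩ := exists_pow_bracket K h100 hX
    have hck : c ≤ (k : ℝ) ^ 9 := by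
      have h1 : (K : ℝ) ≤ k := by exact_mod_cast hKk
      have h2 : (1 : ℝ) ≤ k := by exact_mod_cast (le_trans (by norm_num) (h100.trans hKk))
      linarith [le_self_pow₀ h2 (show 9 ≠ 0 by norm_num)]
    have h9 : 0 ≤ (k : ℝ) ^ 9 := by positivity
    have hsub : E ∩ Set.Icc 0 X ⊆ E ∩ Set.Icc 0 (2 / 3 * X) ∪
        E ∩ Set.Icc (384 * (k : ℝ) ^ 9 + c) (640 * (k : ℝ) ^ 9 + c) := by
      rintro τ ⟨hτ, h0, h1⟩
      rcases le_total τ (2 / 3 * X) with h2 | h2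
      · exact Or.inl ⟨hτ, h0, h2⟩
      · exact Or.inr ⟨hτ, by linarith, by linarith⟩
    refine (measure_mono hsub).trans ((measure_union_le _ _).trans ?_)
    gcongr
    refine (hK₁ k (hK1K.trans hKk)).trans ?_
    gcongr
    linarith
  have hind : ∀ n : ℕ, ∀ X, 0 ≤ X → X ≤ X₀ * (3 / 2) ^ n →
      volume (E ∩ Set.Icc 0 X) ≤ ENNReal.ofReal (X₀ + 3 * δ * X) := by
    have hbase : ∀ X, 0 ≤ X → X ≤ X₀ →
        volume (E ∩ Set.Icc 0 X) ≤ ENNReal.ofReal (X₀ + 3 * δ * X) := by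
      intro X hX0 hX
      calc _ ≤ volume (Set.Icc 0 X) := measure_mono Set.inter_subset_right
        _ = ENNReal.ofReal X := by rw [Real.volume_Icc, sub_zero]
        _ ≤ _ := ENNReal.ofReal_le_ofReal (by
          have : 0 ≤ 3 * δ * X := by positivity
          linarith)
    intro n
    induction n with
    | zero => intro X hX0 hX; exact hbase X hX0 (by simpa using hX)
    | succ n ih =>
      intro X hX0 hX
      rcases le_total X X₀ with h1 | h1
      · exact hbase X hX0 h1
      · calc _ ≤ _ := hstep X h1
          _ ≤ ENNReal.ofReal (X₀ + 3 * δ * (2 / 3 * X)) + ENNReal.ofReal (δ * X) := by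
            gcongr
            refine ih _ (by positivity) ?_
            rw [pow_succ] at hX
            linarith
          _ = _ := by
            rw [← ENNReal.ofReal_add (by positivity) (by positivity)]
            congr 1
            ring
  refine ⟨2 * X₀ / ε, by positivity, fun N hN => ?_⟩
  have hN0 : 0 ≤ N := le_trans (by positivity) hN
  have hlim : Tendsto (fun n : ℕ => X₀ * (3 / 2 : ℝ) ^ n) atTop atTop :=
    (tendsto_pow_atTop_atTop_of_one_lt (by norm_num)).const_mul_atTop hX₀0
  obtain ⟨n, hn⟩ := (hlim.eventually_ge_atTop N).exists
  refine (hind n N hN0 hn).trans (ENNReal.ofReal_le_ofReal ?_)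
  rw [div_le_iff₀ hε] at hN
  rw [hδ]
  linarith

theorem volume_exceptional_le {t : ℕ} (μ : Fin (5 + t) → ℝ) (hμ : Irrational (μ (Fin.castAdd t 0)))
    {η ε : ℝ} (hη : 0 < η) (hε : 0 < ε) : ∃ N₀ : ℝ, 0 ≤ N₀ ∧ ∀ N : ℝ, N₀ ≤ N →
      volume (exceptional μ η ∩ Set.Icc 0 N) ≤ ENNReal.ofReal (ε * N) := by
  obtain ⟨c, hc, hshift⟩ := exists_shift_exceptional μ η
  refine volume_inter_Icc_le_of_dyadic hc (fun ε hε => ?_) hε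
  filter_upwards [volume_exceptional_inter_Icc_le (fun i => μ (Fin.castAdd t i)) hμ hη hε] with k hk
  refine le_trans ?_ hk
  rw [← measure_preimage_add_right volume (-c) (_ ∩ Set.Icc (384 * (k : ℝ) ^ 9) _)]
  refine measure_mono ?_
  rintro τ ⟨hτ, h1, h2⟩
  refine ⟨by simpa only [sub_eq_add_neg] using hshift τ hτ, ?_, ?_⟩
  · change _ ≤ τ + -c
    linarith
  · change τ + -c ≤ _
    linarith

end ShiftedCubes

/-- **Full density result.**
If `s ≥ 5`, `μ₁` is irrational and `η > 0`, then the measure of the set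
`Z(N)` of exceptional `τ ∈ [0, N]` (those not approximable within `η` by
`F(x) = ∑ᵢ (xᵢ - μᵢ)³` with integers `xᵢ > μᵢ`) is `o(N)` as `N → ∞`. -/
theorem sums_of_shifted_cubes_full_density
    (s : ℕ) (hs : 5 ≤ s) (μ : Fin s → ℝ)
    (hμ : Irrational (μ ⟨0, by omega⟩))
    (η : ℝ) (hη : 0 < η) :
    ∀ ε : ℝ, 0 < ε → ∃ N₀ : ℝ, ∀ N : ℝ, N₀ ≤ N →
      (volume {τ : ℝ | τ ∈ Set.Icc (0 : ℝ) N ∧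
        ¬ ∃ x : Fin s → ℤ, (∀ i, μ i < (x i : ℝ)) ∧
          |(∑ i, ((x i : ℝ) - μ i) ^ 3) - τ| < η}).toReal ≤ ε * N := by
  intro ε hε
  obtain ⟨t, rfl⟩ := Nat.exists_eq_add_of_le hs
  obtain ⟨N₀, hN₀, h⟩ := ShiftedCubes.volume_exceptional_le μ hμ hη hε
  refine ⟨N₀, fun N hN => ENNReal.toReal_le_of_le_ofReal
    (mul_nonneg hε.le (hN₀.trans hN)) (le_trans (measure_mono ?_) (h N hN))⟩
  exact fun τ hτ => ⟨hτ.2, hτ.1⟩
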